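/- Let ψ be an approximation function with lower order τ_ψ ≥ 2, and let f₁, f₂, λ ∈ C²(I) on an interval I be such that the planar curve C = {(f₁(x), f₂(x)) : x ∈ I} is non-degenerate at every point x ∈ I (i.e. the Wronskian f₁'(x)f₂''(x) − f₂'(x)f₁''(x) ≠ 0) except possibly on a set of x of Hausdorff dimension less than 3/(τ_ψ+1). Then the Hausdorff dimension of A₂(ψ,λ) equals 3/(τ_ψ+1). -/

import Mathlib

open MeasureTheory Filter Set

/-- Distance from a real number to the nearest integer. -/
noncomputable def nearestIntDist (x : ℝ) : ℝ := |x - round x|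

/-- The `s`-dimensional Hausdorff content on the real line. -/
noncomputable def hContent (s : ℝ) : OuterMeasure ℝ :=
  OuterMeasure.boundedBy fun E => Metric.ediam E ^ s

theorem hContent_le_of_dist {s d : ℝ} (hs : 0 < s) (hd : 0 ≤ d) {E : Set ℝ}
    (h : ∀ x ∈ E, ∀ y ∈ E, |x - y| ≤ d) : hContent s E ≤ ENNReal.ofReal (d ^ s) := by
  refine (OuterMeasure.boundedBy_le E).trans ?_
  rw [← ENNReal.ofReal_rpow_of_nonneg hd hs.le]
  refine ENNReal.rpow_le_rpow ?_ hs.le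
  refine Metric.ediam_le fun x hx y hy => ?_
  rw [edist_dist, Real.dist_eq]
  exact ENNReal.ofReal_le_ofReal (h x hx y hy)

theorem volume_le_hContent_one (E : Set ℝ) : volume E ≤ hContent 1 E := by
  have : (volume : Measure ℝ).toOuterMeasure ≤ hContent 1 := by
    refine OuterMeasure.le_boundedBy.2 fun s => ?_
    simpa using Real.volume_le_diam s
  exact this E

theorem exists_cover_of_hContent_eq_zero {s : ℝ} {E : Set ℝ} (h : hContent s E = 0)
    {ε : ENNReal} (hε : 0 < ε) : ∃ t : ℕ → Set ℝ, E ⊆ ⋃ n, t n ∧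
      ∑' n, ⨆ _ : (t n).Nonempty, Metric.ediam (t n) ^ s < ε := by
  rw [hContent, OuterMeasure.boundedBy_apply] at h
  rw [← h] at hε
  simpa only [iInf_lt_iff, exists_prop] using hε

theorem dimH_le_of_hContent_eq_zero {s : ℝ} (hs : 0 < s) {E : Set ℝ} (h : hContent s E = 0) :
    dimH E ≤ ENNReal.ofReal s := by
  have hz : Measure.hausdorffMeasure s E = 0 := by
    rw [Measure.hausdorffMeasure_apply]
    refine le_antisymm (iSup₂_le fun r hr => ?_) bot_le
    refine le_of_forall_pos_le_add fun ε hε => ?_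
    rw [zero_add]
    have hr' : 0 < r ^ s := by
      rcases eq_or_ne r ⊤ with rfl | hr1
      · simp [hs]
      · exact ENNReal.rpow_pos hr hr1
    obtain ⟨t, ht, hsum⟩ := exists_cover_of_hContent_eq_zero h (lt_min hε hr')
    refine iInf_le_of_le t <| iInf_le_of_le ht <| iInf_le_of_le (fun n => ?_) ?_
    · rcases (t n).eq_empty_or_nonempty with h0 | h0
      · simp [h0]
      · have h1 : Metric.ediam (t n) ^ s ≤ r ^ s := by
          refine le_trans ?_ (hsum.le.trans (min_le_right _ _))
          refine le_trans ?_ (ENNReal.le_tsum n)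
          simp [h0]
        exact (ENNReal.rpow_le_rpow_iff hs).1 h1
    · exact hsum.le.trans (min_le_left _ _)
  have := dimH_le_of_hausdorffMeasure_ne_top (s := E) (d := s.toNNReal)
    (by rw [Real.coe_toNNReal _ hs.le, hz]; simp)
  simpa [ENNReal.ofReal] using this

theorem hContent_eq_zero_of_dimH_lt {s : ℝ} (hs : 0 < s) {E : Set ℝ}
    (h : dimH E < ENNReal.ofReal s) : hContent s E = 0 := by
  have hz : Measure.hausdorffMeasure s E = 0 := by
    have := hausdorffMeasure_of_dimH_lt (s := E) (d := s.toNNReal) h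
    rwa [Real.coe_toNNReal _ hs.le] at this
  rw [Measure.hausdorffMeasure_apply] at hz
  refine le_antisymm ?_ bot_le
  rw [← hz, hContent, OuterMeasure.boundedBy_apply]
  refine le_iSup₂_of_le 1 one_pos ?_
  refine le_iInf fun t => le_iInf fun ht => le_iInf fun _ => ?_
  exact iInf₂_le t ht

theorem exists_balls_of_dimH_lt {s : ℝ} (hs : 0 < s) {E : Set ℝ}
    (h : dimH E < ENNReal.ofReal s) {ε : ℝ} (hε : 0 < ε) :
    ∃ c d : ℕ → ℝ, (∀ i, 0 < d i) ∧ (∀ x ∈ E, ∃ i, |x - c i| ≤ d i) ∧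
      Summable (fun i => d i ^ s) ∧ ∑' i, d i ^ s ≤ ε := by
  obtain ⟨t, ht, hsum⟩ := exists_cover_of_hContent_eq_zero (hContent_eq_zero_of_dimH_lt hs h)
    (ENNReal.ofReal_pos.2 (half_pos hε))
  set W : ℕ → ENNReal := fun n => ⨆ _ : (t n).Nonempty, Metric.ediam (t n) ^ s with hW
  have hWtop : ∑' n, W n ≠ ⊤ := (hsum.trans ENNReal.ofReal_lt_top).ne
  have hWn : ∀ n, W n ≠ ⊤ := fun n => ENNReal.ne_top_of_tsum_ne_top hWtop n
  have hWs : Summable fun n => (W n).toReal := ENNReal.summable_toReal hWtop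
  have hWe : ∑' n, (W n).toReal ≤ ε / 2 := by
    rw [← ENNReal.tsum_toReal_eq hWn]
    exact ENNReal.toReal_le_of_le_ofReal (half_pos hε).le hsum.le
  have hg := hasSum_geometric_two' (ε / 2)
  have hpos : ∀ n, 0 < (W n).toReal + ε / 2 / 2 / 2 ^ n := fun n => by positivity
  have hds : ∀ n, (((W n).toReal + ε / 2 / 2 / 2 ^ n) ^ (1 / s)) ^ s
      = (W n).toReal + ε / 2 / 2 / 2 ^ n := fun n => by
    rw [← Real.rpow_mul (hpos n).le, one_div_mul_cancel hs.ne', Real.rpow_one]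
  classical
  refine ⟨fun n => if h : (t n).Nonempty then h.some else 0,
    fun n => ((W n).toReal + ε / 2 / 2 / 2 ^ n) ^ (1 / s),
    fun n => Real.rpow_pos_of_pos (hpos n) _, fun x hx => ?_, ?_, ?_⟩
  · obtain ⟨n, hn⟩ := mem_iUnion.1 (ht hx)
    have hne : (t n).Nonempty := ⟨x, hn⟩
    refine ⟨n, ?_⟩
    simp only [hne, dite_true]
    have h1 : edist x hne.some ≤ Metric.ediam (t n) := Metric.edist_le_ediam_of_mem hn hne.some_mem
    have h2 : Metric.ediam (t n) ^ s ≤ W n := by simp [hW, hne]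
    have h3 : edist x hne.some ^ s ≤ W n := (ENNReal.rpow_le_rpow h1 hs.le).trans h2
    have h4 := ENNReal.toReal_mono (hWn n) h3
    rw [← ENNReal.toReal_rpow, edist_dist, ENNReal.toReal_ofReal dist_nonneg, Real.dist_eq] at h4
    refine (Real.rpow_le_rpow_iff (abs_nonneg _) (Real.rpow_nonneg (hpos n).le _) hs).1 ?_
    rw [hds]
    have : 0 < ε / 2 / 2 / 2 ^ n := by positivity
    linarith
  · simp only [hds]
    exact hWs.add hg.summable
  · simp only [hds]
    rw [hWs.tsum_add hg.summable, hg.tsum_eq]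
    linarith

theorem card_le_of_separated {g : ℝ} (hg : 0 < g) {P : Finset ℝ}
    (hP : ∀ y ∈ P, ∀ z ∈ P, y ≠ z → g < |y - z|) {c d : ℝ} (hd : 0 ≤ d)
    (hPc : ∀ y ∈ P, |c - y| ≤ d) : (P.card : ℝ) ≤ 2 * d / g + 2 := by
  have hmaps : ∀ y ∈ P, ⌊y / g⌋ ∈ Finset.Icc ⌊(c - d) / g⌋ ⌊(c + d) / g⌋ := fun y hy => by
    have := abs_le.1 (hPc y hy)
    rw [Finset.mem_Icc]
    exact ⟨Int.floor_le_floor (by gcongr; linarith), Int.floor_le_floor (by gcongr; linarith)⟩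
  have hinj : Set.InjOn (fun y : ℝ => ⌊y / g⌋) P := fun y hy z hz hyz => by
    by_contra hne
    have h1 := hP y hy z hz hne
    have h2 := Int.abs_sub_lt_one_of_floor_eq_floor hyz
    rw [← sub_div, abs_div, abs_of_pos hg, div_lt_one hg] at h2
    linarith
  have hcard := Finset.card_le_card_of_injOn _ hmaps hinj
  rw [Int.card_Icc] at hcard
  have hle : ⌊(c - d) / g⌋ ≤ ⌊(c + d) / g⌋ := Int.floor_le_floor (by gcongr; linarith)
  have h3 : ((⌊(c + d) / g⌋ + 1 - ⌊(c - d) / g⌋).toNat : ℝ)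
      = (⌊(c + d) / g⌋ : ℝ) + 1 - ⌊(c - d) / g⌋ := by
    have : ((⌊(c + d) / g⌋ + 1 - ⌊(c - d) / g⌋).toNat : ℤ)
      = ⌊(c + d) / g⌋ + 1 - ⌊(c - d) / g⌋ := Int.toNat_of_nonneg (by omega)
    exact_mod_cast this
  have h4 : (P.card : ℝ) ≤ (⌊(c + d) / g⌋ : ℝ) + 1 - ⌊(c - d) / g⌋ := by
    rw [← h3]; exact_mod_cast hcard
  have h5 := Int.floor_le ((c + d) / g)
  have h6 := Int.sub_one_lt_floor ((c - d) / g)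
  have h7 : 2 * d / g = (c + d) / g - (c - d) / g := by ring
  linarith

theorem exists_separated_net {g : ℝ} (hg : 0 < g) {S : Set ℝ} {c d : ℝ} (hd : 0 ≤ d)
    (hS : ∀ y ∈ S, |c - y| ≤ d) : ∃ P : Finset ℝ, (∀ y ∈ P, y ∈ S) ∧
      (∀ y ∈ P, ∀ z ∈ P, y ≠ z → g < |y - z|) ∧ ∀ x ∈ S, ∃ y ∈ P, |x - y| ≤ g := by
  classical
  let A : Set ℕ := {n | ∃ P : Finset ℝ, (∀ y ∈ P, y ∈ S) ∧
      (∀ y ∈ P, ∀ z ∈ P, y ≠ z → g < |y - z|) ∧ P.card = n}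
  have hA0 : A.Nonempty := ⟨0, ∅, by simp⟩
  have hAb : BddAbove A := by
    refine ⟨⌊2 * d / g + 2⌋₊, ?_⟩
    rintro n ⟨P, hPS, hP, rfl⟩
    exact Nat.le_floor (card_le_of_separated hg hP hd fun y hy => hS y (hPS y hy))
  obtain ⟨P, hPS, hP, hcard⟩ := Nat.sSup_mem hA0 hAb
  refine ⟨P, hPS, hP, fun x hx => ?_⟩
  by_contra! hcon
  have hxP : x ∉ P := fun h => by
    have := hcon x h
    simp at this
    linarith
  have : (insert x P).card ∈ A := by
    refine ⟨insert x P, ?_, ?_, rfl⟩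
    · intro y hy
      rcases Finset.mem_insert.1 hy with rfl | hy
      exacts [hx, hPS y hy]
    · intro y hy z hz hyz
      rcases Finset.mem_insert.1 hy with hy' | hy' <;> rcases Finset.mem_insert.1 hz with hz' | hz'
      · exact absurd (hy'.trans hz'.symm) hyz
      · rw [hy']; exact hcon z hz'
      · rw [hz', abs_sub_comm]; exact hcon y hy'
      · exact hP y hy' z hz' hyz
  have h2 := le_csSup hAb this
  rw [Finset.card_insert_of_notMem hxP, hcard] at h2
  omega

theorem exists_separated_of_volume {g r x : ℝ} (hg : 0 < g) (hr : 0 < r) {S : Set ℝ}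
    (hS : ENNReal.ofReal (r / 2) ≤
      volume (Metric.ball x (r / 2) ∩ ⋃ y ∈ S, Metric.closedBall y g)) :
    ∃ P : Finset ℝ, (∀ y ∈ P, y ∈ S ∧ |y - x| ≤ r / 2 + g) ∧
      (∀ y ∈ P, ∀ z ∈ P, y ≠ z → g < |y - z|) ∧ r / (8 * g) ≤ P.card := by
  obtain ⟨P, hPS, hP, hnet⟩ := exists_separated_net hg
    (S := {y | y ∈ S ∧ |y - x| ≤ r / 2 + g}) (c := x) (d := r / 2 + g) (by positivity)
    (fun y hy => by rw [abs_sub_comm]; exact hy.2)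
  refine ⟨P, hPS, hP, ?_⟩
  have hsub : Metric.ball x (r / 2) ∩ ⋃ y ∈ S, Metric.closedBall y g ⊆
      ⋃ p ∈ P, Metric.closedBall p (2 * g) := by
    rintro z ⟨hz, hz'⟩
    simp only [mem_iUnion, Metric.mem_closedBall, Metric.mem_ball, Real.dist_eq] at hz hz' ⊢
    obtain ⟨y, hy, hzy⟩ := hz'
    have h1 : |y - x| ≤ r / 2 + g := by
      have := abs_sub_le y z x
      rw [abs_sub_comm y z] at this
      linarith
    obtain ⟨p, hp, hyp⟩ := hnet y ⟨hy, h1⟩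
    refine ⟨p, hp, ?_⟩
    have := abs_sub_le z y p
    linarith
  have h1 := hS.trans ((measure_mono hsub).trans (measure_biUnion_finset_le P _))
  simp only [Real.volume_closedBall, Finset.sum_const, nsmul_eq_mul] at h1
  rw [← ENNReal.ofReal_natCast, ← ENNReal.ofReal_mul (by positivity),
    ENNReal.ofReal_le_ofReal_iff (by positivity)] at h1
  rw [div_le_iff₀ (by positivity)]
  linarith

theorem exists_child_ball {s ρ v : ℝ} (hs0 : 0 < s) (hs1 : s < 1) (hρ : 0 < ρ) (hρv : ρ ≤ v)
    (hsv : s * v < ρ) {c d : ℕ → ℝ} (hd : ∀ i, 0 < d i) (hsum : Summable fun i => d i ^ s)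
    {X : ℝ → Set ℝ} {x r : ℝ} (hr : 0 < r)
    (hX : ∀ N : ℝ, ∃ q ≥ N, ENNReal.ofReal (r / 2) ≤
      volume (Metric.ball x (r / 2) ∩ ⋃ y ∈ X q, Metric.closedBall y (q ^ (-ρ))))
    (hinv : ∑' i, (if |c i - x| ≤ d i + r then d i ^ s else 0) ≤ (1 / 96) ^ s * r ^ s) (N : ℝ) :
    ∃ q ≥ N, ∃ y ∈ X q, 0 < q ^ (-v) ∧ |y - x| + q ^ (-v) ≤ r ∧ q ^ (-v) ≤ r / 2 ∧
      ∑' i, (if |c i - y| ≤ d i + q ^ (-v) then d i ^ s else 0) ≤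
        (1 / 96) ^ s * (q ^ (-v)) ^ s := by
  have hev : ∀ᶠ q : ℝ in atTop, N ≤ q ∧ 1 ≤ q ∧ q ^ (-ρ) < r / 4 ∧
      96 * r ^ s / r < q ^ (ρ - s * v) :=
    (eventually_ge_atTop N).and <| (eventually_ge_atTop 1).and <|
      ((tendsto_rpow_neg_atTop hρ).eventually_lt_const (by positivity)).and
      ((tendsto_rpow_atTop (by linarith)).eventually_gt_atTop _)
  obtain ⟨N', hN'⟩ := eventually_atTop.1 hev
  obtain ⟨q, hq, hvol⟩ := hX N'
  obtain ⟨hqN, hq1, hgr, hbig⟩ := hN' q hq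
  have hq0 : 0 < q := by linarith
  set g := q ^ (-ρ) with hg_def
  set r' := q ^ (-v) with hr'_def
  have hg : 0 < g := Real.rpow_pos_of_pos hq0 _
  have hr' : 0 < r' := Real.rpow_pos_of_pos hq0 _
  have hr'g : r' ≤ g := Real.rpow_le_rpow_of_exponent_le hq1 (by linarith)
  obtain ⟨P, hPX, hPsep, hPcard⟩ := exists_separated_of_volume hg hr hvol
  refine ⟨q, hqN, ?_⟩
  set κ : ℝ := (1 / 96 : ℝ) ^ s with hκ_def
  have hκ : 0 < κ := by positivity
  set w : ℕ → ℝ := fun i => if g ≤ d i then 1 else d i ^ s / (κ * r' ^ s) with hw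
  have hds : ∀ i, 0 < d i ^ s := fun i => Real.rpow_pos_of_pos (hd i) _
  have hr's : 0 < r' ^ s := Real.rpow_pos_of_pos hr' _
  have hgs : 0 < g ^ s := Real.rpow_pos_of_pos hg _
  have hw0 : ∀ i, 0 ≤ w i := fun i => by
    simp only [hw]; split_ifs
    · exact zero_le_one
    · exact div_nonneg (hds i).le (by positivity)
  have hwle : ∀ i, w i ≤ (1 / g ^ s + 1 / (κ * r' ^ s)) * d i ^ s := fun i => by
    have h1 : 0 < 1 / g ^ s * d i ^ s := by have := hds i; positivity
    have h2 : 0 < 1 / (κ * r' ^ s) * d i ^ s := by have := hds i; positivity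
    simp only [hw]; split_ifs with h
    · have : 1 ≤ 1 / g ^ s * d i ^ s := by
        rw [one_div, ← div_eq_inv_mul, one_le_div hgs]
        exact Real.rpow_le_rpow hg.le h hs0.le
      linarith
    · have : d i ^ s / (κ * r' ^ s) = 1 / (κ * r' ^ s) * d i ^ s := by ring
      linarith
  have hwsum : Summable w := Summable.of_nonneg_of_le hw0 hwle (hsum.mul_left _)
  have hite : ∀ (p : ℕ → Prop) [DecidablePred p] {u : ℕ → ℝ}, (∀ i, 0 ≤ u i) → Summable u →
      Summable fun i => if p i then u i else 0 := fun p _ u hu0 hu =>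
    Summable.of_nonneg_of_le (fun i => by split_ifs <;> simp [hu0 i])
      (fun i => by split_ifs <;> simp [hu0 i]) hu
  have hinvs : Summable fun i => if |c i - x| ≤ d i + r then d i ^ s else 0 :=
    hite _ (fun i => (hds i).le) hsum
  have hcost : ∀ y ∈ P, Summable fun i => if |c i - y| ≤ d i + r' then w i else 0 :=
    fun y _ => hite _ hw0 hwsum
  have htot : ∑ y ∈ P, ∑' i, (if |c i - y| ≤ d i + r' then w i else 0) < P.card := by
    rw [← Summable.tsum_finsetSum hcost]
    have hterm : ∀ i, ∑ y ∈ P, (if |c i - y| ≤ d i + r' then w i else 0) ≤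
        (6 * (r / 96) ^ (1 - s) / g + 6 / (κ * r' ^ s)) *
          (if |c i - x| ≤ d i + r then d i ^ s else 0) := by
      intro i
      rw [← Finset.sum_filter, Finset.sum_const, nsmul_eq_mul]
      set P' := P.filter fun y => |c i - y| ≤ d i + r' with hP'
      have hP'c : (P'.card : ℝ) ≤ 2 * (d i + r') / g + 2 :=
        card_le_of_separated hg (fun y hy z hz => hPsep y (Finset.mem_of_mem_filter y hy) z
          (Finset.mem_of_mem_filter z hz)) (by have := hd i; positivity)
          fun y hy => (Finset.mem_filter.1 hy).2
      rcases P'.eq_empty_or_nonempty with h0 | ⟨y, hy⟩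
      · rw [h0]
        simp only [Finset.card_empty, Nat.cast_zero, zero_mul]
        refine mul_nonneg (by positivity) ?_
        split_ifs
        exacts [(hds i).le, le_rfl]
      obtain ⟨hyP, hyd⟩ := Finset.mem_filter.1 hy
      have hmeet : |c i - x| ≤ d i + r := by
        have := abs_sub_le (c i) y x
        have := (hPX y hyP).2
        linarith
      rw [if_pos hmeet]
      have hdi : d i ≤ r / 96 := by
        have h1 : d i ^ s ≤ (1 / 96 * r) ^ s := by
          rw [Real.mul_rpow (by norm_num) hr.le]
          refine le_trans ?_ hinv
          refine le_trans ?_ (hinvs.le_tsum i fun j _ => ?_)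
          · simp [hmeet]
          · split_ifs
            exacts [(hds j).le, le_rfl]
        have := (Real.rpow_le_rpow_iff (hd i).le (by positivity) hs0).1 h1
        linarith
      have hA : 0 ≤ 6 * (r / 96) ^ (1 - s) / g * d i ^ s := by have := hds i; positivity
      have hB : 0 ≤ 6 / (κ * r' ^ s) * d i ^ s := by have := hds i; positivity
      rw [add_mul]
      simp only [hw]
      split_ifs with hgd
      · have h1 : (P'.card : ℝ) ≤ 6 * d i / g := by
          refine hP'c.trans ?_
          rw [div_add' _ _ _ hg.ne']
          gcongr
          linarith
        have h2 : d i ≤ (r / 96) ^ (1 - s) * d i ^ s := by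
          calc d i = d i ^ (1 - s) * d i ^ s := by
                rw [← Real.rpow_add (hd i)]; simp
            _ ≤ _ := by
                have := hds i
                gcongr
                exact (hd i).le
        have h3 : 6 * d i / g ≤ 6 * (r / 96) ^ (1 - s) / g * d i ^ s := by
          rw [div_mul_eq_mul_div, mul_assoc]
          gcongr
        linarith
      · have h1 : (P'.card : ℝ) ≤ 6 := by
          refine hP'c.trans ?_
          have : 2 * (d i + r') / g ≤ 4 := by
            rw [div_le_iff₀ hg]; push Not at hgd; linarith
          linarith
        have h2 : (P'.card : ℝ) * (d i ^ s / (κ * r' ^ s)) ≤ 6 * (d i ^ s / (κ * r' ^ s)) := by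
          have := hds i
          gcongr
        have h3 : 6 * (d i ^ s / (κ * r' ^ s)) = 6 / (κ * r' ^ s) * d i ^ s := by ring
        linarith
    have hsumm : Summable fun i => ∑ y ∈ P, (if |c i - y| ≤ d i + r' then w i else 0) :=
      summable_sum hcost
    have h1 := (hsumm.tsum_le_tsum hterm (hinvs.mul_left _)).trans_eq tsum_mul_left
    refine h1.trans_lt ?_
    refine lt_of_le_of_lt (mul_le_mul_of_nonneg_left hinv (by positivity)) ?_
    refine lt_of_lt_of_le ?_ hPcard
    have hrs : 0 < r ^ s := Real.rpow_pos_of_pos hr _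
    have e1 : (r / 96) ^ (1 - s) * ((1 / 96) ^ s * r ^ s) = r / 96 := by
      rw [← Real.mul_rpow (by norm_num) hr.le, one_div_mul_eq_div, ← Real.rpow_add (by positivity)]
      simp
    have e2 : (6 * (r / 96) ^ (1 - s) / g + 6 / (κ * r' ^ s)) * (κ * r ^ s)
        = r / (16 * g) + 6 * r ^ s / r' ^ s := by
      have : (6 * (r / 96) ^ (1 - s) / g + 6 / (κ * r' ^ s)) * (κ * r ^ s)
        = 6 * ((r / 96) ^ (1 - s) * (κ * r ^ s)) / g + 6 * r ^ s / r' ^ s := by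
        field_simp
      rw [this, e1]
      field_simp
      ring
    rw [e2]
    have e3 : 6 * r ^ s / r' ^ s < r / (16 * g) := by
      have h5 : q ^ (ρ - s * v) = r' ^ s / g := by
        rw [hr'_def, hg_def, ← Real.rpow_mul hq0.le, ← Real.rpow_sub hq0]
        congr 1; ring
      rw [h5, div_lt_div_iff₀ hr hg] at hbig
      rw [div_lt_div_iff₀ hr's (by positivity)]
      linarith
    have e4 : r / (8 * g) = r / (16 * g) + r / (16 * g) := by field_simp; ring
    linarith
  obtain ⟨y, hyP, hy⟩ : ∃ y ∈ P, ∑' i, (if |c i - y| ≤ d i + r' then w i else 0) < 1 := by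
    by_contra! hcon
    have := Finset.sum_le_sum hcon
    simp only [Finset.sum_const, nsmul_eq_mul, mul_one] at this
    linarith
  refine ⟨y, (hPX y hyP).1, hr', ?_, by linarith, ?_⟩
  · have := (hPX y hyP).2
    linarith
  have hsmall : ∀ i, |c i - y| ≤ d i + r' → d i < g := by
    intro i hi
    by_contra! hgi
    have h1 := (hcost y hyP).le_tsum i fun j _ => by
      split_ifs
      exacts [hw0 j, le_rfl]
    simp only [hi, if_true, hw, hgi] at h1
    exact absurd (h1.trans_lt hy) (lt_irrefl _)
  have heq : ∀ i, (if |c i - y| ≤ d i + r' then d i ^ s else 0) =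
      κ * r' ^ s * (if |c i - y| ≤ d i + r' then w i else 0) := by
    intro i
    split_ifs with h
    · simp only [hw, if_neg (not_le.2 (hsmall i h))]
      field_simp
    · simp
  rw [tsum_congr heq, tsum_mul_left]
  have : 0 < κ * r' ^ s := by positivity
  nlinarith

theorem le_dimH_of_ubiquitous {s ρ v α β : ℝ} (hs0 : 0 < s) (hs1 : s < 1) (hρ : 0 < ρ)
    (hρv : ρ ≤ v) (hsv : s * v < ρ) (hαβ : α < β) {X : ℝ → Set ℝ} {E : Set ℝ}
    (hX : ∀ x r : ℝ, 0 < r → Metric.closedBall x r ⊆ Ioo α β → ∀ N : ℝ, ∃ q ≥ N,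
      ENNReal.ofReal (r / 2) ≤
        volume (Metric.ball x (r / 2) ∩ ⋃ y ∈ X q, Metric.closedBall y (q ^ (-ρ))))
    (hE : ∀ x ∈ Ioo α β, (∀ N : ℝ, ∃ q ≥ N, ∃ y ∈ X q, |x - y| ≤ q ^ (-v)) → x ∈ E) :
    ENNReal.ofReal s ≤ dimH E := by
  by_contra! hlt
  set r₀ := (β - α) / 4 with hr₀
  have hr₀pos : 0 < r₀ := by rw [hr₀]; linarith
  obtain ⟨c, d, hd, hcov, hsum, hle⟩ := exists_balls_of_dimH_lt hs0 hlt
    (ε := (1 / 96) ^ s * r₀ ^ s) (by positivity)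
  have hds : ∀ i, 0 < d i ^ s := fun i => Real.rpow_pos_of_pos (hd i) _
  have hite : ∀ y r : ℝ, Summable fun i => if |c i - y| ≤ d i + r then d i ^ s else 0 :=
    fun y r => Summable.of_nonneg_of_le (fun i => by split_ifs <;> simp [(hds i).le])
      (fun i => by split_ifs <;> simp [(hds i).le]) hsum
  let Inv : ℝ × ℝ → Prop := fun p => 0 < p.2 ∧ Metric.closedBall p.1 p.2 ⊆ Ioo α β ∧
    ∑' i, (if |c i - p.1| ≤ d i + p.2 then d i ^ s else 0) ≤ (1 / 96) ^ s * p.2 ^ s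
  have hstep : ∀ (p : {p // Inv p}) (n : ℕ), ∃ p' : {p // Inv p},
      Metric.closedBall p'.1.1 p'.1.2 ⊆ Metric.closedBall p.1.1 p.1.2 ∧ p'.1.2 ≤ p.1.2 / 2 ∧
      ∃ q : ℝ, n ≤ q ∧ p'.1.1 ∈ X q ∧ p'.1.2 = q ^ (-v) := by
    rintro ⟨⟨x, r⟩, hr, hsub, hinv⟩ n
    obtain ⟨q, hq, y, hy, h0, h1, h2, h3⟩ := exists_child_ball hs0 hs1 hρ hρv hsv hd hsum hr
      (hX x r hr hsub) hinv n
    have hsub' : Metric.closedBall y (q ^ (-v)) ⊆ Metric.closedBall x r :=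
      Metric.closedBall_subset_closedBall' (by rw [Real.dist_eq]; linarith)
    exact ⟨⟨(y, q ^ (-v)), h0, hsub'.trans hsub, h3⟩, hsub', h2, q, hq, hy, rfl⟩
  choose next hnext1 hnext2 hnext3 using hstep
  have hinit : Inv ((α + β) / 2, r₀) := by
    refine ⟨hr₀pos, fun z hz => ?_, ?_⟩
    · rw [Metric.mem_closedBall, Real.dist_eq] at hz
      have hz := abs_le.1 hz
      simp only [hr₀] at hz
      constructor <;> linarith
    · refine (Summable.tsum_le_tsum (fun i => ?_) (hite _ _) hsum).trans hle
      split_ifs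
      exacts [le_rfl, (hds i).le]
  let S : ℕ → {p // Inv p} := fun n => Nat.rec ⟨_, hinit⟩ (fun k p => next p k) n
  have hS : ∀ n, S (n + 1) = next (S n) n := fun n => rfl
  obtain ⟨z, hz⟩ := IsCompact.nonempty_iInter_of_sequence_nonempty_isCompact_isClosed
    (fun n => Metric.closedBall (S n).1.1 (S n).1.2)
    (fun n => by simpa only [hS n] using hnext1 (S n) n)
    (fun n => ⟨_, Metric.mem_closedBall_self (S n).2.1.le⟩) (isCompact_closedBall _ _)
    (fun n => Metric.isClosed_closedBall)
  rw [mem_iInter] at hz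
  have hrad : ∀ n, (S n).1.2 ≤ r₀ * (1 / 2) ^ n := by
    intro n
    induction n with
    | zero => simp [S]
    | succ n ih =>
      have := hnext2 (S n) n
      rw [← hS n] at this
      rw [pow_succ]
      linarith
  have hzE : z ∈ E := by
    refine hE z ((S 0).2.2.1 (hz 0)) fun N => ?_
    obtain ⟨n, hn⟩ := exists_nat_ge N
    obtain ⟨q, hq, hy, hrq⟩ := hnext3 (S n) n
    refine ⟨q, hn.trans hq, _, hy, ?_⟩
    have := hz (n + 1)
    rw [hS n, Metric.mem_closedBall, Real.dist_eq, hrq] at this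
    exact this
  obtain ⟨i, hi⟩ := hcov z hzE
  have hsmall : ∀ n, d i ^ s ≤ (1 / 96) ^ s * (S n).1.2 ^ s := by
    intro n
    refine le_trans ?_ (S n).2.2.2
    refine le_trans ?_ ((hite _ _).le_tsum i fun j _ => ?_)
    · have h1 := hz n
      rw [Metric.mem_closedBall, Real.dist_eq] at h1
      have h2 := abs_sub_le (c i) z (S n).1.1
      rw [abs_sub_comm (c i) z] at h2
      rw [if_pos (by linarith)]
    · split_ifs
      exacts [(hds j).le, le_rfl]
  have hlim : Tendsto (fun n : ℕ => r₀ * (1 / 2 : ℝ) ^ n) atTop (nhds 0) := by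
    simpa using (tendsto_pow_atTop_nhds_zero_of_lt_one (by norm_num : (0 : ℝ) ≤ 1 / 2)
      (by norm_num)).const_mul r₀
  obtain ⟨n, hn⟩ := (hlim.eventually_lt_const (hd i)).exists
  have h1 := hsmall n
  rw [← Real.mul_rpow (by norm_num) (S n).2.1.le,
    Real.rpow_le_rpow_iff (hd i).le (mul_nonneg (by norm_num) (S n).2.1.le) hs0] at h1
  have h2 := hrad n
  have h3 := (S n).2.1
  linarith

theorem exists_primitive_triple (x y z : ℤ) (h : x ≠ 0 ∨ y ≠ 0 ∨ z ≠ 0) :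
    ∃ G x' y' z' u v w : ℤ, G ≠ 0 ∧ x = G * x' ∧ y = G * y' ∧ z = G * z' ∧
      u * x' + v * y' + w * z' = 1 := by
  obtain ⟨G, hG⟩ := IsPrincipalIdealRing.principal (Ideal.span {x, y, z} : Ideal ℤ)
  have hdvd : ∀ t ∈ (Ideal.span {x, y, z} : Ideal ℤ), ∃ t', t = G * t' := fun t ht => by
    rw [hG] at ht
    obtain ⟨a, ha⟩ := Submodule.mem_span_singleton.1 ht
    exact ⟨a, by rw [← ha, smul_eq_mul, mul_comm]⟩
  obtain ⟨x', hx⟩ := hdvd x (Ideal.subset_span (by simp))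
  obtain ⟨y', hy⟩ := hdvd y (Ideal.subset_span (by simp))
  obtain ⟨z', hz⟩ := hdvd z (Ideal.subset_span (by simp))
  have hG0 : G ≠ 0 := by
    rintro rfl
    simp_all
  have hmem : G ∈ (Ideal.span {x, y, z} : Ideal ℤ) := by
    rw [hG]; exact Submodule.mem_span_singleton_self G
  obtain ⟨u, t, ht, hu⟩ := Ideal.mem_span_insert.1 hmem
  obtain ⟨v, w, hvw⟩ := Ideal.mem_span_pair.1 ht
  refine ⟨G, x', y', z', u, v, w, hG0, hx, hy, hz, ?_⟩
  apply mul_left_cancel₀ hG0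
  linear_combination (-1 : ℤ) * hu + hvw - u * hx - v * hy - w * hz

/-- The determinant of the last two coordinates of two integer triples. -/
def planarCross (B B' : ℤ × ℤ × ℤ) : ℤ := B.2.1 * B'.2.2 - B.2.2 * B'.2.1

theorem Finset.card_le_of_abs_le {ι : Type*} {D : Finset ι} {j : ι → ℤ} (hj : Set.InjOn j D)
    {m : ℤ} (hm : 0 ≤ m) (h : ∀ B ∈ D, |j B| ≤ m) : (D.card : ℤ) ≤ 2 * m + 1 := by
  have := Finset.card_le_card_of_injOn (t := Finset.Icc (-m) m) j
    (fun B hB => by rw [Finset.mem_coe, Finset.mem_Icc]; exact abs_le.1 (h B hB)) hj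
  rw [Int.card_Icc] at this
  omega

theorem exists_large_multiple_of_collinear {D : Finset (ℤ × ℤ × ℤ)} (h3 : 3 ≤ D.card)
    (h0 : (0 : ℤ × ℤ × ℤ) ∈ D) (hinj : ∀ B ∈ D, ∀ B' ∈ D, B.2 = B'.2 → B = B')
    (hcol : ∀ B ∈ D, ∀ B' ∈ D, planarCross B B' = 0) :
    ∃ B ∈ D, ∃ j b₁ b₂ : ℤ, (b₁ ≠ 0 ∨ b₂ ≠ 0) ∧ B.2.1 = j * b₁ ∧ B.2.2 = j * b₂ ∧
      (D.card : ℤ) ≤ 3 * |j| := by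
  obtain ⟨B₁, hB₁, hne⟩ : ∃ B ∈ D, B ≠ 0 := by
    obtain ⟨B, hB, hne⟩ := Finset.exists_mem_ne (by omega : 1 < D.card) 0
    exact ⟨B, hB, hne⟩
  have hne' : (0 : ℤ) ≠ 0 ∨ B₁.2.1 ≠ 0 ∨ B₁.2.2 ≠ 0 := by
    right
    by_contra! hcon
    exact hne (hinj B₁ hB₁ 0 h0 (Prod.ext hcon.1 hcon.2))
  obtain ⟨G, x', b₁, b₂, u, v, w, hG, hx, h1, h2, hbez⟩ := exists_primitive_triple _ _ _ hne'
  have hx' : x' = 0 := by simpa [hG] using hx.symm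
  rw [hx', mul_zero, zero_add] at hbez
  have hj : ∀ B ∈ D, B.2.1 = (v * B.2.1 + w * B.2.2) * b₁ ∧
      B.2.2 = (v * B.2.1 + w * B.2.2) * b₂ := by
    intro B hB
    have h := hcol B hB B₁ hB₁
    rw [planarCross, h1, h2] at h
    have h' : B.2.1 * b₂ - B.2.2 * b₁ = 0 := by
      apply mul_left_cancel₀ hG
      linear_combination h
    constructor
    · linear_combination (-B.2.1) * hbez + w * h'
    · linear_combination (-B.2.2) * hbez - v * h'
  have hjinj : Set.InjOn (fun B : ℤ × ℤ × ℤ => v * B.2.1 + w * B.2.2) D := by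
    intro B hB B' hB' heq
    simp only at heq
    refine hinj B hB B' hB' (Prod.ext ?_ ?_)
    · rw [(hj B hB).1, (hj B' hB').1, heq]
    · rw [(hj B hB).2, (hj B' hB').2, heq]
  by_contra! hcon
  have hb : b₁ ≠ 0 ∨ b₂ ≠ 0 := by
    by_contra! hb
    rw [hb.1, hb.2] at hbez
    simp at hbez
  have hbound : ∀ B ∈ D, |v * B.2.1 + w * B.2.2| ≤ ((D.card : ℤ) - 1) / 3 := fun B hB => by
    have := hcon B hB _ b₁ b₂ hb (hj B hB).1 (hj B hB).2
    omega
  have := Finset.card_le_of_abs_le hjinj (by omega) hbound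
  omega

theorem planarCross_eq_mul_of_plane {p₀ p₁ p₂ u v w : ℤ} (hbez : u * p₀ + v * p₁ + w * p₂ = 1)
    {B B' : ℤ × ℤ × ℤ} (hB : p₀ * B.1 + p₁ * B.2.1 + p₂ * B.2.2 = 0)
    (hB' : p₀ * B'.1 + p₁ * B'.2.1 + p₂ * B'.2.2 = 0) :
    planarCross B B' = p₀ * (u * planarCross B B' + v * (B.2.2 * B'.1 - B.1 * B'.2.2)
      + w * (B.1 * B'.2.1 - B.2.1 * B'.1)) := by
  simp only [planarCross]
  linear_combination (-(B.2.1 * B'.2.2 - B.2.2 * B'.2.1)) * hbez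
    + (v * B'.2.2 - w * B'.2.1) * hB - (v * B.2.2 - w * B.2.1) * hB'

theorem card_mul_le_of_plane {p₀ p₁ p₂ u v w : ℤ} (hp₀ : p₀ ≠ 0)
    (hbez : u * p₀ + v * p₁ + w * p₂ = 1) {D : Finset (ℤ × ℤ × ℤ)}
    (hD : ∀ B ∈ D, p₀ * B.1 + p₁ * B.2.1 + p₂ * B.2.2 = 0) {B₁ B₂ : ℤ × ℤ × ℤ}
    (hB₁ : B₁ ∈ D) (hB₂ : B₂ ∈ D) (hne : planarCross B₁ B₂ ≠ 0)
    (h1 : ∀ B ∈ D, |planarCross B B₁| ≤ |planarCross B₁ B₂|)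
    (h2 : ∀ B ∈ D, |planarCross B B₂| ≤ |planarCross B₁ B₂|) :
    (D.card : ℤ) * |p₀| ≤ 15 * |planarCross B₁ B₂| := by
  have hB₁0 : B₁.1 ≠ 0 ∨ B₁.2.1 ≠ 0 ∨ B₁.2.2 ≠ 0 := by
    by_contra! hcon
    exact hne (by simp [planarCross, hcon.2.1, hcon.2.2])
  obtain ⟨G, c₀, c₁, c₂, u', v', w', hG, e0, e1, e2, hbez'⟩ := exists_primitive_triple _ _ _ hB₁0
  set C : ℤ × ℤ × ℤ := (c₀, c₁, c₂) with hC
  have hCp : p₀ * C.1 + p₁ * C.2.1 + p₂ * C.2.2 = 0 := by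
    apply mul_left_cancel₀ hG
    have := hD B₁ hB₁
    rw [e0, e1, e2] at this
    simp only [hC]
    linear_combination this
  have hcr : ∀ B, planarCross B B₁ = G * planarCross B C := fun B => by
    simp only [planarCross, hC]
    rw [e1, e2]; ring
  have hcr' : planarCross B₁ B₂ = G * planarCross C B₂ := by
    simp only [planarCross, hC]
    rw [e1, e2]; ring
  let m : ℤ × ℤ × ℤ → ℤ := fun B => u * planarCross B C + v * (B.2.2 * C.1 - B.1 * C.2.2)
      + w * (B.1 * C.2.1 - B.2.1 * C.1)
  have hm : ∀ B ∈ D, planarCross B C = p₀ * m B := fun B hB =>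
    planarCross_eq_mul_of_plane hbez (hD B hB) hCp
  obtain ⟨t, ht⟩ : ∃ t, planarCross C B₂ = p₀ * t :=
    ⟨_, planarCross_eq_mul_of_plane hbez hCp (hD B₂ hB₂)⟩
  have ht0 : t ≠ 0 := by
    rintro rfl
    exact hne (by rw [hcr', ht]; ring)
  have hΔ : |planarCross B₁ B₂| = |G| * |p₀| * |t| := by
    rw [hcr', ht, abs_mul, abs_mul]; ring
  have hGpos : 0 < |G| := abs_pos.2 hG
  have hppos : 0 < |p₀| := abs_pos.2 hp₀
  have htpos : 0 < |t| := abs_pos.2 ht0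
  have hmle : ∀ B ∈ D, |m B| ≤ |t| := fun B hB => by
    have h := h1 B hB
    rw [hΔ, hcr, hm B hB, abs_mul, abs_mul, ← mul_assoc] at h
    exact le_of_mul_le_mul_left h (by positivity)
  have himg : ((D.image m).card : ℤ) ≤ 3 * |t| := by
    have := Finset.card_le_of_abs_le (D := D.image m) (j := id) (Set.injOn_id _) htpos.le (by
      intro k hk
      obtain ⟨B, hB, rfl⟩ := Finset.mem_image.1 hk
      exact hmle B hB)
    omega
  have hfib : ∀ k ∈ D.image m, (D.filter fun B => m B = k).card ≤ (5 * |G|).toNat := by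
    intro k hk
    obtain ⟨B', hB', hk'⟩ := Finset.mem_image.1 hk
    let j : ℤ × ℤ × ℤ → ℤ := fun B =>
      u' * (B.1 - B'.1) + v' * (B.2.1 - B'.2.1) + w' * (B.2.2 - B'.2.2)
    have hjj : ∀ B ∈ D.filter fun B => m B = k, B.1 - B'.1 = j B * c₀ ∧
        B.2.1 - B'.2.1 = j B * c₁ ∧ B.2.2 - B'.2.2 = j B * c₂ := by
      intro B hB
      obtain ⟨hBD, hBk⟩ := Finset.mem_filter.1 hB
      have d0 : (B.2.1 - B'.2.1) * c₂ - (B.2.2 - B'.2.2) * c₁ = 0 := by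
        have a1 := hm B hBD
        have a2 := hm B' hB'
        rw [hBk] at a1
        rw [hk'] at a2
        simp only [planarCross, hC] at a1 a2
        linear_combination a1 - a2
      have q1 := hD B hBD
      have q2 := hD B' hB'
      simp only [hC] at hCp
      have d1 : (B.2.2 - B'.2.2) * c₀ - (B.1 - B'.1) * c₂ = 0 := by
        apply mul_left_cancel₀ hp₀
        linear_combination (B.2.2 - B'.2.2) * hCp - c₂ * (q1 - q2) + p₁ * d0
      have d2 : (B.1 - B'.1) * c₁ - (B.2.1 - B'.2.1) * c₀ = 0 := by
        apply mul_left_cancel₀ hp₀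
        linear_combination -(B.2.1 - B'.2.1) * hCp + c₁ * (q1 - q2) + p₂ * d0
      simp only [j]
      refine ⟨?_, ?_, ?_⟩
      · linear_combination (-(B.1 - B'.1)) * hbez' + v' * d2 - w' * d1
      · linear_combination (-(B.2.1 - B'.2.1)) * hbez' + w' * d0 - u' * d2
      · linear_combination (-(B.2.2 - B'.2.2)) * hbez' - v' * d0 + u' * d1
    have hjinj : Set.InjOn j (D.filter fun B => m B = k : Finset _) := by
      intro B hB B'' hB'' heq
      obtain ⟨a0, a1, a2⟩ := hjj B hB
      obtain ⟨b0, b1, b2⟩ := hjj B'' hB''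
      rw [heq] at a0 a1 a2
      refine Prod.ext ?_ (Prod.ext ?_ ?_) <;> linarith
    have hjle : ∀ B ∈ D.filter fun B => m B = k, |j B| ≤ 2 * |G| := by
      intro B hB
      obtain ⟨a0, a1, a2⟩ := hjj B hB
      have hBD := (Finset.mem_filter.1 hB).1
      have e : planarCross B B₂ - planarCross B' B₂ = j B * (p₀ * t) := by
        rw [← ht]
        simp only [planarCross, hC]
        linear_combination B₂.2.2 * a1 - B₂.2.1 * a2
      have h3 : |j B| * (|p₀| * |t|) ≤ 2 * |G| * (|p₀| * |t|) := by
        rw [← abs_mul, ← abs_mul, ← e]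
        have hΔ' : |planarCross B₁ B₂| = |G| * |p₀ * t| := by rw [hΔ, abs_mul]; ring
        have := abs_sub (planarCross B B₂) (planarCross B' B₂)
        have := h2 B hBD
        have := h2 B' hB'
        linarith
      exact le_of_mul_le_mul_right h3 (by positivity)
    have := Finset.card_le_of_abs_le hjinj (by positivity) hjle
    omega
  have hcard := Finset.card_le_mul_card_image D _ hfib
  have hcard' : (D.card : ℤ) ≤ 5 * |G| * (D.image m).card := by
    have : ((5 * |G|).toNat : ℤ) = 5 * |G| := Int.toNat_of_nonneg (by positivity)
    rw [← this]; exact_mod_cast hcard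
  rw [hΔ]
  calc (D.card : ℤ) * |p₀| ≤ 5 * |G| * (3 * |t|) * |p₀| := by gcongr; exact hcard'.trans (by gcongr)
    _ = _ := by ring

theorem det_eq_zero_of_small {f₁ f₂ g₁ g₂ κ c R : ℝ} (hκ : κ ≤ |g₁|) (hR : 1 ≤ R)
    (hcκ : 96 * c < κ) {B B' B'' : ℤ × ℤ × ℤ}
    (hF : ∀ A ∈ ({B, B', B''} : Set (ℤ × ℤ × ℤ)), |(A.1 : ℝ) + A.2.1 * f₁ + A.2.2 * f₂| ≤ c / R)
    (hG : ∀ A ∈ ({B, B', B''} : Set (ℤ × ℤ × ℤ)), |(A.2.1 : ℝ) * g₁ + A.2.2 * g₂| ≤ 4)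
    (h2 : ∀ A ∈ ({B, B', B''} : Set (ℤ × ℤ × ℤ)), |(A.2.2 : ℝ)| ≤ 4 * R) :
    planarCross B' B'' * B.1 + (B'.2.2 * B''.1 - B'.1 * B''.2.2) * B.2.1
      + (B'.1 * B''.2.1 - B'.2.1 * B''.1) * B.2.2 = 0 := by
  simp only [Set.mem_insert_iff, Set.mem_singleton_iff, forall_eq_or_imp, forall_eq] at hF hG h2
  obtain ⟨F, F', F''⟩ := hF
  obtain ⟨G, G', G''⟩ := hG
  obtain ⟨z, z', z''⟩ := h2
  set d := planarCross B' B'' * B.1 + (B'.2.2 * B''.1 - B'.1 * B''.2.2) * B.2.1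
      + (B'.1 * B''.2.1 - B'.2.1 * B''.1) * B.2.2 with hd
  have hprod : ∀ {x y t : ℝ}, |x| ≤ c / R → |y| ≤ 4 → |t| ≤ 4 * R → |x * y * t| ≤ 16 * c := by
    intro x y t hx hy ht
    have hcR : 0 ≤ c / R := (abs_nonneg x).trans hx
    calc |x * y * t| = |x| * |y| * |t| := by rw [abs_mul, abs_mul]
      _ ≤ c / R * 4 * (4 * R) := by gcongr
      _ = 16 * c := by field_simp; norm_num
  have key : |g₁ * d| ≤ 96 * c := by
    have e : g₁ * (d : ℝ) =
        ((B.1 : ℝ) + B.2.1 * f₁ + B.2.2 * f₂) * ((B'.2.1 : ℝ) * g₁ + B'.2.2 * g₂) * B''.2.2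
        - ((B.1 : ℝ) + B.2.1 * f₁ + B.2.2 * f₂) * ((B''.2.1 : ℝ) * g₁ + B''.2.2 * g₂) * B'.2.2
        + ((B'.1 : ℝ) + B'.2.1 * f₁ + B'.2.2 * f₂) * ((B''.2.1 : ℝ) * g₁ + B''.2.2 * g₂) * B.2.2
        - ((B'.1 : ℝ) + B'.2.1 * f₁ + B'.2.2 * f₂) * ((B.2.1 : ℝ) * g₁ + B.2.2 * g₂) * B''.2.2
        + ((B''.1 : ℝ) + B''.2.1 * f₁ + B''.2.2 * f₂) * ((B.2.1 : ℝ) * g₁ + B.2.2 * g₂) * B'.2.2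
        - ((B''.1 : ℝ) + B''.2.1 * f₁ + B''.2.2 * f₂) * ((B'.2.1 : ℝ) * g₁ + B'.2.2 * g₂)
          * B.2.2 := by
      rw [hd]; simp only [planarCross]; push_cast; ring
    rw [e, abs_le]
    have a1 := abs_le.1 (hprod F G' z'')
    have a2 := abs_le.1 (hprod F G'' z')
    have a3 := abs_le.1 (hprod F' G'' z)
    have a4 := abs_le.1 (hprod F' G z'')
    have a5 := abs_le.1 (hprod F'' G z')
    have a6 := abs_le.1 (hprod F'' G' z)
    constructor <;> linarith
  by_contra hne
  have h1 : (1 : ℝ) ≤ |(d : ℝ)| := by exact_mod_cast Int.one_le_abs hne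
  rw [abs_mul] at key
  have : |g₁| ≤ |g₁| * |(d : ℝ)| := le_mul_of_one_le_right (abs_nonneg _) h1
  linarith

theorem cell_dichotomy {f₁ f₂ g₁ g₂ κ c R : ℝ} (hκ0 : 0 < κ) (hκ : κ ≤ |g₁|) (hR : 1 ≤ R)
    (hc1 : c < 1) (hcκ : 96 * c < κ) {S : Finset (ℤ × ℤ × ℤ)} (h3 : 3 ≤ S.card)
    (hF : ∀ A ∈ S, ∀ A' ∈ S, |((A - A').1 : ℝ) + (A - A').2.1 * f₁ + (A - A').2.2 * f₂| ≤ c / R)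
    (hG : ∀ A ∈ S, ∀ A' ∈ S, |((A - A').2.1 : ℝ) * g₁ + (A - A').2.2 * g₂| ≤ 4)
    (h1 : ∀ A ∈ S, ∀ A' ∈ S, |((A - A').2.1 : ℝ)| ≤ 4 * R)
    (h2 : ∀ A ∈ S, ∀ A' ∈ S, |((A - A').2.2 : ℝ)| ≤ 4 * R) :
    (∃ b₁ b₂ : ℤ, (b₁ ≠ 0 ∨ b₂ ≠ 0) ∧ |(b₁ : ℝ)| ≤ 12 * R / S.card ∧
      |(b₂ : ℝ)| ≤ 12 * R / S.card ∧ |(b₁ : ℝ) * g₁ + b₂ * g₂| ≤ 12 / S.card) ∨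
    (∃ p₀ p₁ : ℤ, p₀ ≠ 0 ∧ |(p₀ : ℝ)| ≤ 480 * R / (κ * S.card) ∧
      |p₀ * f₁ - p₁| ≤ 120 / S.card) := by
  have hN : (0 : ℝ) < S.card := by exact_mod_cast (by omega : 0 < S.card)
  obtain ⟨A₀, hA₀⟩ := Finset.card_pos.1 (by omega : 0 < S.card)
  set D : Finset (ℤ × ℤ × ℤ) := S.image (· - A₀) with hD
  have hcard : D.card = S.card := Finset.card_image_of_injective _ sub_left_injective
  have hmem : ∀ B ∈ D, ∃ A ∈ S, B = A - A₀ := fun B hB => by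
    obtain ⟨A, hA, rfl⟩ := Finset.mem_image.1 hB
    exact ⟨A, hA, rfl⟩
  have h0 : (0 : ℤ × ℤ × ℤ) ∈ D := Finset.mem_image.2 ⟨A₀, hA₀, sub_self _⟩
  have DF : ∀ B ∈ D, |(B.1 : ℝ) + B.2.1 * f₁ + B.2.2 * f₂| ≤ c / R := fun B hB => by
    obtain ⟨A, hA, rfl⟩ := hmem B hB; exact hF A hA A₀ hA₀
  have DG : ∀ B ∈ D, |(B.2.1 : ℝ) * g₁ + B.2.2 * g₂| ≤ 4 := fun B hB => by
    obtain ⟨A, hA, rfl⟩ := hmem B hB; exact hG A hA A₀ hA₀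
  have D1 : ∀ B ∈ D, |(B.2.1 : ℝ)| ≤ 4 * R := fun B hB => by
    obtain ⟨A, hA, rfl⟩ := hmem B hB; exact h1 A hA A₀ hA₀
  have D2 : ∀ B ∈ D, |(B.2.2 : ℝ)| ≤ 4 * R := fun B hB => by
    obtain ⟨A, hA, rfl⟩ := hmem B hB; exact h2 A hA A₀ hA₀
  have hinj : ∀ B ∈ D, ∀ B' ∈ D, B.2 = B'.2 → B = B' := by
    intro B hB B' hB' heq
    obtain ⟨A, hA, rfl⟩ := hmem B hB
    obtain ⟨A', hA', rfl⟩ := hmem B' hB'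
    have e : A.2 = A'.2 := by simpa using heq
    have h := hF A hA A' hA'
    have e2 : (A - A').2 = 0 := by simp [e]
    rw [e2] at h
    have hlt : |((A - A').1 : ℝ)| < 1 := by
      have : c / R < 1 := by rw [div_lt_one (by linarith)]; linarith
      simp only [Prod.fst_zero, Prod.snd_zero, Int.cast_zero, zero_mul, add_zero] at h
      exact h.trans_lt this
    have : (A - A').1 = 0 := Int.abs_lt_one_iff.1 (by exact_mod_cast hlt)
    have e1 : A.1 = A'.1 := by simpa [sub_eq_zero] using this
    rw [Prod.ext e1 e]
  by_cases hcol : ∀ B ∈ D, ∀ B' ∈ D, planarCross B B' = 0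
  · left
    obtain ⟨B, hB, j, b₁, b₂, hb, e1, e2, hj⟩ :=
      exists_large_multiple_of_collinear (by omega) h0 hinj hcol
    have hj' : (S.card : ℝ) ≤ 3 * |(j : ℝ)| := by rw [← hcard]; exact_mod_cast hj
    have aux : ∀ {x K : ℝ}, |j * x| ≤ K → |x| ≤ 3 * K / S.card := by
      intro x K hx
      rw [abs_mul] at hx
      rw [le_div_iff₀ hN]
      nlinarith [abs_nonneg x]
    have E1 : (B.2.1 : ℝ) = j * b₁ := by exact_mod_cast e1
    have E2 : (B.2.2 : ℝ) = j * b₂ := by exact_mod_cast e2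
    refine ⟨b₁, b₂, hb, ?_, ?_, ?_⟩
    · have := aux (K := 4 * R) (by rw [← E1]; exact D1 B hB)
      convert this using 2; ring
    · have := aux (K := 4 * R) (by rw [← E2]; exact D2 B hB)
      convert this using 2; ring
    · have := aux (x := b₁ * g₁ + b₂ * g₂) (K := 4) (by
        have := DG B hB
        rw [E1, E2] at this
        convert this using 2; ring)
      convert this using 2; norm_num
  · right
    push Not at hcol
    obtain ⟨C₁, hC₁, C₂, hC₂, hC⟩ := hcol
    obtain ⟨⟨B₁, B₂⟩, hBB, hmax⟩ := Finset.exists_max_image (D ×ˢ D)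
      (fun q => |planarCross q.1 q.2|) ⟨0, Finset.mk_mem_product h0 h0⟩
    obtain ⟨hB₁, hB₂⟩ := Finset.mem_product.1 hBB
    simp only at hB₁ hB₂ hmax
    have hne : planarCross B₁ B₂ ≠ 0 := by
      have := hmax (C₁, C₂) (Finset.mk_mem_product hC₁ hC₂)
      exact abs_pos.1 ((abs_pos.2 hC).trans_le this)
    obtain ⟨G, p₀, p₁, p₂, u, v, w, hG0, e0, e1, e2, hbez⟩ :=
      exists_primitive_triple (planarCross B₁ B₂) (B₁.2.2 * B₂.1 - B₁.1 * B₂.2.2)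
        (B₁.1 * B₂.2.1 - B₁.2.1 * B₂.1) (Or.inl hne)
    have hp₀ : p₀ ≠ 0 := by
      rintro rfl
      exact hne (by rw [e0]; ring)
    have hplane : ∀ B ∈ D, p₀ * B.1 + p₁ * B.2.1 + p₂ * B.2.2 = 0 := by
      intro B hB
      have := det_eq_zero_of_small (f₁ := f₁) (f₂ := f₂) (g₁ := g₁) (g₂ := g₂) hκ hR hcκ
        (B := B) (B' := B₁) (B'' := B₂)
        (by simp only [Set.mem_insert_iff, Set.mem_singleton_iff, forall_eq_or_imp, forall_eq]
            exact ⟨DF _ hB, DF _ hB₁, DF _ hB₂⟩)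
        (by simp only [Set.mem_insert_iff, Set.mem_singleton_iff, forall_eq_or_imp, forall_eq]
            exact ⟨DG _ hB, DG _ hB₁, DG _ hB₂⟩)
        (by simp only [Set.mem_insert_iff, Set.mem_singleton_iff, forall_eq_or_imp, forall_eq]
            exact ⟨D2 _ hB, D2 _ hB₁, D2 _ hB₂⟩)
      rw [e0, e1, e2] at this
      apply mul_left_cancel₀ hG0
      linear_combination this
    have hcp := card_mul_le_of_plane hp₀ hbez hplane hB₁ hB₂ hne
      (fun B hB => hmax (B, B₁) (Finset.mk_mem_product hB hB₁))
      (fun B hB => hmax (B, B₂) (Finset.mk_mem_product hB hB₂))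
    set Δ : ℝ := |(planarCross B₁ B₂ : ℝ)| with hΔ
    have hcp' : (S.card : ℝ) * |(p₀ : ℝ)| ≤ 15 * Δ := by
      rw [← hcard, hΔ]; exact_mod_cast hcp
    have hΔ0 : 0 < Δ := abs_pos.2 (by exact_mod_cast hne)
    have hpabs : 0 < |(p₀ : ℝ)| := abs_pos.2 (by exact_mod_cast hp₀)
    have hprod : ∀ {x t K : ℝ}, |x| ≤ K → |t| ≤ 4 * R → |x * t| ≤ K * (4 * R) := by
      intro x t K hx ht
      rw [abs_mul]
      exact mul_le_mul hx ht (abs_nonneg _) ((abs_nonneg _).trans hx)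
    have hΔR : κ * Δ ≤ 32 * R := by
      have e : g₁ * (planarCross B₁ B₂ : ℝ) = (B₁.2.1 * g₁ + B₁.2.2 * g₂) * B₂.2.2
          - (B₂.2.1 * g₁ + B₂.2.2 * g₂) * B₁.2.2 := by
        simp only [planarCross]; push_cast; ring
      calc κ * Δ ≤ |g₁| * Δ := by gcongr
        _ = |g₁ * (planarCross B₁ B₂ : ℝ)| := by rw [abs_mul]
        _ ≤ 4 * (4 * R) + 4 * (4 * R) := by
          rw [e]
          exact (abs_sub _ _).trans
            (add_le_add (hprod (DG _ hB₁) (D2 _ hB₂)) (hprod (DG _ hB₂) (D2 _ hB₁)))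
        _ = 32 * R := by ring
    refine ⟨p₀, p₁, hp₀, ?_, ?_⟩
    · rw [le_div_iff₀ (by positivity)]
      nlinarith
    · have hv : |(p₀ * f₁ - p₁) * (planarCross B₁ B₂ : ℝ)| ≤ |(p₀ : ℝ)| * (8 * c) := by
        have q₁ : (p₀ : ℝ) * B₁.1 + p₁ * B₁.2.1 + p₂ * B₁.2.2 = 0 := by
          exact_mod_cast hplane B₁ hB₁
        have q₂ : (p₀ : ℝ) * B₂.1 + p₁ * B₂.2.1 + p₂ * B₂.2.2 = 0 := by
          exact_mod_cast hplane B₂ hB₂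
        have e : (p₀ * f₁ - p₁) * (planarCross B₁ B₂ : ℝ) =
            p₀ * ((B₁.1 + B₁.2.1 * f₁ + B₁.2.2 * f₂) * B₂.2.2
              - (B₂.1 + B₂.2.1 * f₁ + B₂.2.2 * f₂) * B₁.2.2) := by
          simp only [planarCross]; push_cast
          linear_combination B₂.2.2 * (-q₁) + B₁.2.2 * q₂
        rw [e, abs_mul]
        gcongr
        calc _ ≤ c / R * (4 * R) + c / R * (4 * R) := (abs_sub _ _).trans
              (add_le_add (hprod (DF _ hB₁) (D2 _ hB₂)) (hprod (DF _ hB₂) (D2 _ hB₁)))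
          _ = 8 * c := by field_simp; ring
      rw [abs_mul] at hv
      rw [le_div_iff₀ hN]
      have hc0 : 0 ≤ c := by
        have := (abs_nonneg _).trans (DF 0 h0)
        by_contra! hneg
        exact absurd this (not_le.2 (div_neg_of_neg_of_pos hneg (by linarith)))
      have h4 : |p₀ * f₁ - p₁| * S.card * Δ ≤ 120 * Δ := by
        calc |p₀ * f₁ - p₁| * S.card * Δ = |p₀ * f₁ - p₁| * Δ * S.card := by ring
          _ ≤ |(p₀ : ℝ)| * (8 * c) * S.card := by gcongr
          _ = 8 * c * (S.card * |(p₀ : ℝ)|) := by ring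
          _ ≤ 8 * c * (15 * Δ) := by gcongr
          _ ≤ 120 * Δ := by nlinarith
      exact le_of_mul_le_mul_right h4 hΔ0

theorem Finset.sum_le_of_card_superlevel_le {ι : Type*} {I : Finset ι} {n : ι → ℕ} {N : ℕ}
    (hn : ∀ i ∈ I, n i ≤ N) {A : ℝ} (hA : 0 ≤ A)
    (h : ∀ m : ℕ, 1 ≤ m → ((I.filter fun i => m ≤ n i).card : ℝ) ≤ A / m) :
    (∑ i ∈ I, n i : ℝ) ≤ A * (1 + Real.log N) := by
  have e : ∑ i ∈ I, n i = ∑ m ∈ Finset.Icc 1 N, (I.filter fun i => m ≤ n i).card := by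
    simp_rw [Finset.card_filter]
    rw [Finset.sum_comm]
    refine Finset.sum_congr rfl fun i hi => ?_
    rw [← Finset.card_filter]
    have : (Finset.Icc 1 N).filter (fun m => m ≤ n i) = Finset.Icc 1 (n i) := by
      ext m
      have := hn i hi
      simp only [Finset.mem_filter, Finset.mem_Icc]
      omega
    rw [this, Nat.card_Icc]; omega
  have e' : (∑ i ∈ I, n i : ℝ) = ∑ m ∈ Finset.Icc 1 N, ((I.filter fun i => m ≤ n i).card : ℝ) := by
    exact_mod_cast e
  rw [e']
  calc _ ≤ ∑ m ∈ Finset.Icc 1 N, A * (m : ℝ)⁻¹ := Finset.sum_le_sum fun m hm => by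
        rw [← div_eq_mul_inv]; exact h m (Finset.mem_Icc.1 hm).1
    _ = A * (harmonic N : ℝ) := by
        rw [← Finset.mul_sum, harmonic_eq_sum_Icc]; push_cast; rfl
    _ ≤ _ := by gcongr; exact harmonic_le_one_add_log N

theorem Finset.card_le_of_localized {ι κ : Type*} {I : Finset ι} {P : Finset κ}
    {w : κ → ℕ} {good : ι → κ → Prop} {C X : ℝ} {H : ℕ} (hC : 0 ≤ C) (hX : 0 ≤ X)
    (hw : ∀ p ∈ P, 1 ≤ w p ∧ w p ≤ H)
    (hP : ∀ m : ℕ, 1 ≤ m → ((P.filter fun p => w p = m).card : ℝ) ≤ C * m)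
    (hI : ∀ i ∈ I, ∃ p ∈ P, good i p)
    (hloc : ∀ p ∈ P, ∀ T ⊆ I, (∀ i ∈ T, good i p) → (T.card : ℝ) ≤ 1 + X / w p) :
    (I.card : ℝ) ≤ C * H * (H + X) := by
  classical
  have hsub : I ⊆ P.biUnion fun p => I.filter fun i => good i p := fun i hi => by
    obtain ⟨p, hp, hg⟩ := hI i hi
    exact Finset.mem_biUnion.2 ⟨p, hp, Finset.mem_filter.2 ⟨hi, hg⟩⟩
  calc (I.card : ℝ) ≤ ∑ p ∈ P, ((I.filter fun i => good i p).card : ℝ) := by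
        exact_mod_cast (Finset.card_le_card hsub).trans Finset.card_biUnion_le
    _ ≤ ∑ p ∈ P, (1 + X / w p) := Finset.sum_le_sum fun p hp =>
        hloc p hp _ (Finset.filter_subset _ _) fun i hi => (Finset.mem_filter.1 hi).2
    _ = ∑ m ∈ Finset.Icc 1 H, ∑ p ∈ P.filter fun p => w p = m, (1 + X / w p) :=
        (Finset.sum_fiberwise_of_maps_to (fun p hp => Finset.mem_Icc.2 (hw p hp)) _).symm
    _ ≤ ∑ m ∈ Finset.Icc 1 H, C * (H + X) := Finset.sum_le_sum fun m hm => by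
        obtain ⟨h1, h2⟩ := Finset.mem_Icc.1 hm
        have hm0 : (0 : ℝ) < m := by exact_mod_cast h1
        rw [Finset.sum_congr rfl (g := fun _ => 1 + X / m)
          (fun p hp => by rw [(Finset.mem_filter.1 hp).2]), Finset.sum_const, nsmul_eq_mul]
        calc _ ≤ C * m * (1 + X / m) := by gcongr; exact hP m h1
          _ = C * (m + X) := by field_simp
          _ ≤ _ := by gcongr
    _ = C * H * (H + X) := by
        rw [Finset.sum_const, Nat.card_Icc, nsmul_eq_mul]; push_cast [Nat.add_sub_cancel]; ring

theorem Finset.card_le_of_diam_le {T : Finset ℕ} {D : ℝ} (hD : 0 ≤ D)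
    (h : ∀ i ∈ T, ∀ j ∈ T, |(i : ℝ) - j| ≤ D) : (T.card : ℝ) ≤ 1 + D := by
  rcases T.eq_empty_or_nonempty with rfl | hT
  · simp; linarith
  have hsub : T ⊆ Finset.Icc (T.min' hT) (T.max' hT) := fun i hi =>
    Finset.mem_Icc.2 ⟨T.min'_le i hi, T.le_max' i hi⟩
  have h1 := Finset.card_le_card hsub
  rw [Nat.card_Icc] at h1
  have hle : T.min' hT ≤ T.max' hT := T.min'_le _ (T.max'_mem hT)
  have h2 := (le_abs_self _).trans (h _ (T.max'_mem hT) _ (T.min'_mem hT))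
  have h3 : (T.card : ℝ) ≤ (T.max' hT : ℝ) + 1 - T.min' hT := by
    rw [← Nat.cast_succ, ← Nat.cast_sub (by omega)]
    exact_mod_cast h1
  linarith

/-- A short arc of a planar curve `(f₁, f₂)` together with an inhomogeneity `g`, carrying the
quantitative non-degeneracy that survives on a neighbourhood of a non-degenerate point. -/
structure PhaseArc where
  (α β κ M R₀ : ℝ)
  (f₁ df₁ ddf₁ f₂ df₂ ddf₂ g dg ddg : ℝ → ℝ)
  lt : α < β
  le_one : β - α ≤ 1
  κ_pos : 0 < κ
  κ_le : κ ≤ 1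
  one_le_M : 1 ≤ M
  one_le_R₀ : 1 ≤ R₀
  hf₁ : ∀ x ∈ Icc α β, HasDerivAt f₁ (df₁ x) x
  hdf₁ : ∀ x ∈ Icc α β, HasDerivAt df₁ (ddf₁ x) x
  hf₂ : ∀ x ∈ Icc α β, HasDerivAt f₂ (df₂ x) x
  hdf₂ : ∀ x ∈ Icc α β, HasDerivAt df₂ (ddf₂ x) x
  hg : ∀ x ∈ Icc α β, HasDerivAt g (dg x) x
  hdg : ∀ x ∈ Icc α β, HasDerivAt dg (ddg x) x
  f₁_le : ∀ x ∈ Icc α β, |f₁ x| ≤ M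
  f₂_le : ∀ x ∈ Icc α β, |f₂ x| ≤ M
  df₁_le : ∀ x ∈ Icc α β, |df₁ x| ≤ M
  df₂_le : ∀ x ∈ Icc α β, |df₂ x| ≤ M
  ddf₁_le : ∀ x ∈ Icc α β, |ddf₁ x| ≤ M
  ddf₂_le : ∀ x ∈ Icc α β, |ddf₂ x| ≤ M
  dg_le : ∀ x ∈ Icc α β, |dg x| ≤ κ / 2 * R₀
  ddg_le : ∀ x ∈ Icc α β, |ddg x| ≤ κ / 2 * R₀
  κ_le_df₁ : ∀ x ∈ Icc α β, κ ≤ |df₁ x|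
  dichotomy : ∀ b₁ b₂ : ℝ,
    (∀ x ∈ Icc α β, κ * max |b₁| |b₂| ≤ |b₁ * df₁ x + b₂ * df₂ x|) ∨
    (∀ x ∈ Icc α β, κ * max |b₁| |b₂| ≤ |b₁ * ddf₁ x + b₂ * ddf₂ x|)

theorem mul_abs_sub_le_of_le_abs_deriv {α β m : ℝ} {F F' : ℝ → ℝ}
    (hF : ∀ x ∈ Icc α β, HasDerivAt F (F' x) x) (hm : ∀ x ∈ Icc α β, m ≤ |F' x|)
    {x y : ℝ} (hx : x ∈ Icc α β) (hy : y ∈ Icc α β) : m * |x - y| ≤ |F x - F y| := by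
  wlog hxy : x < y generalizing x y
  · rcases eq_or_lt_of_le (not_lt.1 hxy) with rfl | h
    · simp
    · rw [abs_sub_comm x y, abs_sub_comm (F x)]; exact this hy hx h
  have hsub : Icc x y ⊆ Icc α β := Icc_subset_Icc hx.1 hy.2
  obtain ⟨c, hc, hcd⟩ := exists_hasDerivAt_eq_slope F F' hxy
    (fun z hz => (hF z (hsub hz)).continuousAt.continuousWithinAt)
    (fun z hz => hF z (hsub (Ioo_subset_Icc_self hz)))
  have h1 := hm c (hsub (Ioo_subset_Icc_self hc))
  have hpos : 0 < y - x := sub_pos.2 hxy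
  rw [hcd, abs_div, abs_of_pos hpos, le_div_iff₀ hpos] at h1
  rw [abs_sub_comm x y, abs_sub_comm (F x), abs_of_pos hpos]
  exact h1

theorem abs_sub_le_of_abs_deriv_le {α β L : ℝ} {F F' : ℝ → ℝ}
    (hF : ∀ x ∈ Icc α β, HasDerivAt F (F' x) x) (hL : ∀ x ∈ Icc α β, |F' x| ≤ L)
    {x y : ℝ} (hx : x ∈ Icc α β) (hy : y ∈ Icc α β) : |F x - F y| ≤ L * |x - y| := by
  have := (convex_Icc α β).norm_image_sub_le_of_norm_hasDerivWithin_le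
    (fun z hz => (hF z hz).hasDerivWithinAt) (fun z hz => by simpa using hL z hz) hy hx
  simpa using this

namespace PhaseArc
variable (P : PhaseArc)

/-- The phase `a₁ f₁ + a₂ f₂ + g`. -/
def F (a : ℤ × ℤ) (x : ℝ) : ℝ := a.1 * P.f₁ x + a.2 * P.f₂ x + P.g x

/-- The derivative of the phase. -/
def dF (a : ℤ × ℤ) (x : ℝ) : ℝ := a.1 * P.df₁ x + a.2 * P.df₂ x + P.dg x

/-- The second derivative of the phase. -/
def ddF (a : ℤ × ℤ) (x : ℝ) : ℝ := a.1 * P.ddf₁ x + a.2 * P.ddf₂ x + P.ddg x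

variable {P}

theorem hasDerivAt_F (a : ℤ × ℤ) {x : ℝ} (hx : x ∈ Icc P.α P.β) :
    HasDerivAt (P.F a) (P.dF a x) x :=
  (((P.hf₁ x hx).const_mul _).add ((P.hf₂ x hx).const_mul _)).add (P.hg x hx)

theorem hasDerivAt_dF (a : ℤ × ℤ) {x : ℝ} (hx : x ∈ Icc P.α P.β) :
    HasDerivAt (P.dF a) (P.ddF a x) x :=
  (((P.hdf₁ x hx).const_mul _).add ((P.hdf₂ x hx).const_mul _)).add (P.hdg x hx)

theorem κ_le_M : P.κ ≤ P.M := P.κ_le.trans P.one_le_M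

theorem abs_comb_le {u v w M κ R R₀ : ℝ} {a : ℤ × ℤ} (hκ : 0 ≤ κ) (hκM : κ ≤ M) (hu : |u| ≤ M)
    (hv : |v| ≤ M) (hw : |w| ≤ κ / 2 * R₀) (hR : R₀ ≤ R) (hR₀ : 1 ≤ R₀) (h1 : |(a.1 : ℝ)| ≤ 2 * R)
    (h2 : |(a.2 : ℝ)| ≤ 2 * R) : |a.1 * u + a.2 * v + w| ≤ 5 * M * R := by
  have e1 : |a.1 * u| ≤ 2 * R * M := by
    rw [abs_mul]; exact mul_le_mul h1 hu (abs_nonneg _) (by linarith)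
  have e2 : |a.2 * v| ≤ 2 * R * M := by
    rw [abs_mul]; exact mul_le_mul h2 hv (abs_nonneg _) (by linarith)
  have e3 : κ / 2 * R₀ ≤ M * R := by
    apply mul_le_mul <;> linarith
  have := abs_add_three (a.1 * u) (a.2 * v) w
  linarith

end PhaseArc

theorem card_filter_max_natAbs_le (P : Finset (ℤ × ℤ)) {m : ℕ} (hm : 1 ≤ m) :
    (P.filter fun p => max p.1.natAbs p.2.natAbs = m).card ≤ 12 * m := by
  have hsub : (P.filter fun p => max p.1.natAbs p.2.natAbs = m) ⊆
      (({(m : ℤ), -(m : ℤ)} : Finset ℤ) ×ˢ Finset.Icc (-(m : ℤ)) m) ∪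
      (Finset.Icc (-(m : ℤ)) m ×ˢ ({(m : ℤ), -(m : ℤ)} : Finset ℤ)) := by
    intro p hp
    have := (Finset.mem_filter.1 hp).2
    simp only [Finset.mem_union, Finset.mem_product, Finset.mem_insert, Finset.mem_singleton,
      Finset.mem_Icc]
    omega
  have h2 : ({(m : ℤ), -(m : ℤ)} : Finset ℤ).card ≤ 2 := Finset.card_le_two
  have h3 : (Finset.Icc (-(m : ℤ)) m).card = 2 * m + 1 := by rw [Int.card_Icc]; omega
  have := (Finset.card_le_card hsub).trans (Finset.card_union_le _ _)
  rw [Finset.card_product, Finset.card_product, h3] at this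
  nlinarith

theorem card_filter_natAbs_fst_le {P : Finset (ℤ × ℤ)} {K : ℕ} (hK : 1 ≤ K)
    (hP : ∀ p ∈ P, p.2.natAbs ≤ K * p.1.natAbs) {m : ℕ} (hm : 1 ≤ m) :
    (P.filter fun p => p.1.natAbs = m).card ≤ 6 * K * m := by
  have hsub : (P.filter fun p => p.1.natAbs = m) ⊆
      (({(m : ℤ), -(m : ℤ)} : Finset ℤ) ×ˢ Finset.Icc (-((K * m : ℕ) : ℤ)) (K * m : ℕ)) := by
    intro p hp
    obtain ⟨hp, hpm⟩ := Finset.mem_filter.1 hp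
    have h := hP p hp
    rw [hpm] at h
    simp only [Finset.mem_product, Finset.mem_insert, Finset.mem_singleton,
      Finset.mem_Icc]
    omega
  have h2 : ({(m : ℤ), -(m : ℤ)} : Finset ℤ).card ≤ 2 := Finset.card_le_two
  have h3 : (Finset.Icc (-((K * m : ℕ) : ℤ)) (K * m : ℕ)).card = 2 * (K * m) + 1 := by
    rw [Int.card_Icc]; omega
  have := Finset.card_le_card hsub
  rw [Finset.card_product, h3] at this
  have : 1 ≤ K * m := Nat.mul_pos hK hm
  nlinarith

namespace PhaseArc
variable (P : PhaseArc)

/-- The mesh constant of the subdivision of an arc into cells. -/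
noncomputable def mesh : ℝ := P.κ / (1000 * P.M)

/-- The left endpoints of the cells of length `mesh / R`. -/
noncomputable def node (R : ℝ) (i : ℕ) : ℝ := P.α + i * (P.mesh / R)

variable {P}

theorem mesh_pos : 0 < P.mesh := div_pos P.κ_pos (by linarith [P.one_le_M])

theorem abs_natCast_sub_le_of_node {R d : ℝ} (hR : 1 ≤ R) {i j : ℕ}
    (h : |P.node R i - P.node R j| ≤ d) : |(i : ℝ) - j| ≤ d * R / P.mesh := by
  have hpos : 0 < P.mesh / R := div_pos mesh_pos (by linarith)
  have e : P.node R i - P.node R j = ((i : ℝ) - j) * (P.mesh / R) := by simp only [node]; ring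
  rw [e, abs_mul, abs_of_pos hpos, ← le_div_iff₀ hpos] at h
  rwa [div_div_eq_mul_div] at h

theorem abs_sub_le_of_linear_resonance {n b₁ b₂ : ℝ} (hn : 0 < n)
    (hb : 0 < max |b₁| |b₂|) {x y : ℝ} (hx : x ∈ Icc P.α P.β) (hy : y ∈ Icc P.α P.β)
    (hbx : |b₁ * P.df₁ x + b₂ * P.df₂ x| ≤ 12 / n)
    (hby : |b₁ * P.df₁ y + b₂ * P.df₂ y| ≤ 12 / n) :
    |x - y| ≤ 240 / P.κ / n / max |b₁| |b₂| := by
  have hκ := P.κ_pos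
  set h := max |b₁| |b₂|
  rcases P.dichotomy b₁ b₂ with H | H
  · have h1 := (H x hx).trans hbx
    have h2 : |x - y| ≤ 1 := by
      have := P.le_one
      rw [abs_le]; constructor <;> linarith [hx.1, hx.2, hy.1, hy.2]
    refine h2.trans ?_
    rw [le_div_iff₀ hn] at h1
    rw [div_div, div_div, one_le_div (by positivity)]
    linarith
  · have h1 := mul_abs_sub_le_of_le_abs_deriv
      (F := fun x => b₁ * P.df₁ x + b₂ * P.df₂ x)
      (fun z hz => ((P.hdf₁ z hz).const_mul b₁).add ((P.hdf₂ z hz).const_mul b₂)) H hx hy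
    have h2 := h1.trans ((abs_sub _ _).trans (add_le_add hbx hby))
    rw [← add_div, le_div_iff₀ hn] at h2
    rw [div_div, div_div, le_div_iff₀ (by positivity)]
    linarith

theorem abs_sub_le_of_point_resonance {n : ℝ} {p₀ p₁ : ℝ} (hn : 0 < n)
    (hp : 0 < |p₀|) {x y : ℝ} (hx : x ∈ Icc P.α P.β) (hy : y ∈ Icc P.α P.β)
    (hbx : |p₀ * P.f₁ x - p₁| ≤ 120 / n) (hby : |p₀ * P.f₁ y - p₁| ≤ 120 / n) :
    |x - y| ≤ 240 / P.κ / n / |p₀| := by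
  have hκ := P.κ_pos
  have h1 := mul_abs_sub_le_of_le_abs_deriv P.hf₁ P.κ_le_df₁ hx hy
  have h2 : |p₀| * |P.f₁ x - P.f₁ y| ≤ 240 / n := by
    rw [← abs_mul]
    calc _ = |(p₀ * P.f₁ x - p₁) - (p₀ * P.f₁ y - p₁)| := by ring_nf
      _ ≤ 120 / n + 120 / n := (abs_sub _ _).trans (add_le_add hbx hby)
      _ = _ := by ring
  rw [le_div_iff₀ hn] at h2
  rw [div_div, div_div, le_div_iff₀ (by positivity)]
  have h3 : |p₀| * n * (P.κ * |x - y|) ≤ |p₀| * n * |P.f₁ x - P.f₁ y| := by gcongr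
  linarith

/-- Resonance of the linear type at `x`. -/
def LinearResonance (P : PhaseArc) (R : ℝ) (n : ℕ) (x : ℝ) : Prop :=
  ∃ b₁ b₂ : ℤ, (b₁ ≠ 0 ∨ b₂ ≠ 0) ∧ |(b₁ : ℝ)| ≤ 12 * R / n ∧ |(b₂ : ℝ)| ≤ 12 * R / n ∧
    |(b₁ : ℝ) * P.df₁ x + b₂ * P.df₂ x| ≤ 12 / n

/-- Resonance of the rational-point type at `x`. -/
def PointResonance (P : PhaseArc) (R : ℝ) (n : ℕ) (x : ℝ) : Prop :=
  ∃ p₀ p₁ : ℤ, p₀ ≠ 0 ∧ |(p₀ : ℝ)| ≤ 480 * R / (P.κ * n) ∧ |p₀ * P.f₁ x - p₁| ≤ 120 / n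

theorem card_linearResonance_le {R : ℝ} (hR : 1 ≤ R) {n : ℕ} (hn : 1 ≤ n) {I : Finset ℕ}
    (hI : ∀ i ∈ I, P.node R i ∈ Icc P.α P.β) (h : ∀ i ∈ I, P.LinearResonance R n (P.node R i)) :
    (I.card : ℝ) ≤ 12 * (480 / P.κ) * (480 / P.κ + 240 / P.κ / P.mesh) * (R / n) ^ 2 := by
  have hκ := P.κ_pos
  have hmesh : 0 < P.mesh := mesh_pos
  have hn0 : (0 : ℝ) < n := by exact_mod_cast hn
  set H := ⌊480 / P.κ * (R / n)⌋₊
  have hH : (H : ℝ) ≤ 480 / P.κ * (R / n) := Nat.floor_le (by positivity)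
  set X := 240 / P.κ / P.mesh * (R / n) with hX
  set Q : Finset (ℤ × ℤ) := (Finset.Icc (-(H : ℤ)) H ×ˢ Finset.Icc (-(H : ℤ)) H).filter
    fun p => 1 ≤ max p.1.natAbs p.2.natAbs with hQ
  have cast_w : ∀ p : ℤ × ℤ,
      ((max p.1.natAbs p.2.natAbs : ℕ) : ℝ) = max |(p.1 : ℝ)| |(p.2 : ℝ)| := by
    intro p
    rw [Nat.cast_max, Nat.cast_natAbs, Nat.cast_natAbs, Int.cast_abs, Int.cast_abs]
  have := Finset.card_le_of_localized (I := I) (P := Q) (w := fun p => max p.1.natAbs p.2.natAbs)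
    (good := fun i p => |(p.1 : ℝ) * P.df₁ (P.node R i) + p.2 * P.df₂ (P.node R i)| ≤ 12 / n)
    (C := 12) (X := X) (H := H) (by norm_num) (by positivity)
    (by
      intro p hp
      simp only [hQ, Finset.mem_filter, Finset.mem_product, Finset.mem_Icc] at hp
      omega)
    (by
      intro m hm
      exact_mod_cast card_filter_max_natAbs_le Q hm)
    (by
      intro i hi
      obtain ⟨b₁, b₂, hb, h1, h2, h3⟩ := h i hi
      refine ⟨(b₁, b₂), ?_, h3⟩
      have aux : ∀ b : ℤ, |(b : ℝ)| ≤ 12 * R / n → b.natAbs ≤ H := fun b hb => by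
        refine Nat.le_floor ?_
        rw [Nat.cast_natAbs, Int.cast_abs]
        refine hb.trans ?_
        rw [mul_div_assoc]
        gcongr
        rw [le_div_iff₀ hκ]; linarith [P.κ_le]
      have := aux b₁ h1
      have := aux b₂ h2
      simp only [hQ, Finset.mem_filter, Finset.mem_product, Finset.mem_Icc]
      omega)
    (by
      intro p hp T hT hg
      simp only [hQ, Finset.mem_filter] at hp
      refine Finset.card_le_of_diam_le (by positivity) fun i hi j hj => ?_
      have hpos : 0 < max |(p.1 : ℝ)| |(p.2 : ℝ)| := by
        rw [← cast_w]; exact_mod_cast hp.2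
      have := abs_natCast_sub_le_of_node hR (abs_sub_le_of_linear_resonance hn0 hpos
        (hI i (hT hi)) (hI j (hT hj)) (hg i hi) (hg j hj))
      refine this.trans_eq ?_
      rw [cast_w, hX]
      field_simp)
  refine this.trans ?_
  calc 12 * (H : ℝ) * (H + X) ≤ 12 * (480 / P.κ * (R / n)) * (480 / P.κ * (R / n) + X) := by gcongr
    _ = _ := by rw [hX]; ring

theorem card_pointResonance_le {R : ℝ} (hR : 1 ≤ R) {n : ℕ} (hn : 1 ≤ n) {I : Finset ℕ}
    (hI : ∀ i ∈ I, P.node R i ∈ Icc P.α P.β) (h : ∀ i ∈ I, P.PointResonance R n (P.node R i)) :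
    (I.card : ℝ) ≤ 6 * (P.M + 121) * (480 / P.κ) * (480 / P.κ + 240 / P.κ / P.mesh)
      * (R / n) ^ 2 := by
  have hκ := P.κ_pos
  have hM := P.one_le_M
  have hmesh : 0 < P.mesh := mesh_pos
  have hn0 : (0 : ℝ) < n := by exact_mod_cast hn
  set H := ⌊480 / P.κ * (R / n)⌋₊
  have hH : (H : ℝ) ≤ 480 / P.κ * (R / n) := Nat.floor_le (by positivity)
  set X := 240 / P.κ / P.mesh * (R / n) with hX
  set K := ⌈P.M + 120⌉₊ with hK
  have hK1 : P.M + 120 ≤ K := Nat.le_ceil _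
  have hK2 : (K : ℝ) ≤ P.M + 121 := by
    have := Nat.ceil_lt_add_one (a := P.M + 120) (by linarith)
    linarith
  have hK0 : 1 ≤ K := by
    have : (1 : ℝ) ≤ K := by linarith
    exact_mod_cast this
  set Q : Finset (ℤ × ℤ) := (Finset.Icc (-(H : ℤ)) H ×ˢ
    Finset.Icc (-((K * H : ℕ) : ℤ)) (K * H : ℕ)).filter
    fun p => 1 ≤ p.1.natAbs ∧ p.2.natAbs ≤ K * p.1.natAbs with hQ
  have := Finset.card_le_of_localized (I := I) (P := Q) (w := fun p => p.1.natAbs)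
    (good := fun i p => |(p.1 : ℝ) * P.f₁ (P.node R i) - p.2| ≤ 120 / n)
    (C := 6 * K) (X := X) (H := H) (by positivity) (by positivity)
    (by
      intro p hp
      simp only [hQ, Finset.mem_filter, Finset.mem_product, Finset.mem_Icc] at hp
      omega)
    (by
      intro m hm
      exact_mod_cast card_filter_natAbs_fst_le hK0
        (P := Q) (fun p hp => (Finset.mem_filter.1 (hQ ▸ hp)).2.2) hm)
    (by
      intro i hi
      obtain ⟨p₀, p₁, hp, h1, h2⟩ := h i hi
      refine ⟨(p₀, p₁), ?_, h2⟩
      have a1 : p₀.natAbs ≤ H := by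
        refine Nat.le_floor ?_
        rw [Nat.cast_natAbs, Int.cast_abs]
        refine h1.trans_eq ?_
        field_simp
      have a2 : p₁.natAbs ≤ K * p₀.natAbs := by
        have hp1 : (1 : ℝ) ≤ |(p₀ : ℝ)| := by exact_mod_cast Int.one_le_abs hp
        have : |(p₁ : ℝ)| ≤ K * |(p₀ : ℝ)| := by
          have e : |(p₁ : ℝ)| ≤ |(p₀ : ℝ) * P.f₁ (P.node R i)| + |p₀ * P.f₁ (P.node R i) - p₁| := by
            have := abs_sub ((p₀ : ℝ) * P.f₁ (P.node R i)) (p₀ * P.f₁ (P.node R i) - p₁)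
            rwa [sub_sub_cancel] at this
          have e1 : |(p₀ : ℝ) * P.f₁ (P.node R i)| ≤ |(p₀ : ℝ)| * P.M := by
            rw [abs_mul]; gcongr; exact P.f₁_le _ (hI i hi)
          have e2 : (120 : ℝ) / n ≤ 120 := div_le_self (by norm_num) (by exact_mod_cast hn)
          nlinarith
        have h' : ((p₁.natAbs : ℕ) : ℝ) ≤ K * (p₀.natAbs : ℕ) := by
          rw [Nat.cast_natAbs, Nat.cast_natAbs, Int.cast_abs, Int.cast_abs]; exact this
        exact_mod_cast h'
      have a3 : K * p₀.natAbs ≤ K * H := Nat.mul_le_mul_left _ a1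
      simp only [hQ, Finset.mem_filter, Finset.mem_product, Finset.mem_Icc]
      refine ⟨⟨?_, ?_⟩, ?_, a2⟩ <;> omega)
    (by
      intro p hp T hT hg
      simp only [hQ, Finset.mem_filter] at hp
      refine Finset.card_le_of_diam_le (by positivity) fun i hi j hj => ?_
      have hw : ((p.1.natAbs : ℕ) : ℝ) = |(p.1 : ℝ)| := by rw [Nat.cast_natAbs, Int.cast_abs]
      have hpos : 0 < |(p.1 : ℝ)| := by
        rw [← hw]; exact_mod_cast hp.2.1
      have := abs_natCast_sub_le_of_node hR (abs_sub_le_of_point_resonance hn0 hpos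
        (hI i (hT hi)) (hI j (hT hj)) (hg i hi) (hg j hj))
      refine this.trans_eq ?_
      rw [hw, hX]
      field_simp)
  refine this.trans ?_
  calc 6 * K * (H : ℝ) * (H + X)
      ≤ 6 * (P.M + 121) * (480 / P.κ * (R / n)) * (480 / P.κ * (R / n) + X) := by gcongr
    _ = _ := by rw [hX]; ring

end PhaseArc

namespace PhaseArc
variable {P : PhaseArc}

theorem abs_ddF_le {R : ℝ} (hR : P.R₀ ≤ R) {a : ℤ × ℤ} (h1 : |(a.1 : ℝ)| ≤ 2 * R)
    (h2 : |(a.2 : ℝ)| ≤ 2 * R) {x : ℝ} (hx : x ∈ Icc P.α P.β) : |P.ddF a x| ≤ 5 * P.M * R :=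
  abs_comb_le P.κ_pos.le κ_le_M (P.ddf₁_le x hx) (P.ddf₂_le x hx) (P.ddg_le x hx) hR
    P.one_le_R₀ h1 h2

theorem abs_dF_le {R : ℝ} (hR : P.R₀ ≤ R) {a : ℤ × ℤ} (h1 : |(a.1 : ℝ)| ≤ 2 * R)
    (h2 : |(a.2 : ℝ)| ≤ 2 * R) {x : ℝ} (hx : x ∈ Icc P.α P.β) : |P.dF a x| ≤ 5 * P.M * R :=
  abs_comb_le P.κ_pos.le κ_le_M (P.df₁_le x hx) (P.df₂_le x hx) (P.dg_le x hx) hR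
    P.one_le_R₀ h1 h2

/-- Integer triples whose phase is nearly an integer at a nearly critical point. -/
def NearCritical (P : PhaseArc) (R δ : ℝ) (A : ℤ × ℤ × ℤ) : Prop :=
  |(A.2.1 : ℝ)| ≤ 2 * R ∧ |(A.2.2 : ℝ)| ≤ 2 * R ∧
    ∃ x ∈ Icc P.α P.β, |P.F A.2 x + A.1| < δ ∧ |P.dF A.2 x| < 1

theorem mesh_mul_M : P.mesh * P.M = P.κ / 1000 := by
  have := P.one_le_M
  rw [mesh]; field_simp

theorem mesh_le : P.mesh ≤ P.κ / 1000 := by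
  rw [← mesh_mul_M]; exact le_mul_of_one_le_right mesh_pos.le P.one_le_M

theorem near_node {R δ : ℝ} (hR : P.R₀ ≤ R) (hδ : δ ≤ P.mesh / R) {A : ℤ × ℤ × ℤ}
    (h1 : |(A.2.1 : ℝ)| ≤ 2 * R) (h2 : |(A.2.2 : ℝ)| ≤ 2 * R) {x y : ℝ}
    (hx : x ∈ Icc P.α P.β) (hy : y ∈ Icc P.α P.β) (hxy : |x - y| ≤ P.mesh / R)
    (hF : |P.F A.2 y + A.1| < δ) (hd : |P.dF A.2 y| < 1) :
    |P.F A.2 x + A.1| ≤ 3 * P.mesh / R ∧ |P.dF A.2 x| ≤ 2 := by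
  have hR1 : 1 ≤ R := P.one_le_R₀.trans hR
  have hM := P.one_le_M
  have hκ := P.κ_le
  have small : 5 * P.M * R * (P.mesh / R) ≤ 1 / 200 := by
    have : 5 * P.M * R * (P.mesh / R) = 5 * (P.mesh * P.M) := by field_simp
    rw [this, mesh_mul_M]; linarith
  have hdz : ∀ z ∈ Icc P.α P.β, |z - y| ≤ P.mesh / R → |P.dF A.2 z| ≤ 2 := by
    intro z hz hzy
    have e := abs_sub_le_of_abs_deriv_le (fun t ht => hasDerivAt_dF A.2 ht)
      (fun t ht => abs_ddF_le hR h1 h2 ht) hz hy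
    have e2 : 5 * P.M * R * |z - y| ≤ 5 * P.M * R * (P.mesh / R) := by gcongr
    have e3 := abs_sub_abs_le_abs_sub (P.dF A.2 z) (P.dF A.2 y)
    linarith
  refine ⟨?_, hdz x hx hxy⟩
  have hIcc : ∀ z ∈ Icc (min x y) (max x y), z ∈ Icc P.α P.β ∧ |z - y| ≤ P.mesh / R := by
    intro z hz
    refine ⟨⟨(le_min hx.1 hy.1).trans hz.1, hz.2.trans (max_le hx.2 hy.2)⟩, ?_⟩
    refine le_trans ?_ hxy
    rcases le_total x y with h | h
    · rw [min_eq_left h, max_eq_right h] at hz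
      rw [abs_of_nonpos (by linarith [hz.2]), abs_of_nonpos (by linarith)]
      linarith [hz.1]
    · rw [min_eq_right h, max_eq_left h] at hz
      rw [abs_of_nonneg (by linarith [hz.1]), abs_of_nonneg (by linarith)]
      linarith [hz.2]
  have e := abs_sub_le_of_abs_deriv_le (fun t ht => hasDerivAt_F A.2 (hIcc t ht).1)
    (fun t ht => hdz t (hIcc t ht).1 (hIcc t ht).2) (x := x) (y := y)
    ⟨min_le_left _ _, le_max_left _ _⟩ ⟨min_le_right _ _, le_max_right _ _⟩
  have e3 := abs_sub_abs_le_abs_sub (P.F A.2 x + A.1) (P.F A.2 y + A.1)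
  rw [add_sub_add_right_eq_sub] at e3
  have : 3 * P.mesh / R = 3 * (P.mesh / R) := by ring
  linarith

theorem resonance_of_fiber {R : ℝ} (hR : P.R₀ ≤ R) {x : ℝ} (hx : x ∈ Icc P.α P.β)
    {S : Finset (ℤ × ℤ × ℤ)} (h1 : ∀ A ∈ S, |(A.2.1 : ℝ)| ≤ 2 * R)
    (h2 : ∀ A ∈ S, |(A.2.2 : ℝ)| ≤ 2 * R)
    (hF : ∀ A ∈ S, |P.F A.2 x + A.1| ≤ 3 * P.mesh / R) (hG : ∀ A ∈ S, |P.dF A.2 x| ≤ 2)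
    {n : ℕ} (hn : 3 ≤ n) (hnS : n ≤ S.card) :
    P.LinearResonance R n x ∨ P.PointResonance R n x := by
  have hR1 : 1 ≤ R := P.one_le_R₀.trans hR
  have hκ := P.κ_pos
  have hm := P.mesh_le
  have hκ1 := P.κ_le
  have hn0 : (0 : ℝ) < n := by exact_mod_cast (by omega : 0 < n)
  have hnS' : (n : ℝ) ≤ S.card := by exact_mod_cast hnS
  rcases cell_dichotomy (f₁ := P.f₁ x) (f₂ := P.f₂ x) (g₁ := P.df₁ x) (g₂ := P.df₂ x)
    (c := 6 * P.mesh) (R := R) hκ (P.κ_le_df₁ x hx) hR1 (by linarith) (by linarith)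
    (hn.trans hnS) (S := S)
    (by
      intro A hA A' hA'
      have := (abs_sub _ _).trans (add_le_add (hF A hA) (hF A' hA'))
      refine (congrArg _ ?_).le.trans (this.trans_eq (by ring))
      simp only [F, Prod.fst_sub, Prod.snd_sub, Int.cast_sub]; ring)
    (by
      intro A hA A' hA'
      have := (abs_sub _ _).trans (add_le_add (hG A hA) (hG A' hA'))
      refine (congrArg _ ?_).le.trans (this.trans_eq (by norm_num))
      simp only [dF, Prod.fst_sub, Prod.snd_sub, Int.cast_sub]; ring)
    (by
      intro A hA A' hA'
      have := (abs_sub _ _).trans (add_le_add (h1 A hA) (h1 A' hA'))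
      refine (congrArg _ ?_).le.trans (this.trans_eq (by ring))
      simp only [Prod.fst_sub, Prod.snd_sub, Int.cast_sub])
    (by
      intro A hA A' hA'
      have := (abs_sub _ _).trans (add_le_add (h2 A hA) (h2 A' hA'))
      refine (congrArg _ ?_).le.trans (this.trans_eq (by ring))
      simp only [Prod.snd_sub, Int.cast_sub]) with ⟨b₁, b₂, hb, c1, c2, c3⟩ | ⟨p₀, p₁, hp, c1, c2⟩
  · left
    refine ⟨b₁, b₂, hb, c1.trans ?_, c2.trans ?_, c3.trans ?_⟩ <;> gcongr
  · right
    refine ⟨p₀, p₁, hp, c1.trans ?_, c2.trans ?_⟩ <;> gcongr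

theorem card_fiber_le {R : ℝ} (hR : P.R₀ ≤ R) {x : ℝ}
    {S : Finset (ℤ × ℤ × ℤ)} (h1 : ∀ A ∈ S, |(A.2.1 : ℝ)| ≤ 2 * R)
    (h2 : ∀ A ∈ S, |(A.2.2 : ℝ)| ≤ 2 * R)
    (hF : ∀ A ∈ S, |P.F A.2 x + A.1| ≤ 3 * P.mesh / R) : (S.card : ℝ) ≤ 25 * R ^ 2 := by
  have hR1 : 1 ≤ R := P.one_le_R₀.trans hR
  have hm := P.mesh_le
  have hκ1 := P.κ_le
  set m := ⌊2 * R⌋₊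
  have hmR : (m : ℝ) ≤ 2 * R := Nat.floor_le (by linarith)
  have hle : ∀ b : ℤ, |(b : ℝ)| ≤ 2 * R → b ∈ Finset.Icc (-(m : ℤ)) m := fun b hb => by
    have : b.natAbs ≤ m := Nat.le_floor (by rwa [Nat.cast_natAbs, Int.cast_abs])
    rw [Finset.mem_Icc]; omega
  have hcard := Finset.card_le_card_of_injOn (s := S)
    (t := Finset.Icc (-(m : ℤ)) m ×ˢ Finset.Icc (-(m : ℤ)) m) (fun A => A.2)
    (fun A hA => Finset.mem_coe.2 (Finset.mem_product.2 ⟨hle _ (h1 A hA), hle _ (h2 A hA)⟩))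
    (by
      intro A hA A' hA' heq
      simp only at heq
      have e := (abs_sub _ _).trans (add_le_add (hF A hA) (hF A' hA'))
      rw [heq, add_sub_add_left_eq_sub] at e
      have hlt : |(A.1 : ℝ) - A'.1| < 1 := by
        have : P.mesh / R ≤ P.mesh := div_le_self mesh_pos.le hR1
        have e3 : 3 * P.mesh / R = 3 * (P.mesh / R) := by ring
        rw [e3] at e
        linarith
      have : A.1 - A'.1 = 0 := Int.abs_lt_one_iff.1 (by exact_mod_cast hlt)
      exact Prod.ext (by omega) heq)
  have h3 : (Finset.Icc (-(m : ℤ)) m).card = 2 * m + 1 := by rw [Int.card_Icc]; omega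
  rw [Finset.card_product, h3] at hcard
  have : (S.card : ℝ) ≤ (2 * m + 1) * (2 * m + 1) := by exact_mod_cast hcard
  nlinarith

theorem exists_card_nearCritical_le (P : PhaseArc) : ∃ C : ℝ, 0 < C ∧ ∀ R δ : ℝ, P.R₀ ≤ R →
    δ ≤ P.mesh / R → ∀ S : Finset (ℤ × ℤ × ℤ), (∀ A ∈ S, P.NearCritical R δ A) →
    (S.card : ℝ) ≤ C * (1 + Real.log R) * (R * √R) := by
  have hκ := P.κ_pos
  have hM := P.one_le_M
  have hmesh : 0 < P.mesh := mesh_pos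
  set C₁ := 12 * (480 / P.κ) * (480 / P.κ + 240 / P.κ / P.mesh) +
    6 * (P.M + 121) * (480 / P.κ) * (480 / P.κ + 240 / P.κ / P.mesh) with hC₁
  have hC₁0 : 0 < C₁ := by positivity
  set C₃ := √(2 * C₁ / P.mesh) + 4 / P.mesh with hC₃
  have hC₃0 : 0 < C₃ := by positivity
  refine ⟨25 * C₃, by positivity, fun R δ hR hδ S hS => ?_⟩
  have hR1 : 1 ≤ R := P.one_le_R₀.trans hR
  choose! x hx hFx hdx using fun A hA => (hS A hA).2.2
  set idx : ℤ × ℤ × ℤ → ℕ := fun A => ⌊(x A - P.α) * R / P.mesh⌋₊ with hidx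
  have hcell : ∀ A ∈ S, P.node R (idx A) ∈ Icc P.α P.β ∧
      |P.node R (idx A) - x A| ≤ P.mesh / R := by
    intro A hA
    have hxA := hx A hA
    have hpos : 0 < P.mesh / R := by positivity
    have h0 : 0 ≤ (x A - P.α) * R / P.mesh := by
      have := sub_nonneg.2 hxA.1
      positivity
    have e1 : (idx A : ℝ) ≤ (x A - P.α) * R / P.mesh := Nat.floor_le h0
    have e2 : (x A - P.α) * R / P.mesh < idx A + 1 := Nat.lt_floor_add_one _
    have e3 : (x A - P.α) * R / P.mesh * (P.mesh / R) = x A - P.α := by field_simp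
    have e4 := mul_le_mul_of_nonneg_right e1 hpos.le
    have e5 := mul_lt_mul_of_pos_right e2 hpos
    rw [e3] at e4 e5
    have e6 : 0 ≤ (idx A : ℝ) * (P.mesh / R) := by positivity
    simp only [node]
    refine ⟨⟨by linarith, by linarith [hxA.2]⟩, ?_⟩
    rw [abs_le]; constructor <;> linarith
  set I := S.image idx with hI
  set n : ℕ → ℕ := fun i => (S.filter fun A => idx A = i).card with hn
  have hnode : ∀ i ∈ I, P.node R i ∈ Icc P.α P.β := fun i hi => by
    obtain ⟨A, hA, rfl⟩ := Finset.mem_image.1 hi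
    exact (hcell A hA).1
  have hfib : ∀ i, ∀ A ∈ S.filter fun A => idx A = i, |(A.2.1 : ℝ)| ≤ 2 * R ∧
      |(A.2.2 : ℝ)| ≤ 2 * R ∧ |P.F A.2 (P.node R i) + A.1| ≤ 3 * P.mesh / R ∧
      |P.dF A.2 (P.node R i)| ≤ 2 := by
    intro i A hA
    obtain ⟨hAS, rfl⟩ := Finset.mem_filter.1 hA
    have := near_node hR hδ (hS A hAS).1 (hS A hAS).2.1 (hcell A hAS).1 (hx A hAS) (hcell A hAS).2
      (hFx A hAS) (hdx A hAS)
    exact ⟨(hS A hAS).1, (hS A hAS).2.1, this⟩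
  have hIcard : (I.card : ℝ) ≤ 2 * R / P.mesh := by
    have := Finset.card_le_of_diam_le (T := I) (D := R / P.mesh) (by positivity) (by
      intro i hi j hj
      have := abs_natCast_sub_le_of_node (P := P) hR1 (i := i) (j := j) (d := 1) (by
        have h1 := hnode i hi
        have h2 := hnode j hj
        have := P.le_one
        rw [abs_le]; constructor <;> linarith [h1.1, h1.2, h2.1, h2.2])
      rwa [one_mul] at this)
    have h1 : 1 ≤ R / P.mesh := by
      rw [one_le_div hmesh]; linarith [P.mesh_le, P.κ_le]
    have h2 : 2 * R / P.mesh = R / P.mesh + R / P.mesh := by ring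
    linarith
  have hsuper : ∀ m : ℕ, 3 ≤ m →
      ((I.filter fun i => m ≤ n i).card : ℝ) ≤ C₁ * (R / m) ^ 2 := by
    intro m hm
    classical
    set I' := I.filter fun i => m ≤ n i with hI'
    have hI'node : ∀ i ∈ I', P.node R i ∈ Icc P.α P.β := fun i hi =>
      hnode i (Finset.mem_filter.1 hi).1
    have hres : ∀ i ∈ I', P.LinearResonance R m (P.node R i) ∨
        P.PointResonance R m (P.node R i) := fun i hi =>
      resonance_of_fiber hR (hI'node i hi) (fun A hA => (hfib i A hA).1)
        (fun A hA => (hfib i A hA).2.1) (fun A hA => (hfib i A hA).2.2.1)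
        (fun A hA => (hfib i A hA).2.2.2) hm (Finset.mem_filter.1 hi).2
    have hsub : I' ⊆ (I'.filter fun i => P.LinearResonance R m (P.node R i)) ∪
        (I'.filter fun i => P.PointResonance R m (P.node R i)) := by
      intro i hi
      rw [Finset.mem_union]
      exact (hres i hi).imp (fun h => Finset.mem_filter.2 ⟨hi, h⟩)
        (fun h => Finset.mem_filter.2 ⟨hi, h⟩)
    have c0 : (I'.card : ℝ) ≤ (I'.filter fun i => P.LinearResonance R m (P.node R i)).card +
        (I'.filter fun i => P.PointResonance R m (P.node R i)).card := by
      exact_mod_cast (Finset.card_le_card hsub).trans (Finset.card_union_le _ _)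
    have c1 := card_linearResonance_le hR1 (by omega : 1 ≤ m)
      (I := I'.filter fun i => P.LinearResonance R m (P.node R i))
      (fun i hi => hI'node i (Finset.mem_filter.1 hi).1) (fun i hi => (Finset.mem_filter.1 hi).2)
    have c2 := card_pointResonance_le hR1 (by omega : 1 ≤ m)
      (I := I'.filter fun i => P.PointResonance R m (P.node R i))
      (fun i hi => hI'node i (Finset.mem_filter.1 hi).1) (fun i hi => (Finset.mem_filter.1 hi).2)
    rw [hC₁, add_mul]
    linarith
  have hR0 : 0 < R := by linarith
  have hsqrt1 : 1 ≤ √R := Real.one_le_sqrt.2 hR1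
  have hlevel : ∀ m : ℕ, 1 ≤ m →
      ((I.filter fun i => m ≤ n i).card : ℝ) ≤ C₃ * (R * √R) / m := by
    intro m hm
    have hm0 : (0 : ℝ) < m := by exact_mod_cast hm
    have hle : ((I.filter fun i => m ≤ n i).card : ℝ) ≤ 2 * R / P.mesh :=
      le_trans (by exact_mod_cast Finset.card_filter_le _ _) hIcard
    by_cases h3 : 3 ≤ m
    · have h4 : ((I.filter fun i => m ≤ n i).card : ℝ) ≤ √(2 * C₁ / P.mesh) * (R * √R) / m := by
        apply le_of_sq_le_sq _ (by positivity)
        calc ((I.filter fun i => m ≤ n i).card : ℝ) ^ 2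
            = (I.filter fun i => m ≤ n i).card * (I.filter fun i => m ≤ n i).card := sq _
          _ ≤ (2 * R / P.mesh) * (C₁ * (R / m) ^ 2) := by gcongr; exact hsuper m h3
          _ = (√(2 * C₁ / P.mesh)) ^ 2 * (R ^ 2 * (√R) ^ 2) / m ^ 2 := by
            rw [Real.sq_sqrt (by positivity), Real.sq_sqrt hR0.le]; field_simp
          _ = _ := by ring
      refine h4.trans ?_
      gcongr
      rw [hC₃]; exact le_add_of_nonneg_right (by positivity)
    · have hm2 : (m : ℝ) ≤ 2 := by exact_mod_cast (by omega : m ≤ 2)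
      refine hle.trans ?_
      rw [le_div_iff₀ hm0]
      calc 2 * R / P.mesh * m ≤ 2 * R / P.mesh * 2 := by gcongr
        _ = 4 / P.mesh * (R * 1) := by ring
        _ ≤ C₃ * (R * √R) := by
          gcongr
          rw [hC₃]; exact le_add_of_nonneg_left (by positivity)
  have hN : ∀ i ∈ I, n i ≤ ⌊25 * R ^ 2⌋₊ := fun i _ => Nat.le_floor
    (card_fiber_le hR (fun A hA => (hfib i A hA).1) (fun A hA => (hfib i A hA).2.1)
      (fun A hA => (hfib i A hA).2.2.1))
  have hsum := Finset.sum_le_of_card_superlevel_le hN (by positivity) hlevel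
  have hS' : (S.card : ℝ) = ∑ i ∈ I, (n i : ℝ) := by
    exact_mod_cast Finset.card_eq_sum_card_image idx S
  rw [hS']
  refine hsum.trans ?_
  have hfl : (0 : ℝ) < ⌊25 * R ^ 2⌋₊ := by
    exact_mod_cast Nat.floor_pos.2 (by nlinarith)
  have hlog : Real.log ⌊25 * R ^ 2⌋₊ ≤ 24 + 2 * Real.log R := by
    calc _ ≤ Real.log (25 * R ^ 2) := Real.log_le_log hfl (Nat.floor_le (by positivity))
      _ = Real.log 25 + 2 * Real.log R := by
        rw [Real.log_mul (by norm_num) (by positivity), Real.log_pow]; norm_num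
      _ ≤ _ := by
        have := Real.log_le_sub_one_of_pos (x := 25) (by norm_num)
        linarith
  have hlogR : 0 ≤ Real.log R := Real.log_nonneg hR1
  calc _ ≤ C₃ * (R * √R) * (25 * (1 + Real.log R)) := by gcongr; linarith
    _ = _ := by ring

end PhaseArc

theorem mul_sub_le_of_le_deriv {F F' : ℝ → ℝ} {x y m : ℝ} (hxy : x ≤ y)
    (hF : ∀ t ∈ Icc x y, HasDerivAt F (F' t) t) (hm : ∀ t ∈ Icc x y, m ≤ F' t) :
    m * (y - x) ≤ F y - F x := by
  rcases hxy.eq_or_lt with rfl | hlt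
  · simp
  obtain ⟨c, hc, hcd⟩ := exists_hasDerivAt_eq_slope F F' hlt
    (fun z hz => (hF z hz).continuousAt.continuousWithinAt)
    (fun z hz => hF z (Ioo_subset_Icc_self hz))
  have h1 := hm c (Ioo_subset_Icc_self hc)
  rwa [hcd, le_div_iff₀ (sub_pos.2 hlt)] at h1

theorem hContent_near_integer_le {s m L δ : ℝ} (hs : 0 < s) (hm : 0 < m) (hL : 0 ≤ L)
    (hδ : 0 < δ) (hδ1 : δ ≤ 1) {T : Set ℝ} {F : ℝ → ℝ}
    (hlow : ∀ x ∈ T, ∀ y ∈ T, m * |x - y| ≤ |F x - F y|)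
    (hup : ∀ x ∈ T, ∀ y ∈ T, |F x - F y| ≤ L) :
    hContent s {x ∈ T | ∃ z : ℤ, |F x + z| < δ} ≤
      ENNReal.ofReal ((2 * L + 5) * (2 * δ / m) ^ s) := by
  rcases eq_empty_or_nonempty {x ∈ T | ∃ z : ℤ, |F x + z| < δ} with h | ⟨x₀, hx₀, z₀, hz₀⟩
  · rw [h]; simp
  set k := ⌊L + 2⌋₊ with hk
  have hk1 : (k : ℝ) ≤ L + 2 := Nat.floor_le (by linarith)
  set Z := Finset.Icc (z₀ - k) (z₀ + k) with hZ
  have hcard : (Z.card : ℝ) ≤ 2 * L + 5 := by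
    have : Z.card = 2 * k + 1 := by rw [hZ, Int.card_Icc]; omega
    rw [this]; push_cast; linarith
  have hsub : {x ∈ T | ∃ z : ℤ, |F x + z| < δ} ⊆
      ⋃ z ∈ Z, {x ∈ T | |F x + (z : ℤ)| < δ} := by
    rintro x ⟨hx, z, hz⟩
    refine mem_biUnion ?_ (⟨hx, hz⟩ : x ∈ {x ∈ T | |F x + (z : ℤ)| < δ})
    have h1 := abs_lt.1 hz
    have h2 := abs_lt.1 hz₀
    have h3 := abs_le.1 (hup x hx x₀ hx₀)
    have h4 : |(z : ℝ) - z₀| ≤ L + 2 := by rw [abs_le]; constructor <;> linarith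
    have h5 : (z - z₀).natAbs ≤ k := Nat.le_floor (by
      rw [Nat.cast_natAbs]; push_cast; exact h4)
    simp only [hZ, Finset.coe_Icc, mem_Icc]
    omega
  calc _ ≤ hContent s (⋃ z ∈ Z, {x ∈ T | |F x + (z : ℤ)| < δ}) := measure_mono hsub
    _ ≤ ∑ z ∈ Z, hContent s {x ∈ T | |F x + (z : ℤ)| < δ} := measure_biUnion_finset_le _ _
    _ ≤ ∑ z ∈ Z, ENNReal.ofReal ((2 * δ / m) ^ s) := Finset.sum_le_sum fun z _ =>
        hContent_le_of_dist hs (by positivity) fun x hx y hy => by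
          rw [le_div_iff₀ hm, mul_comm]
          refine (hlow x hx.1 y hy.1).trans ?_
          have h1 := abs_lt.1 hx.2
          have h2 := abs_lt.1 hy.2
          rw [abs_le]; constructor <;> linarith
    _ = ENNReal.ofReal (Z.card * (2 * δ / m) ^ s) := by
        rw [Finset.sum_const, nsmul_eq_mul,
          ENNReal.ofReal_mul (Nat.cast_nonneg _), ENNReal.ofReal_natCast]
    _ ≤ _ := by gcongr

section Convex

variable {α β μ : ℝ} {H H' H'' : ℝ → ℝ}

theorem deriv_diff_ge (hH' : ∀ x ∈ Icc α β, HasDerivAt H' (H'' x) x)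
    (hμ : ∀ x ∈ Icc α β, μ ≤ H'' x) {x y : ℝ} (hx : x ∈ Icc α β) (hy : y ∈ Icc α β)
    (hxy : x ≤ y) : μ * (y - x) ≤ H' y - H' x :=
  mul_sub_le_of_le_deriv hxy (fun t ht => hH' t ⟨hx.1.trans ht.1, ht.2.trans hy.2⟩)
    fun t ht => hμ t ⟨hx.1.trans ht.1, ht.2.trans hy.2⟩

theorem hContent_convex_sublevel_le (hH : ∀ x ∈ Icc α β, HasDerivAt H (H' x) x)
    (hH' : ∀ x ∈ Icc α β, HasDerivAt H' (H'' x) x) (hμ0 : 0 < μ)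
    (hμ : ∀ x ∈ Icc α β, μ ≤ H'' x) {s δ : ℝ} (hs : 0 < s) (hδ : 0 < δ) (z : ℝ) :
    hContent s {x ∈ Icc α β | |H x + z| < δ} ≤ ENNReal.ofReal (2 * (√(8 * δ / μ)) ^ s) := by
  have key : ∀ x ∈ Icc α β, ∀ y ∈ Icc α β, x ≤ y → (0 ≤ H' x ∨ H' y ≤ 0) →
      μ * (y - x) ^ 2 / 4 ≤ |H y - H x| := by
    intro x hx y hy hxy hsign
    have hd : 0 ≤ y - x := sub_nonneg.2 hxy
    set w := (x + y) / 2 with hw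
    have hxw : x ≤ w := by rw [hw]; linarith
    have hwy : w ≤ y := by rw [hw]; linarith
    have hwJ : w ∈ Icc α β := ⟨hx.1.trans hxw, hwy.trans hy.2⟩
    have hJ : ∀ t, x ≤ t → t ≤ y → t ∈ Icc α β := fun t h1 h2 => ⟨hx.1.trans h1, h2.trans hy.2⟩
    rcases hsign with h0 | h0
    · have e1 := mul_sub_le_of_le_deriv (m := 0) hxw (fun t ht => hH t (hJ t ht.1 (ht.2.trans hwy)))
        (fun t ht => by
          have := deriv_diff_ge hH' hμ hx (hJ t ht.1 (ht.2.trans hwy)) ht.1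
          nlinarith [ht.1])
      have e2 := mul_sub_le_of_le_deriv (m := μ * (y - x) / 2) hwy
        (fun t ht => hH t (hJ t (hxw.trans ht.1) ht.2))
        (fun t ht => by
          have := deriv_diff_ge hH' hμ hx (hJ t (hxw.trans ht.1) ht.2) (hxw.trans ht.1)
          nlinarith [ht.1])
      have e3 : y - w = (y - x) / 2 := by rw [hw]; ring
      rw [e3] at e2
      refine le_trans ?_ (le_abs_self _)
      nlinarith
    · have e1 := mul_sub_le_of_le_deriv (F := fun t => -H t) (m := 0) hwy
        (fun t ht => (hH t (hJ t (hxw.trans ht.1) ht.2)).neg)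
        (fun t ht => by
          have := deriv_diff_ge hH' hμ (hJ t (hxw.trans ht.1) ht.2) hy ht.2
          nlinarith [ht.2])
      have e2 := mul_sub_le_of_le_deriv (F := fun t => -H t) (m := μ * (y - x) / 2) hxw
        (fun t ht => (hH t (hJ t ht.1 (ht.2.trans hwy))).neg)
        (fun t ht => by
          have := deriv_diff_ge hH' hμ (hJ t ht.1 (ht.2.trans hwy)) hy (ht.2.trans hwy)
          nlinarith [ht.2])
      have e3 : w - x = (y - x) / 2 := by rw [hw]; ring
      rw [e3] at e2
      refine le_trans ?_ (neg_le_abs _)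
      nlinarith
  have diam : ∀ x ∈ Icc α β, ∀ y ∈ Icc α β, x ≤ y → (0 ≤ H' x ∨ H' y ≤ 0) → |H x + z| < δ →
      |H y + z| < δ → |x - y| ≤ √(8 * δ / μ) := by
    intro x hx y hy hxy hsign h1 h2
    apply Real.le_sqrt_of_sq_le
    rw [sq_abs, le_div_iff₀ hμ0]
    have := key x hx y hy hxy hsign
    have h3 : |H y - H x| ≤ 2 * δ := by
      have := abs_lt.1 h1
      have := abs_lt.1 h2
      rw [abs_le]; constructor <;> linarith
    nlinarith
  have hsub : {x ∈ Icc α β | |H x + z| < δ} ⊆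
      {x ∈ Icc α β | |H x + z| < δ ∧ 0 ≤ H' x} ∪ {x ∈ Icc α β | |H x + z| < δ ∧ H' x ≤ 0} := by
    rintro x ⟨hx, hz⟩
    exact (le_total 0 (H' x)).imp (⟨hx, hz, ·⟩) (⟨hx, hz, ·⟩)
  have h1 : hContent s {x ∈ Icc α β | |H x + z| < δ ∧ 0 ≤ H' x} ≤
      ENNReal.ofReal ((√(8 * δ / μ)) ^ s) :=
    hContent_le_of_dist hs (Real.sqrt_nonneg _) fun x hx y hy => by
      rcases le_total x y with h | h
      · exact diam x hx.1 y hy.1 h (Or.inl hx.2.2) hx.2.1 hy.2.1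
      · rw [abs_sub_comm]; exact diam y hy.1 x hx.1 h (Or.inl hy.2.2) hy.2.1 hx.2.1
  have h2 : hContent s {x ∈ Icc α β | |H x + z| < δ ∧ H' x ≤ 0} ≤
      ENNReal.ofReal ((√(8 * δ / μ)) ^ s) :=
    hContent_le_of_dist hs (Real.sqrt_nonneg _) fun x hx y hy => by
      rcases le_total x y with h | h
      · exact diam x hx.1 y hy.1 h (Or.inr hy.2.2) hx.2.1 hy.2.1
      · rw [abs_sub_comm]; exact diam y hy.1 x hx.1 h (Or.inr hx.2.2) hy.2.1 hx.2.1
  calc _ ≤ _ := measure_mono hsub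
    _ ≤ _ := measure_union_le _ _
    _ ≤ _ := add_le_add h1 h2
    _ = _ := by rw [← ENNReal.ofReal_add (by positivity) (by positivity)]; ring_nf

theorem hContent_dyadic_le (hH : ∀ x ∈ Icc α β, HasDerivAt H (H' x) x)
    (hH' : ∀ x ∈ Icc α β, HasDerivAt H' (H'' x) x) (hμ0 : 0 < μ)
    (hμ : ∀ x ∈ Icc α β, μ ≤ H'' x) {s δ D : ℝ} (hs : 0 < s) (hδ : 0 < δ) (hδ1 : δ ≤ 1)
    (hD : 0 < D) :
    hContent s {x ∈ Icc α β | (D ≤ |H' x| ∧ |H' x| < 2 * D) ∧ ∃ z : ℤ, |H x + z| < δ} ≤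
      ENNReal.ofReal (2 * ((4 * D ^ 2 / μ + 5) * (2 * δ / D) ^ s)) := by
  have main : ∀ T : Set ℝ, (∀ x ∈ T, x ∈ Icc α β) →
      ((∀ x ∈ T, D ≤ H' x ∧ H' x < 2 * D) ∨ (∀ x ∈ T, D ≤ -H' x ∧ -H' x < 2 * D)) →
      hContent s {x ∈ T | ∃ z : ℤ, |H x + z| < δ} ≤
        ENNReal.ofReal ((4 * D ^ 2 / μ + 5) * (2 * δ / D) ^ s) := by
    intro T hTJ hT
    have hbetween : ∀ x ∈ T, ∀ y ∈ T, ∀ t ∈ Icc x y, D ≤ |H' t| ∧ |H' t| ≤ 2 * D := by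
      intro x hx y hy t ht
      have htJ : t ∈ Icc α β := ⟨(hTJ x hx).1.trans ht.1, ht.2.trans (hTJ y hy).2⟩
      have e1 := deriv_diff_ge hH' hμ (hTJ x hx) htJ ht.1
      have e2 := deriv_diff_ge hH' hμ htJ (hTJ y hy) ht.2
      have e3 : 0 ≤ μ * (t - x) := mul_nonneg hμ0.le (sub_nonneg.2 ht.1)
      have e4 : 0 ≤ μ * (y - t) := mul_nonneg hμ0.le (sub_nonneg.2 ht.2)
      rcases hT with hT | hT
      · have a1 := hT x hx
        have a2 := hT y hy
        rw [abs_of_pos (by linarith)]; constructor <;> linarith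
      · have a1 := hT x hx
        have a2 := hT y hy
        rw [abs_of_neg (by linarith)]; constructor <;> linarith
    have hdist : ∀ x ∈ T, ∀ y ∈ T, x ≤ y → y - x ≤ D / μ := by
      intro x hx y hy hxy
      rw [le_div_iff₀ hμ0]
      have e1 := deriv_diff_ge hH' hμ (hTJ x hx) (hTJ y hy) hxy
      rcases hT with hT | hT <;> linarith [hT x hx, hT y hy]
    have hboth : ∀ x ∈ T, ∀ y ∈ T, D * |x - y| ≤ |H x - H y| ∧ |H x - H y| ≤ 2 * D ^ 2 / μ := by
      intro x hx y hy
      wlog hxy : x ≤ y generalizing x y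
      · rw [abs_sub_comm x, abs_sub_comm (H x)]; exact this y hy x hx (le_of_not_ge hxy)
      have hd : ∀ t ∈ Icc x y, HasDerivAt H (H' t) t := fun t ht =>
        hH t ⟨(hTJ x hx).1.trans ht.1, ht.2.trans (hTJ y hy).2⟩
      refine ⟨mul_abs_sub_le_of_le_abs_deriv hd (fun t ht => (hbetween x hx y hy t ht).1)
        (left_mem_Icc.2 hxy) (right_mem_Icc.2 hxy), ?_⟩
      refine (abs_sub_le_of_abs_deriv_le hd (fun t ht => (hbetween x hx y hy t ht).2)
        (left_mem_Icc.2 hxy) (right_mem_Icc.2 hxy)).trans ?_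
      rw [abs_sub_comm, abs_of_nonneg (sub_nonneg.2 hxy)]
      calc 2 * D * (y - x) ≤ 2 * D * (D / μ) := by gcongr; exact hdist x hx y hy hxy
        _ = _ := by ring
    have := hContent_near_integer_le (L := 2 * D ^ 2 / μ) hs hD (by positivity) hδ hδ1
      (fun x hx y hy => (hboth x hx y hy).1) (fun x hx y hy => (hboth x hx y hy).2)
    refine this.trans_eq ?_
    congr 3; ring
  have h1 := main {x ∈ Icc α β | D ≤ H' x ∧ H' x < 2 * D} (fun x hx => hx.1)
    (Or.inl fun x hx => hx.2)
  have h2 := main {x ∈ Icc α β | D ≤ -H' x ∧ -H' x < 2 * D} (fun x hx => hx.1)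
    (Or.inr fun x hx => hx.2)
  refine (measure_mono ?_).trans ((measure_union_le _ _).trans ((add_le_add h1 h2).trans_eq ?_))
  · rintro x ⟨hx, ⟨hD1, hD2⟩, hz⟩
    rcases abs_cases (H' x) with ⟨h, _⟩ | ⟨h, _⟩
    · rw [h] at hD1 hD2; exact Or.inl ⟨⟨hx, hD1, hD2⟩, hz⟩
    · rw [h] at hD1 hD2; exact Or.inr ⟨⟨hx, hD1, hD2⟩, hz⟩
  · rw [← ENNReal.ofReal_add (by positivity) (by positivity)]; ring_nf

theorem hContent_convex_noncritical_le (hH : ∀ x ∈ Icc α β, HasDerivAt H (H' x) x)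
    (hH' : ∀ x ∈ Icc α β, HasDerivAt H' (H'' x) x) (hμ0 : 0 < μ)
    (hμ : ∀ x ∈ Icc α β, μ ≤ H'' x) {s δ Λ : ℝ} (hs : 0 < s) (hs1 : s ≤ 1) (hδ : 0 < δ)
    (hδ1 : δ ≤ 1) (hΛ1 : 1 ≤ Λ) (hΛ : ∀ x ∈ Icc α β, |H' x| ≤ Λ) :
    hContent s {x ∈ Icc α β | 1 ≤ |H' x| ∧ ∃ z : ℤ, |H x + z| < δ} ≤
      ENNReal.ofReal ((1 + 2 * Real.log Λ) * (4 * δ ^ s * (4 * Λ ^ (2 - s) / μ + 5))) := by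
  set N := ⌊2 * Real.log Λ⌋₊ with hN
  have hlog : 0 ≤ Real.log Λ := Real.log_nonneg hΛ1
  have hj : ∀ x ∈ Icc α β, 1 ≤ |H' x| →
      ∃ j ∈ (Finset.range (N + 1)).filter (fun j => (2 : ℝ) ^ j ≤ Λ),
      (2 : ℝ) ^ j ≤ |H' x| ∧ |H' x| < 2 * 2 ^ j := by
    intro x hx h1
    obtain ⟨j, hj1, hj2⟩ := exists_nat_pow_near h1 (by norm_num : (1 : ℝ) < 2)
    have hjΛ := hj1.trans (hΛ x hx)
    refine ⟨j, ?_, hj1, by rwa [pow_succ, mul_comm] at hj2⟩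
    rw [Finset.mem_filter, Finset.mem_range, Nat.lt_succ_iff]
    refine ⟨Nat.le_floor ?_, hjΛ⟩
    have := Real.log_le_log (by positivity) hjΛ
    rw [Real.log_pow] at this
    have h2 := Real.log_two_gt_d9
    have : (0 : ℝ) ≤ j := Nat.cast_nonneg j
    nlinarith
  have hterm : ∀ j ∈ (Finset.range (N + 1)).filter (fun j => (2 : ℝ) ^ j ≤ Λ),
      2 * ((4 * ((2 : ℝ) ^ j) ^ 2 / μ + 5) * (2 * δ / 2 ^ j) ^ s) ≤
      4 * δ ^ s * (4 * Λ ^ (2 - s) / μ + 5) := by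
    intro j hj
    have hjΛ := (Finset.mem_filter.1 hj).2
    set D : ℝ := (2 : ℝ) ^ j with hD
    have hD1 : 1 ≤ D := one_le_pow₀ (by norm_num)
    have hD0 : 0 < D := by positivity
    have hDs : (2 * δ / D) ^ s = 2 ^ s * δ ^ s / D ^ s := by
      rw [Real.div_rpow (by positivity) hD0.le, Real.mul_rpow (by norm_num) hδ.le]
    have h2s : (2 : ℝ) ^ s ≤ 2 := by
      calc (2 : ℝ) ^ s ≤ 2 ^ (1 : ℝ) := Real.rpow_le_rpow_of_exponent_le (by norm_num) hs1
        _ = 2 := Real.rpow_one 2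
    have hDs1 : 1 ≤ D ^ s := Real.one_le_rpow hD1 hs.le
    have e1 : D ^ 2 / D ^ s = D ^ (2 - s) := by
      rw [Real.rpow_sub hD0, Real.rpow_two]
    have e2 : D ^ (2 - s) ≤ Λ ^ (2 - s) := Real.rpow_le_rpow hD0.le hjΛ (by linarith)
    calc 2 * ((4 * D ^ 2 / μ + 5) * (2 * δ / D) ^ s)
        = 2 * 2 ^ s * δ ^ s * (4 * (D ^ 2 / D ^ s) / μ + 5 / D ^ s) := by
          rw [hDs]; ring
      _ ≤ 2 * 2 * δ ^ s * (4 * Λ ^ (2 - s) / μ + 5) := by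
          rw [e1]
          gcongr
          exact div_le_self (by norm_num) hDs1
      _ = _ := by ring
  have hsub : {x ∈ Icc α β | 1 ≤ |H' x| ∧ ∃ z : ℤ, |H x + z| < δ} ⊆
      ⋃ j ∈ (Finset.range (N + 1)).filter (fun j => (2 : ℝ) ^ j ≤ Λ),
        {x ∈ Icc α β | ((2 : ℝ) ^ j ≤ |H' x| ∧ |H' x| < 2 * 2 ^ j) ∧ ∃ z : ℤ, |H x + z| < δ} := by
    rintro x ⟨hx, h1, hz⟩
    obtain ⟨j, hjN, hj'⟩ := hj x hx h1
    exact mem_biUnion (Finset.mem_coe.2 hjN) ⟨hx, hj', hz⟩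
  calc _ ≤ _ := measure_mono hsub
    _ ≤ _ := measure_biUnion_finset_le _ _
    _ ≤ ∑ j ∈ (Finset.range (N + 1)).filter (fun j => (2 : ℝ) ^ j ≤ Λ),
        ENNReal.ofReal (4 * δ ^ s * (4 * Λ ^ (2 - s) / μ + 5)) := Finset.sum_le_sum fun j hj =>
        (hContent_dyadic_le hH hH' hμ0 hμ hs hδ hδ1 (by positivity)).trans
          (ENNReal.ofReal_le_ofReal (hterm j hj))
    _ = ENNReal.ofReal (((Finset.range (N + 1)).filter (fun j => (2 : ℝ) ^ j ≤ Λ)).card *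
          (4 * δ ^ s * (4 * Λ ^ (2 - s) / μ + 5))) := by
        rw [Finset.sum_const, nsmul_eq_mul,
          ENNReal.ofReal_mul (Nat.cast_nonneg _), ENNReal.ofReal_natCast]
    _ ≤ _ := by
        gcongr
        have h1 : ((Finset.range (N + 1)).filter (fun j => (2 : ℝ) ^ j ≤ Λ)).card ≤ N + 1 :=
          (Finset.card_filter_le _ _).trans_eq (Finset.card_range _)
        have h2 : (N : ℝ) ≤ 2 * Real.log Λ := Nat.floor_le (by linarith)
        have h3 :
            (((Finset.range (N + 1)).filter (fun j => (2 : ℝ) ^ j ≤ Λ)).card : ℝ) ≤ N + 1 := by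
          exact_mod_cast h1
        linarith

end Convex

namespace PhaseArc
variable {P : PhaseArc}

/-- Points at which the phase of some frequency of size about `R` is `δ`-close to an integer. -/
def nearSet (P : PhaseArc) (R δ : ℝ) : Set ℝ :=
  {x ∈ Icc P.α P.β | ∃ a : ℤ × ℤ, R ≤ max |(a.1 : ℝ)| |(a.2 : ℝ)| ∧ |(a.1 : ℝ)| ≤ 2 * R ∧
    |(a.2 : ℝ)| ≤ 2 * R ∧ ∃ z : ℤ, |P.F a x + z| < δ}

theorem le_dF_or_le_ddF {R : ℝ} (hR : P.R₀ ≤ R) {a : ℤ × ℤ}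
    (ha : R ≤ max |(a.1 : ℝ)| |(a.2 : ℝ)|) :
    (∀ x ∈ Icc P.α P.β, P.κ / 2 * R ≤ |P.dF a x|) ∨
      (∀ x ∈ Icc P.α P.β, P.κ / 2 * R ≤ |P.ddF a x|) := by
  have hκ := P.κ_pos
  have h1 : P.κ * R ≤ P.κ * max |(a.1 : ℝ)| |(a.2 : ℝ)| := by gcongr
  have h2 : P.κ / 2 * P.R₀ ≤ P.κ / 2 * R := by gcongr
  have key : ∀ u w : ℝ, P.κ * max |(a.1 : ℝ)| |(a.2 : ℝ)| ≤ |u| → |w| ≤ P.κ / 2 * P.R₀ →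
      P.κ / 2 * R ≤ |u + w| := by
    intro u w hu hw
    have := abs_sub_abs_le_abs_sub u (-w)
    rw [abs_neg, sub_neg_eq_add] at this
    linarith
  rcases P.dichotomy a.1 a.2 with h | h
  · exact Or.inl fun x hx => key _ _ (h x hx) (P.dg_le x hx)
  · exact Or.inr fun x hx => key _ _ (h x hx) (P.ddg_le x hx)

theorem le_ddF_or_le_neg_ddF {m : ℝ} (hm : 0 < m) {a : ℤ × ℤ}
    (h : ∀ x ∈ Icc P.α P.β, m ≤ |P.ddF a x|) :
    (∀ x ∈ Icc P.α P.β, m ≤ P.ddF a x) ∨ (∀ x ∈ Icc P.α P.β, m ≤ -P.ddF a x) := by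
  rcases hasDerivWithinAt_forall_lt_or_forall_gt_of_forall_ne (convex_Icc P.α P.β)
    (fun x hx => (hasDerivAt_dF a hx).hasDerivWithinAt) (m := 0)
    (fun x hx h0 => by have := h x hx; rw [h0, abs_zero] at this; linarith) with h1 | h1
  · refine Or.inr fun x hx => ?_
    have := h x hx
    rwa [abs_of_neg (h1 x hx)] at this
  · refine Or.inl fun x hx => ?_
    have := h x hx
    rwa [abs_of_pos (h1 x hx)] at this

theorem rpow_le_self_of_one_le {x s : ℝ} (hx : 1 ≤ x) (hs1 : s ≤ 1) : x ^ s ≤ x := by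
  simpa using Real.rpow_le_rpow_of_exponent_le hx hs1

theorem hContent_noncritical_le {s R δ : ℝ} (hs : 0 < s) (hs1 : s ≤ 1) (hR : P.R₀ ≤ R)
    (hδ : 0 < δ) (hδ1 : δ ≤ 1) {a : ℤ × ℤ} (h1 : |(a.1 : ℝ)| ≤ 2 * R)
    (h2 : |(a.2 : ℝ)| ≤ 2 * R) (h : ∀ x ∈ Icc P.α P.β, P.κ / 2 * R ≤ |P.ddF a x|) :
    hContent s {x ∈ Icc P.α P.β | 1 ≤ |P.dF a x| ∧ ∃ z : ℤ, |P.F a x + z| < δ} ≤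
      ENNReal.ofReal ((2 + 2 * Real.log (5 * P.M)) * (820 * P.M ^ 2 / P.κ) *
        ((1 + Real.log R) * (R * (δ / R) ^ s))) := by
  have hκ := P.κ_pos
  have hκ1 := P.κ_le
  have hM := P.one_le_M
  have hR1 : 1 ≤ R := P.one_le_R₀.trans hR
  have hR0 : 0 < R := by linarith
  have hlR : 0 ≤ Real.log R := Real.log_nonneg hR1
  have hlM : 0 ≤ Real.log (5 * P.M) := Real.log_nonneg (by linarith)
  have hμ : 0 < P.κ / 2 * R := by positivity
  have hΛ1 : 1 ≤ 5 * P.M * R := by nlinarith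
  have hΛ : ∀ x ∈ Icc P.α P.β, |P.dF a x| ≤ 5 * P.M * R := fun x hx => abs_dF_le hR h1 h2 hx
  refine LE.le.trans ?_ (ENNReal.ofReal_le_ofReal (?_ :
    (1 + 2 * Real.log (5 * P.M * R)) *
      (4 * δ ^ s * (4 * (5 * P.M * R) ^ (2 - s) / (P.κ / 2 * R) + 5)) ≤ _))
  · rcases le_ddF_or_le_neg_ddF hμ h with h' | h'
    · exact hContent_convex_noncritical_le (fun x hx => hasDerivAt_F a hx)
        (fun x hx => hasDerivAt_dF a hx) hμ h' hs hs1 hδ hδ1 hΛ1 hΛ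
    · refine le_trans (measure_mono ?_) (hContent_convex_noncritical_le
        (fun x hx => (hasDerivAt_F a hx).neg) (fun x hx => (hasDerivAt_dF a hx).neg) hμ h' hs hs1
        hδ hδ1 hΛ1 (fun x hx => by rw [abs_neg]; exact hΛ x hx))
      rintro x ⟨hx, hx1, z, hz⟩
      refine ⟨hx, by rwa [abs_neg], -z, ?_⟩
      rw [← abs_neg] at hz
      convert hz using 2
      push_cast; simp only [Pi.neg_apply]; ring
  · have e1 : (5 * P.M * R) ^ (2 - s) ≤ 25 * P.M ^ 2 * R ^ 2 / R ^ s := by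
      rw [Real.rpow_sub (by positivity), Real.rpow_two]
      have : R ^ s ≤ (5 * P.M * R) ^ s := Real.rpow_le_rpow hR0.le (by nlinarith) hs.le
      rw [show 25 * P.M ^ 2 * R ^ 2 = (5 * P.M * R) ^ 2 by ring]
      gcongr
    have e2 : 1 ≤ R / R ^ s := by
      rw [one_le_div (by positivity)]; exact rpow_le_self_of_one_le hR1 hs1
    have e3 : 4 * (5 * P.M * R) ^ (2 - s) / (P.κ / 2 * R) + 5 ≤
        205 * P.M ^ 2 / P.κ * (R / R ^ s) := by
      have h3 : 4 * (5 * P.M * R) ^ (2 - s) / (P.κ / 2 * R) ≤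
          200 * P.M ^ 2 / P.κ * (R / R ^ s) := by
        calc _ ≤ 4 * (25 * P.M ^ 2 * R ^ 2 / R ^ s) / (P.κ / 2 * R) := by gcongr
          _ = _ := by field_simp; ring
      have h4 : 1 ≤ P.M ^ 2 / P.κ := by
        rw [one_le_div hκ]; nlinarith
      have h5 : 5 ≤ 5 * (P.M ^ 2 / P.κ) * (R / R ^ s) := by nlinarith
      calc _ ≤ 200 * P.M ^ 2 / P.κ * (R / R ^ s) + 5 * (P.M ^ 2 / P.κ) * (R / R ^ s) := by
            linarith
        _ = _ := by ring
    have e4 : 1 + 2 * Real.log (5 * P.M * R) ≤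
        (2 + 2 * Real.log (5 * P.M)) * (1 + Real.log R) := by
      rw [Real.log_mul (by positivity) hR0.ne']
      nlinarith [mul_nonneg hlM hlR]
    calc _ ≤ (2 + 2 * Real.log (5 * P.M)) * (1 + Real.log R) *
          (4 * δ ^ s * (205 * P.M ^ 2 / P.κ * (R / R ^ s))) := by gcongr
      _ = _ := by rw [Real.div_rpow hδ.le hR0.le]; ring

theorem hContent_monotone_le {s R δ : ℝ} (hs : 0 < s) (hs1 : s ≤ 1) (hR : P.R₀ ≤ R)
    (hδ : 0 < δ) (hδ1 : δ ≤ 1) {a : ℤ × ℤ} (h1 : |(a.1 : ℝ)| ≤ 2 * R)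
    (h2 : |(a.2 : ℝ)| ≤ 2 * R) (h : ∀ x ∈ Icc P.α P.β, P.κ / 2 * R ≤ |P.dF a x|) :
    hContent s {x ∈ Icc P.α P.β | ∃ z : ℤ, |P.F a x + z| < δ} ≤
      ENNReal.ofReal ((2 + 2 * Real.log (5 * P.M)) * (820 * P.M ^ 2 / P.κ) *
        ((1 + Real.log R) * (R * (δ / R) ^ s))) := by
  have hκ := P.κ_pos
  have hκ1 := P.κ_le
  have hM := P.one_le_M
  have hR1 : 1 ≤ R := P.one_le_R₀.trans hR
  have hR0 : 0 < R := by linarith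
  have hlR : 0 ≤ Real.log R := Real.log_nonneg hR1
  have hlM : 0 ≤ Real.log (5 * P.M) := Real.log_nonneg (by linarith)
  refine (hContent_near_integer_le (L := 5 * P.M * R) hs (by positivity : 0 < P.κ / 2 * R)
    (by positivity) hδ hδ1
    (fun x hx y hy => mul_abs_sub_le_of_le_abs_deriv (fun x hx => hasDerivAt_F a hx) h hx hy)
    (fun x hx y hy => ?_)).trans (ENNReal.ofReal_le_ofReal ?_)
  · refine (abs_sub_le_of_abs_deriv_le (fun x hx => hasDerivAt_F a hx)
      (fun x hx => abs_dF_le hR h1 h2 hx) hx hy).trans ?_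
    have : |x - y| ≤ 1 := by
      have := P.le_one
      rw [abs_le]; constructor <;> linarith [hx.1, hx.2, hy.1, hy.2]
    nlinarith [mul_nonneg (by linarith : 0 ≤ P.M) hR0.le]
  · have e1 : (2 * δ / (P.κ / 2 * R)) ^ s ≤ 4 / P.κ * (δ / R) ^ s := by
      rw [show 2 * δ / (P.κ / 2 * R) = 4 / P.κ * (δ / R) by field_simp; ring,
        Real.mul_rpow (by positivity) (by positivity)]
      gcongr
      refine rpow_le_self_of_one_le ?_ hs1
      rw [one_le_div hκ]; linarith
    calc _ ≤ (2 * (5 * P.M * R) + 5) * (4 / P.κ * (δ / R) ^ s) := by gcongr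
      _ ≤ (15 * P.M * R) * (4 / P.κ * (δ / R) ^ s) := by
          gcongr; nlinarith
      _ = 1 * (60 * P.M / P.κ) * (1 * (R * (δ / R) ^ s)) := by ring
      _ ≤ _ := by
          gcongr
          · linarith
          · linarith
          · nlinarith
          · linarith

theorem hContent_sublevel_le {s R δ : ℝ} (hs : 0 < s) (hs1 : s ≤ 1) (hR : 0 < R)
    (hδ : 0 < δ) {a : ℤ × ℤ} (h : ∀ x ∈ Icc P.α P.β, P.κ / 2 * R ≤ |P.ddF a x|) (z : ℤ) :
    hContent s {x ∈ Icc P.α P.β | |P.F a x + z| < δ} ≤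
      ENNReal.ofReal (32 / P.κ * √(δ / R) ^ s) := by
  have hκ := P.κ_pos
  have hκ1 := P.κ_le
  have hμ : 0 < P.κ / 2 * R := by positivity
  refine LE.le.trans ?_ (ENNReal.ofReal_le_ofReal (?_ :
    2 * √(8 * δ / (P.κ / 2 * R)) ^ s ≤ _))
  · rcases le_ddF_or_le_neg_ddF hμ h with h' | h'
    · exact hContent_convex_sublevel_le (fun x hx => hasDerivAt_F a hx)
        (fun x hx => hasDerivAt_dF a hx) hμ h' hs hδ z
    · refine le_trans (measure_mono ?_) (hContent_convex_sublevel_le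
        (fun x hx => (hasDerivAt_F a hx).neg) (fun x hx => (hasDerivAt_dF a hx).neg) hμ h' hs
        hδ (-z))
      rintro x ⟨hx, hz⟩
      refine ⟨hx, ?_⟩
      rw [← abs_neg] at hz
      convert hz using 2
      simp only [Pi.neg_apply]; ring
  · have h16 : 1 ≤ 16 / P.κ := by rw [one_le_div hκ]; linarith
    rw [show 8 * δ / (P.κ / 2 * R) = 16 / P.κ * (δ / R) by field_simp; ring,
      Real.sqrt_mul (by positivity), Real.mul_rpow (by positivity) (by positivity)]
    have h1 : √(16 / P.κ) ^ s ≤ 16 / P.κ := by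
      refine (rpow_le_self_of_one_le (Real.one_le_sqrt.2 h16) hs1).trans ?_
      exact Real.sqrt_le_iff.2 ⟨by linarith, by nlinarith⟩
    calc _ ≤ 2 * (16 / P.κ * √(δ / R) ^ s) := by gcongr
      _ = _ := by ring

theorem mesh_div_le_one {R : ℝ} (hR : P.R₀ ≤ R) : P.mesh / R ≤ 1 := by
  have := P.one_le_R₀
  have h := mesh_le (P := P)
  have := P.κ_le
  rw [div_le_one (by linarith)]; linarith

theorem exists_hContent_nearSet_le (P : PhaseArc) : ∃ C : ℝ, 0 < C ∧ ∀ s R δ : ℝ, 0 < s → s ≤ 1 →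
    P.R₀ ≤ R → 0 < δ → δ ≤ P.mesh / R → hContent s (P.nearSet R δ) ≤
      ENNReal.ofReal (C * (1 + Real.log R) * (R ^ 3 * (δ / R) ^ s + R * √R * √(δ / R) ^ s)) := by
  obtain ⟨C₀, hC₀, hcount⟩ := P.exists_card_nearCritical_le
  have hκ := P.κ_pos
  have hM := P.one_le_M
  have hlM : 0 ≤ Real.log (5 * P.M) := Real.log_nonneg (by linarith)
  set C₁ := (2 + 2 * Real.log (5 * P.M)) * (820 * P.M ^ 2 / P.κ) with hC₁
  have hC₁0 : 0 < C₁ := by positivity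
  refine ⟨25 * C₁ + C₀ * (32 / P.κ), by positivity, fun s R δ hs hs1 hR hδ hδR => ?_⟩
  have hR1 : 1 ≤ R := P.one_le_R₀.trans hR
  have hR0 : 0 < R := by linarith
  have hlR : 0 ≤ Real.log R := Real.log_nonneg hR1
  have hδ1 : δ ≤ 1 := hδR.trans (mesh_div_le_one hR)
  set k := ⌊2 * R⌋₊ with hk
  have hk2 : (k : ℝ) ≤ 2 * R := Nat.floor_le (by linarith)
  set I : Finset (ℤ × ℤ) := ((Finset.Icc (-k : ℤ) k) ×ˢ (Finset.Icc (-k : ℤ) k)).filter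
    fun a => R ≤ max |(a.1 : ℝ)| |(a.2 : ℝ)| with hI
  have hIcard : (I.card : ℝ) ≤ 25 * R ^ 2 := by
    have h1 : I.card ≤ (2 * k + 1) * (2 * k + 1) := by
      refine (Finset.card_filter_le _ _).trans_eq ?_
      rw [Finset.card_product, Int.card_Icc]
      congr 1 <;> omega
    calc (I.card : ℝ) ≤ ((2 * k + 1) * (2 * k + 1) : ℝ) := by exact_mod_cast h1
      _ ≤ (5 * R) * (5 * R) := by gcongr <;> linarith
      _ = _ := by ring
  have hImem : ∀ a : ℤ × ℤ, a ∈ I ↔ (|(a.1 : ℝ)| ≤ 2 * R ∧ |(a.2 : ℝ)| ≤ 2 * R) ∧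
      R ≤ max |(a.1 : ℝ)| |(a.2 : ℝ)| := by
    have : ∀ n : ℤ, n ∈ Finset.Icc (-k : ℤ) k ↔ |(n : ℝ)| ≤ 2 * R := by
      intro n
      rw [Finset.mem_Icc, ← abs_le, ← Int.cast_abs, ← Int.natCast_natAbs, Nat.cast_le, hk,
        Nat.le_floor_iff (by linarith)]
      simp
    intro a
    rw [hI, Finset.mem_filter, Finset.mem_product, this, this]
  let G : ℤ × ℤ → Set ℝ := fun a => {x ∈ Icc P.α P.β |
    ((∀ y ∈ Icc P.α P.β, P.κ / 2 * R ≤ |P.dF a y|) ∨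
      (∀ y ∈ Icc P.α P.β, P.κ / 2 * R ≤ |P.ddF a y|) ∧ 1 ≤ |P.dF a x|) ∧
      ∃ z : ℤ, |P.F a x + z| < δ}
  have hG : ∀ a ∈ I, hContent s (G a) ≤
      ENNReal.ofReal (C₁ * ((1 + Real.log R) * (R * (δ / R) ^ s))) := by
    intro a ha
    obtain ⟨⟨h1, h2⟩, h3⟩ := (hImem a).1 ha
    by_cases hA : ∀ y ∈ Icc P.α P.β, P.κ / 2 * R ≤ |P.dF a y|
    · refine (measure_mono fun x hx => ?_).trans
        (hContent_monotone_le hs hs1 hR hδ hδ1 h1 h2 hA)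
      exact ⟨hx.1, hx.2.2⟩
    · have hB := (le_dF_or_le_ddF hR h3).resolve_left hA
      refine (measure_mono fun x hx => ?_).trans
        (hContent_noncritical_le hs hs1 hR hδ hδ1 h1 h2 hB)
      exact ⟨hx.1, (hx.2.1.resolve_left hA).2, hx.2.2⟩
  set 𝒮 : Set (ℤ × ℤ × ℤ) := {A | P.NearCritical R δ A ∧
    ∀ y ∈ Icc P.α P.β, P.κ / 2 * R ≤ |P.ddF A.2 y|} with h𝒮
  have hfin : 𝒮.Finite := by
    by_contra hinf
    obtain ⟨t, ht, htc⟩ := Set.Infinite.exists_subset_card_eq hinf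
      (⌊C₀ * (1 + Real.log R) * (R * √R)⌋₊ + 1)
    have h1 := hcount R δ hR hδR t fun A hA => (ht hA).1
    rw [htc] at h1
    have := Nat.lt_floor_add_one (C₀ * (1 + Real.log R) * (R * √R))
    push_cast at h1
    linarith
  have hcover : P.nearSet R δ ⊆ (⋃ a ∈ I, G a) ∪
      ⋃ A ∈ hfin.toFinset, {x ∈ Icc P.α P.β | |P.F A.2 x + A.1| < δ} := by
    rintro x ⟨hx, a, h3, h1, h2, z, hz⟩
    have haI : a ∈ I := (hImem a).2 ⟨⟨h1, h2⟩, h3⟩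
    by_cases hA : ∀ y ∈ Icc P.α P.β, P.κ / 2 * R ≤ |P.dF a y|
    · exact Or.inl (mem_biUnion (Finset.mem_coe.2 haI) ⟨hx, Or.inl hA, z, hz⟩)
    have hB := (le_dF_or_le_ddF hR h3).resolve_left hA
    by_cases hc : 1 ≤ |P.dF a x|
    · exact Or.inl (mem_biUnion (Finset.mem_coe.2 haI) ⟨hx, Or.inr ⟨hB, hc⟩, z, hz⟩)
    · refine Or.inr (mem_biUnion (x := (z, a)) ?_ ⟨hx, hz⟩)
      rw [Finset.mem_coe, Set.Finite.mem_toFinset]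
      exact ⟨⟨h1, h2, x, hx, hz, not_le.1 hc⟩, hB⟩
  have hScard : (hfin.toFinset.card : ℝ) ≤ C₀ * (1 + Real.log R) * (R * √R) :=
    hcount R δ hR hδR _ fun A hA => (hfin.mem_toFinset.1 hA).1
  have b1 : hContent s (⋃ a ∈ I, G a) ≤
      ENNReal.ofReal (25 * C₁ * (1 + Real.log R) * (R ^ 3 * (δ / R) ^ s)) := by
    refine (measure_biUnion_finset_le _ _).trans ((Finset.sum_le_sum hG).trans ?_)
    rw [Finset.sum_const, nsmul_eq_mul, ← ENNReal.ofReal_natCast,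
      ← ENNReal.ofReal_mul (Nat.cast_nonneg _)]
    refine ENNReal.ofReal_le_ofReal ?_
    calc _ ≤ 25 * R ^ 2 * (C₁ * ((1 + Real.log R) * (R * (δ / R) ^ s))) := by gcongr
      _ = _ := by ring
  have b2 : hContent s (⋃ A ∈ hfin.toFinset, {x ∈ Icc P.α P.β | |P.F A.2 x + A.1| < δ}) ≤
      ENNReal.ofReal (C₀ * (32 / P.κ) * (1 + Real.log R) * (R * √R * √(δ / R) ^ s)) := by
    refine (measure_biUnion_finset_le _ _).trans ((Finset.sum_le_sum fun A hA =>
      hContent_sublevel_le hs hs1 hR0 hδ (hfin.mem_toFinset.1 hA).2 A.1).trans ?_)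
    rw [Finset.sum_const, nsmul_eq_mul, ← ENNReal.ofReal_natCast,
      ← ENNReal.ofReal_mul (Nat.cast_nonneg _)]
    refine ENNReal.ofReal_le_ofReal ?_
    calc _ ≤ C₀ * (1 + Real.log R) * (R * √R) * (32 / P.κ * √(δ / R) ^ s) := by gcongr
      _ = _ := by ring
  refine (measure_mono hcover).trans ((measure_union_le _ _).trans ((add_le_add b1 b2).trans ?_))
  rw [← ENNReal.ofReal_add (by positivity) (by positivity)]
  refine ENNReal.ofReal_le_ofReal ?_
  have x1 : 0 ≤ C₁ * (1 + Real.log R) * (R * √R * √(δ / R) ^ s) := by positivity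
  have x2 : 0 ≤ C₀ * (32 / P.κ) * (1 + Real.log R) * (R ^ 3 * (δ / R) ^ s) := by positivity
  nlinarith

end PhaseArc

namespace PhaseArc
variable {P : PhaseArc}

/-- The `ψ`-approximable points of the arc. -/
def approxSet (P : PhaseArc) (ψ : ℝ → ℝ) : Set ℝ :=
  {x ∈ Icc P.α P.β | {p : ℤ × ℤ | p ≠ 0 ∧ nearestIntDist (P.F p x) <
    ψ ((max p.1.natAbs p.2.natAbs : ℕ) : ℝ)}.Infinite}

theorem exists_le_max_natAbs_of_infinite {S : Set (ℤ × ℤ)} (hS : S.Infinite) (N : ℕ) :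
    ∃ p ∈ S, N ≤ max p.1.natAbs p.2.natAbs := by
  by_contra! h
  refine hS (((Set.finite_Icc (-N : ℤ) N).prod (Set.finite_Icc (-N : ℤ) N)).subset ?_)
  intro p hp
  have := max_lt_iff.1 (h p hp)
  simp only [Set.mem_prod, Set.mem_Icc]
  omega

theorem frequently_mem_nearSet {ψ : ℝ → ℝ} (hψdec : AntitoneOn ψ (Ioi 0)) {x : ℝ}
    (hx : x ∈ P.approxSet ψ) : ∃ᶠ k : ℕ in atTop, x ∈ P.nearSet (2 ^ k) (ψ (2 ^ k)) := by
  rw [Filter.frequently_atTop]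
  intro K
  obtain ⟨p, ⟨-, hp⟩, hN⟩ := exists_le_max_natAbs_of_infinite hx.2 (2 ^ K)
  set n := max p.1.natAbs p.2.natAbs with hn
  have hn0 : n ≠ 0 := (lt_of_lt_of_le (by positivity) hN).ne'
  have hlo : 2 ^ Nat.log 2 n ≤ n := Nat.pow_log_le_self 2 hn0
  have hhi : n < 2 ^ (Nat.log 2 n + 1) := Nat.lt_pow_succ_log_self (by norm_num) n
  have hlo' : (2 : ℝ) ^ Nat.log 2 n ≤ n := by exact_mod_cast hlo
  have hhi' : (n : ℝ) ≤ 2 * 2 ^ Nat.log 2 n := by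
    rw [pow_succ, mul_comm] at hhi; exact_mod_cast hhi.le
  have h1 : |(p.1 : ℝ)| = p.1.natAbs := by rw [Nat.cast_natAbs, Int.cast_abs]
  have h2 : |(p.2 : ℝ)| = p.2.natAbs := by rw [Nat.cast_natAbs, Int.cast_abs]
  have h1n : |(p.1 : ℝ)| ≤ n := by rw [h1]; exact_mod_cast le_max_left _ _
  have h2n : |(p.2 : ℝ)| ≤ n := by rw [h2]; exact_mod_cast le_max_right _ _
  refine ⟨Nat.log 2 n, (Nat.le_log_iff_pow_le (by norm_num) hn0).2 hN, hx.1, p, ?_, h1n.trans hhi',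
    h2n.trans hhi', -round (P.F p x), ?_⟩
  · rw [h1, h2]; refine hlo'.trans ?_
    rw [hn]; push_cast; rfl
  · have h3 : ψ n ≤ ψ (2 ^ Nat.log 2 n) := hψdec (mem_Ioi.2 (by positivity))
      (mem_Ioi.2 (lt_of_lt_of_le (by positivity) hlo')) hlo'
    push_cast
    rw [← sub_eq_add_neg]
    exact lt_of_lt_of_le hp h3

theorem rpow_bounds {s τ R δ : ℝ} (hs : 0 < s) (hR : 1 ≤ R) (hδ : 0 < δ)
    (hδR : δ ≤ R ^ (-τ)) :
    R ^ 3 * (δ / R) ^ s + R * √R * √(δ / R) ^ s ≤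
      R ^ (-(s * (τ + 1) - 3)) + R ^ (-((s * (τ + 1) - 3) / 2)) := by
  have hR0 : 0 < R := by linarith
  have h1 : δ / R ≤ R ^ (-(τ + 1)) := by
    rw [neg_add, ← sub_eq_add_neg, Real.rpow_sub_one hR0.ne']
    gcongr
  have h0 : 0 ≤ δ / R := by positivity
  have e1 : R ^ (3 : ℕ) * (R ^ (-(τ + 1))) ^ s = R ^ (-(s * (τ + 1) - 3)) := by
    rw [← Real.rpow_natCast, ← Real.rpow_mul hR0.le, ← Real.rpow_add hR0]
    congr 1; push_cast; ring
  have e2 : R * √R * (√(R ^ (-(τ + 1)))) ^ s = R ^ (-((s * (τ + 1) - 3) / 2)) := by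
    rw [Real.sqrt_eq_rpow, Real.sqrt_eq_rpow, ← Real.rpow_mul hR0.le, ← Real.rpow_mul hR0.le]
    nth_rewrite 1 [← Real.rpow_one R]
    rw [← Real.rpow_add hR0, ← Real.rpow_add hR0]
    congr 1; ring
  rw [← e1, ← e2]
  gcongr

theorem dimH_approxSet_le (P : PhaseArc) {ψ : ℝ → ℝ} (hψpos : ∀ q : ℝ, 0 < q → 0 < ψ q)
    (hψdec : AntitoneOn ψ (Ioi 0)) {s τ : ℝ} (hs : 0 < s) (hs1 : s ≤ 1) (hτ : 1 < τ)
    (hsτ : 3 < s * (τ + 1)) (hψ : ∀ᶠ q in atTop, ψ q ≤ q ^ (-τ)) :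
    dimH (P.approxSet ψ) ≤ ENNReal.ofReal s := by
  obtain ⟨C, hC, hcont⟩ := P.exists_hContent_nearSet_le
  set θ := s * (τ + 1) - 3 with hθ
  have hθ0 : 0 < θ := by linarith
  have hpow : Tendsto (fun k : ℕ => (2 : ℝ) ^ k) atTop atTop :=
    tendsto_pow_atTop_atTop_of_one_lt (by norm_num)
  have hmesh : ∀ᶠ R : ℝ in atTop, R ^ (-τ) ≤ P.mesh / R := by
    have h1 : Tendsto (fun R : ℝ => R ^ (-(τ - 1))) atTop (nhds 0) :=
      tendsto_rpow_neg_atTop (by linarith)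
    filter_upwards [h1.eventually (gt_mem_nhds (mesh_pos (P := P))), eventually_gt_atTop 0]
      with R hR hR0
    rw [le_div_iff₀ hR0, ← Real.rpow_add_one hR0.ne']
    refine le_trans (le_of_eq ?_) hR.le
    congr 1; ring
  obtain ⟨K, hK⟩ := eventually_atTop.1
    (hpow.eventually (hψ.and (hmesh.and (eventually_ge_atTop P.R₀))))
  set r : ℝ := 2 ^ (-(θ / 2)) with hr
  have hr0 : 0 < r := by positivity
  have hr1 : r < 1 := Real.rpow_lt_one_of_one_lt_of_neg (by norm_num) (by linarith)
  have hterm : ∀ k : ℕ, hContent s {x | K ≤ k ∧ x ∈ P.nearSet (2 ^ k) (ψ (2 ^ k))} ≤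
      ENNReal.ofReal (2 * C * ((1 + k) * r ^ k)) := by
    intro k
    by_cases hk : K ≤ k
    · obtain ⟨h1, h2, h3⟩ := hK k hk
      have hR1 : (1 : ℝ) ≤ 2 ^ k := P.one_le_R₀.trans h3
      refine (measure_mono fun x hx => hx.2).trans ((hcont s _ _ hs hs1 h3 (hψpos _ (by positivity))
        (h1.trans h2)).trans (ENNReal.ofReal_le_ofReal ?_))
      have hb := rpow_bounds hs hR1 (hψpos _ (by positivity)) h1
      have hmono : ((2 : ℝ) ^ k) ^ (-θ) ≤ ((2 : ℝ) ^ k) ^ (-(θ / 2)) :=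
        Real.rpow_le_rpow_of_exponent_le hR1 (by linarith)
      have hrk : ((2 : ℝ) ^ k) ^ (-(θ / 2)) = r ^ k := by
        rw [hr, ← Real.rpow_natCast, ← Real.rpow_mul (by norm_num), mul_comm,
          Real.rpow_mul (by norm_num), Real.rpow_natCast]
      have hlog : Real.log (2 ^ k) ≤ k := by
        rw [Real.log_pow]
        have := Real.log_two_lt_d9
        have : (0 : ℝ) ≤ k := Nat.cast_nonneg k
        nlinarith
      have hlog0 : 0 ≤ Real.log (2 ^ k) := Real.log_nonneg hR1
      calc _ ≤ C * (1 + k) * (2 * r ^ k) := by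
            have := hψpos (2 ^ k) (by positivity)
            gcongr
            rw [← hrk]; linarith
        _ = _ := by ring
    · simp [hk]
  have hsum : Summable fun k : ℕ => 2 * C * ((1 + k) * r ^ k) := by
    refine Summable.mul_left _ ?_
    have h1 := summable_geometric_of_lt_one hr0.le hr1
    have h2 := summable_pow_mul_geometric_of_norm_lt_one 1
      (by rwa [Real.norm_of_nonneg hr0.le] : ‖r‖ < 1)
    refine (h1.add h2).congr fun k => ?_
    simp; ring
  refine dimH_le_of_hContent_eq_zero hs (measure_mono_null ?_ (measure_setOfPred_frequently_eq_zero
    (p := fun (k : ℕ) x => K ≤ k ∧ x ∈ P.nearSet (2 ^ k) (ψ (2 ^ k)))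
    (ne_top_of_le_ne_top hsum.tsum_ofReal_ne_top (ENNReal.tsum_le_tsum hterm))))
  intro x hx
  exact ((frequently_mem_nearSet hψdec hx).and_eventually (eventually_ge_atTop K)).mono
    fun k hk => ⟨hk.2, hk.1⟩

end PhaseArc

theorem exists_dist_lt_of_separated_lattice {ι : Type*} [Fintype ι] [DecidableEq ι]
    (b : Module.Basis ι ℝ (ι → ℝ)) {η : ℝ} (hη : 0 < η) {N : ℕ}
    (hsep : ∀ x ∈ Submodule.span ℤ (range b), x ≠ 0 → η ≤ ‖x‖)
    (hN : |(Matrix.of b).det| < N * η ^ Fintype.card ι) (y : ι → ℝ) :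
    ∃ x ∈ Submodule.span ℤ (range b), dist y x < N * η := by
  set L := Submodule.span ℤ (range b) with hL
  have hne : (L : Set (ι → ℝ)).Nonempty := ⟨0, L.zero_mem⟩
  suffices h : Metric.infDist y (L : Set (ι → ℝ)) < N * η from (Metric.infDist_lt_iff hne).1 h
  by_contra! hfar
  have hcont : Continuous fun t : ℝ => Metric.infDist (t • y) (L : Set (ι → ℝ)) :=
    (Metric.continuous_infDist_pt _).comp (by fun_prop)
  have hz : ∀ j : ℕ, ∃ z : ι → ℝ, j < N → Metric.infDist z (L : Set (ι → ℝ)) = j * η := by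
    intro j
    by_cases hj : j < N
    · have h0 : Metric.infDist ((0 : ℝ) • y) (L : Set (ι → ℝ)) = 0 := by
        rw [zero_smul]; exact Metric.infDist_zero_of_mem L.zero_mem
      have hmem : (j * η : ℝ) ∈ Icc (Metric.infDist ((0 : ℝ) • y) (L : Set (ι → ℝ)))
          (Metric.infDist ((1 : ℝ) • y) (L : Set (ι → ℝ))) := by
        rw [h0, one_smul]
        refine ⟨by positivity, le_trans ?_ hfar⟩
        gcongr
      obtain ⟨t, -, ht⟩ := intermediate_value_Icc zero_le_one hcont.continuousOn hmem
      exact ⟨t • y, fun _ => ht⟩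
    · exact ⟨0, fun h => absurd h hj⟩
  choose z hz using hz
  have hball : ∀ i < N, ∀ j < N, ∀ x ∈ L, dist (x + z i) (z j) < η → i = j ∧ x = 0 := by
    intro i hi j hj x hx hd
    have hinv : Metric.infDist (x + z i) (L : Set (ι → ℝ)) =
        Metric.infDist (z i) (L : Set (ι → ℝ)) := by
      have hle : ∀ x ∈ L, ∀ w : ι → ℝ, Metric.infDist (x + w) (L : Set (ι → ℝ)) ≤
          Metric.infDist w (L : Set (ι → ℝ)) := by
        intro x hx w
        refine (Metric.le_infDist hne).2 fun l hl => ?_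
        have : dist w l = dist (x + w) (x + l) := (dist_add_left _ _ _).symm
        rw [this]
        exact Metric.infDist_le_dist_of_mem (L.add_mem hx hl)
      refine le_antisymm (hle x hx _) ?_
      have := hle (-x) (L.neg_mem hx) (x + z i)
      rwa [neg_add_cancel_left] at this
    have h1 := Metric.infDist_le_infDist_add_dist (s := (L : Set (ι → ℝ))) (x := x + z i) (y := z j)
    have h2 := Metric.infDist_le_infDist_add_dist (s := (L : Set (ι → ℝ))) (x := z j) (y := x + z i)
    rw [hinv, hz i hi, hz j hj] at h1
    rw [hinv, hz i hi, hz j hj, dist_comm] at h2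
    have h3 : (i : ℝ) < j + 1 := by
      by_contra! h
      nlinarith
    have h4 : (j : ℝ) < i + 1 := by
      by_contra! h
      nlinarith
    have hij : i = j := by
      have h3' : i < j + 1 := by exact_mod_cast h3
      have h4' : j < i + 1 := by exact_mod_cast h4
      omega
    refine ⟨hij, by_contra fun hx0 => ?_⟩
    have := hsep x hx hx0
    rw [hij, dist_eq_norm, add_sub_cancel_right] at hd
    linarith
  set S : Set (ι → ℝ) := ⋃ j ∈ Finset.range N, Metric.ball (z j) (η / 2) with hS
  have hSmeas : MeasurableSet S := Finset.measurableSet_biUnion _ fun _ _ => measurableSet_ball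
  have hSvol : volume S = ENNReal.ofReal (N * η ^ Fintype.card ι) := by
    rw [hS, measure_biUnion_finset]
    · have : ∀ j ∈ Finset.range N, volume (Metric.ball (z j) (η / 2)) =
          ENNReal.ofReal (η ^ Fintype.card ι) := by
        intro j _
        rw [Real.volume_pi_ball _ (half_pos hη), mul_div_cancel₀ _ two_ne_zero]
      rw [Finset.sum_congr rfl this, Finset.sum_const, Finset.card_range, nsmul_eq_mul,
        ENNReal.ofReal_mul (Nat.cast_nonneg _), ENNReal.ofReal_natCast]
    · intro i hi j hj hij
      refine Set.disjoint_left.2 fun p hp hp' => hij ?_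
      have h1 := Metric.mem_ball'.1 hp
      have h2 := Metric.mem_ball.1 hp'
      refine (hball i (Finset.mem_range.1 hi) j (Finset.mem_range.1 hj) 0 L.zero_mem ?_).1
      rw [zero_add]
      linarith [dist_triangle (z i) p (z j)]
    · exact fun _ _ => measurableSet_ball
  have : Countable L.toAddSubgroup := inferInstanceAs (Countable L)
  obtain ⟨x, w, hxw, hdis⟩ := exists_pair_mem_lattice_not_disjoint_vadd
    (ZSpan.isAddFundamentalDomain' b volume) hSmeas.nullMeasurableSet (by
      rw [ZSpan.volume_fundamentalDomain, hSvol]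
      exact (ENNReal.ofReal_lt_ofReal_iff_of_nonneg (abs_nonneg _)).2 hN)
  obtain ⟨p, ⟨u, hu, hup⟩, v, hv, hvp⟩ := Set.not_disjoint_iff.1 hdis
  obtain ⟨i, hi, hui⟩ := mem_iUnion₂.1 hu
  obtain ⟨j, hj, hvj⟩ := mem_iUnion₂.1 hv
  have hup' : (x : ι → ℝ) + u = p := hup
  have hvp' : (w : ι → ℝ) + v = p := hvp
  have hmem : (x : ι → ℝ) - w ∈ L := L.sub_mem x.2 w.2
  have h0 := (hball i (Finset.mem_range.1 hi) j (Finset.mem_range.1 hj) _ hmem (by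
    have h1 : dist ((x : ι → ℝ) - w + z i) v = dist (z i) u := by
      rw [dist_eq_norm, dist_eq_norm]
      congr 1
      have : v = (x : ι → ℝ) + u - w := by rw [hup', ← hvp']; abel
      rw [this]; abel
    have h2 := Metric.mem_ball'.1 hui
    have h3 := Metric.mem_ball.1 hvj
    linarith [dist_triangle ((x : ι → ℝ) - w + z i) v (z j)])).2
  exact hxw (Subtype.ext (sub_eq_zero.1 h0))

/-- Transference: if a point of the plane has no small integer relation then every inhomogeneous
system is solvable with comparable bounds. -/
theorem exists_int_relation_near {u v η Q : ℝ} (hη : 0 < η) (hη1 : η ≤ 1) (hQ : 1 ≤ Q)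
    (h : ∀ b₀ b₁ b₂ : ℤ, |(b₁ : ℝ)| ≤ η * Q → |(b₂ : ℝ)| ≤ η * Q →
      |b₀ + b₁ * u + b₂ * v| ≤ η / Q ^ 2 → b₁ = 0 ∧ b₂ = 0) (hηQ : η < Q ^ 2)
    (y₀ y₁ y₂ : ℝ) : ∃ a₀ a₁ a₂ : ℤ, |a₀ + a₁ * u + a₂ * v - y₀| ≤ 2 / η ^ 2 / Q ^ 2 ∧
      |a₁ - y₁| ≤ 2 / η ^ 2 * Q ∧ |a₂ - y₂| ≤ 2 / η ^ 2 * Q := by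
  have hQ0 : 0 < Q := by linarith
  set A : Matrix (Fin 3) (Fin 3) ℝ :=
    !![Q ^ 2, 0, 0; Q ^ 2 * u, 1 / Q, 0; Q ^ 2 * v, 0, 1 / Q] with hA
  have hdet : A.det = 1 := by
    rw [hA, Matrix.det_fin_three]
    simp
    field_simp
  have hli : LinearIndependent ℝ A.row :=
    Matrix.linearIndependent_rows_of_det_ne_zero (A := A) (by rw [hdet]; exact one_ne_zero)
  set b := basisOfLinearIndependentOfCardEqFinrank hli (by simp) with hb
  have hbA : (b : Fin 3 → Fin 3 → ℝ) = A := coe_basisOfLinearIndependentOfCardEqFinrank hli _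
  have hmem : ∀ x ∈ Submodule.span ℤ (range b), ∃ c : Fin 3 → ℤ,
      x = ![Q ^ 2 * (c 0 + c 1 * u + c 2 * v), c 1 / Q, c 2 / Q] := by
    intro x hx
    obtain ⟨c, rfl⟩ := (Submodule.mem_span_range_iff_exists_fun ℤ).1 hx
    refine ⟨c, ?_⟩
    ext i
    rw [hbA, Finset.sum_apply]
    fin_cases i <;> simp [hA, Fin.sum_univ_three] <;> ring
  have hcoord : ∀ x : Fin 3 → ℝ, ∀ r, 0 ≤ r → (‖x‖ ≤ r ↔ |x 0| ≤ r ∧ |x 1| ≤ r ∧ |x 2| ≤ r) := by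
    intro x r hr
    rw [pi_norm_le_iff_of_nonneg hr, Fin.forall_fin_succ, Fin.forall_fin_succ, Fin.forall_fin_succ]
    simp
  have hconv : ∀ c₀ c₁ c₂ r : ℝ, |Q ^ 2 * c₀| ≤ r ∧ |c₁ / Q| ≤ r ∧ |c₂ / Q| ≤ r →
      |c₀| ≤ r / Q ^ 2 ∧ |c₁| ≤ r * Q ∧ |c₂| ≤ r * Q := by
    rintro c₀ c₁ c₂ r ⟨h0, h1, h2⟩
    rw [abs_mul, abs_of_pos (by positivity : 0 < Q ^ 2)] at h0
    rw [abs_div, abs_of_pos hQ0, div_le_iff₀ hQ0] at h1 h2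
    exact ⟨by rw [le_div_iff₀' (by positivity)]; exact h0, h1, h2⟩
  have hsep : ∀ x ∈ Submodule.span ℤ (range b), x ≠ 0 → η ≤ ‖x‖ := by
    intro x hx hx0
    by_contra! hlt
    obtain ⟨c, rfl⟩ := hmem x hx
    have h1 := (hcoord _ η hη.le).1 hlt.le
    simp only [Matrix.cons_val_zero, Matrix.cons_val_one, Matrix.cons_val] at h1
    obtain ⟨h2, h3, h4⟩ := hconv _ _ _ _ h1
    obtain ⟨h5, h6⟩ := h _ _ _ h3 h4 h2
    refine hx0 ?_
    have h7 : c 0 = 0 := by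
      rw [h5, h6] at h2
      simp only [Int.cast_zero, zero_mul, add_zero] at h2
      have h8 : η / Q ^ 2 < 1 := by rw [div_lt_one (by positivity)]; exact hηQ
      have : |c 0| < 1 := by exact_mod_cast h2.trans_lt h8
      exact Int.abs_lt_one_iff.1 this
    ext i
    fin_cases i <;> simp [h5, h6, h7]
  set N := ⌊1 / η ^ 3⌋₊ + 1 with hN
  have hN1 : 1 / η ^ 3 < N := by rw [hN]; push_cast; exact Nat.lt_floor_add_one _
  have hη3 : 1 ≤ 1 / η ^ 3 := by
    rw [one_le_div (by positivity)]; exact pow_le_one₀ hη.le hη1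
  have hN2 : (N : ℝ) * η ≤ 2 / η ^ 2 := by
    have : (N : ℝ) ≤ 2 * (1 / η ^ 3) := by
      rw [hN]; push_cast
      linarith [Nat.floor_le (by linarith : 0 ≤ 1 / η ^ 3)]
    calc (N : ℝ) * η ≤ 2 * (1 / η ^ 3) * η := by gcongr
      _ = _ := by field_simp
  obtain ⟨x, hx, hd⟩ := exists_dist_lt_of_separated_lattice b hη (N := N) hsep (by
    rw [hbA, show Matrix.of (A : Fin 3 → Fin 3 → ℝ) = A from rfl, hdet, abs_one]
    rw [div_lt_iff₀ (by positivity)] at hN1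
    simpa using hN1) ![Q ^ 2 * y₀, y₁ / Q, y₂ / Q]
  obtain ⟨c, rfl⟩ := hmem x hx
  rw [dist_comm, dist_eq_norm] at hd
  have h1 := (hcoord _ _ (by positivity)).1 (hd.le.trans hN2)
  simp only [Pi.sub_apply, Matrix.cons_val_zero, Matrix.cons_val_one, Matrix.cons_val] at h1
  rw [← mul_sub, ← sub_div, ← sub_div] at h1
  obtain ⟨h2, h3, h4⟩ := hconv _ _ _ _ h1
  exact ⟨c 0, c 1, c 2, h2, h3, h4⟩

namespace PhaseArc

/-- The arc with the inhomogeneous term removed. -/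
def hom (P : PhaseArc) : PhaseArc :=
  { P with
    R₀ := 1
    g := fun _ => 0
    dg := fun _ => 0
    ddg := fun _ => 0
    one_le_R₀ := le_rfl
    hg := fun x _ => hasDerivAt_const x 0
    hdg := fun x _ => hasDerivAt_const x 0
    dg_le := fun _ _ => by have := P.κ_pos; rw [abs_zero]; positivity
    ddg_le := fun _ _ => by have := P.κ_pos; rw [abs_zero]; positivity }

/-- Points of the arc having an integer relation of height at most `H` and size at most `δ`. -/
def relationSet (P : PhaseArc) (H δ : ℝ) : Set ℝ :=
  {x ∈ Icc P.α P.β | ∃ b₀ b₁ b₂ : ℤ, |(b₁ : ℝ)| ≤ H ∧ |(b₂ : ℝ)| ≤ H ∧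
    |b₀ + b₁ * P.f₁ x + b₂ * P.f₂ x| ≤ δ ∧ ¬(b₁ = 0 ∧ b₂ = 0)}

theorem relationSet_subset (P : PhaseArc) {H δ : ℝ} (hδ : 0 < δ) :
    P.relationSet H δ ⊆ ⋃ k ∈ (Finset.range (⌊2 * Real.log H⌋₊ + 1)).filter
      (fun k => (2 : ℝ) ^ k ≤ H), P.hom.nearSet (2 ^ k) (2 * δ) := by
  rintro x ⟨hx, b₀, b₁, b₂, h1, h2, h3, h4⟩
  have hmax : (1 : ℝ) ≤ max |(b₁ : ℝ)| |(b₂ : ℝ)| := by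
    have : (1 : ℤ) ≤ max |b₁| |b₂| := by
      rw [le_max_iff]
      by_contra! h
      exact h4 ⟨Int.abs_lt_one_iff.1 h.1, Int.abs_lt_one_iff.1 h.2⟩
    exact_mod_cast this
  obtain ⟨k, hk1, hk2⟩ := exists_nat_pow_near hmax (by norm_num : (1 : ℝ) < 2)
  rw [pow_succ, mul_comm] at hk2
  have hkH : (2 : ℝ) ^ k ≤ H := hk1.trans (max_le h1 h2)
  have hkN : k ≤ ⌊2 * Real.log H⌋₊ := by
    refine Nat.le_floor ?_
    have := Real.log_le_log (by positivity) hkH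
    rw [Real.log_pow] at this
    have h2 := Real.log_two_gt_d9
    have : (0 : ℝ) ≤ k := Nat.cast_nonneg k
    nlinarith
  refine mem_biUnion (x := k) ?_ ⟨hx, (b₁, b₂), hk1, (le_max_left _ _).trans hk2.le,
    (le_max_right _ _).trans hk2.le, b₀, ?_⟩
  · rw [Finset.mem_coe, Finset.mem_filter, Finset.mem_range]
    exact ⟨Nat.lt_succ_of_le hkN, hkH⟩
  · have : P.hom.F (b₁, b₂) x + b₀ = b₀ + b₁ * P.f₁ x + b₂ * P.f₂ x := by
      simp only [F, hom]; ring
    rw [this]; linarith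

theorem exists_volume_relationSet_le (P : PhaseArc) : ∃ C : ℝ, 0 < C ∧ ∀ η Q : ℝ, 0 < η → η ≤ 1 →
    1 ≤ η * Q → 2 ≤ P.mesh * Q → volume (P.relationSet (η * Q) (η / Q ^ 2)) ≤
      ENNReal.ofReal (C * (1 + 2 * Real.log Q) ^ 2 * η) := by
  obtain ⟨C, hC, hcont⟩ := P.hom.exists_hContent_nearSet_le
  refine ⟨4 * C, by positivity, fun η Q hη hη1 hηQ hmesh => ?_⟩
  have hQ0 : 0 < Q := by by_contra! h; nlinarith
  have hH : η * Q ≤ Q := by nlinarith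
  have hQ1 : 1 ≤ Q := hηQ.trans hH
  have hlog : 0 ≤ Real.log Q := Real.log_nonneg hQ1
  have hterm : ∀ k ∈ (Finset.range (⌊2 * Real.log (η * Q)⌋₊ + 1)).filter
      (fun k => (2 : ℝ) ^ k ≤ η * Q), volume (P.hom.nearSet (2 ^ k) (2 * (η / Q ^ 2))) ≤
      ENNReal.ofReal (C * (1 + 2 * Real.log Q) * (4 * η)) := by
    intro k hk
    have hkH := (Finset.mem_filter.1 hk).2
    set R : ℝ := 2 ^ k with hR
    have hR1 : 1 ≤ R := one_le_pow₀ (by norm_num)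
    have hR0 : 0 < R := by linarith
    have hlR : Real.log R ≤ Real.log Q := Real.log_le_log hR0 (hkH.trans hH)
    set δ := 2 * (η / Q ^ 2) with hδ
    have hδ0 : 0 < δ := by positivity
    have hδR : δ ≤ P.mesh / R := by
      rw [le_div_iff₀ hR0]
      calc δ * R ≤ 2 * (1 / Q ^ 2) * Q := by
            rw [hδ]; gcongr; exact hkH.trans hH
        _ = 2 / Q := by field_simp
        _ ≤ P.mesh := by rw [div_le_iff₀ hQ0]; exact hmesh
    refine (volume_le_hContent_one _).trans ((hcont 1 R δ one_pos le_rfl hR1 hδ0 hδR).trans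
      (ENNReal.ofReal_le_ofReal ?_))
    rw [Real.rpow_one, Real.rpow_one]
    have e1 : R ^ 3 * (δ / R) ≤ 2 * η := by
      calc R ^ 3 * (δ / R) = R ^ 2 * δ := by field_simp
        _ ≤ (η * Q) ^ 2 * (2 * (η / Q ^ 2)) := by gcongr
        _ = 2 * η * η ^ 2 := by field_simp
        _ ≤ 2 * η * 1 := by gcongr; exact pow_le_one₀ hη.le hη1
        _ = _ := by ring
    have e2 : R * √R * √(δ / R) ≤ 2 * η := by
      have h1 : √R * √(δ / R) = √δ := by
        rw [← Real.sqrt_mul hR0.le, mul_div_cancel₀ _ hR0.ne']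
      have h2 : √δ ≤ 2 / Q := by
        refine Real.sqrt_le_iff.2 ⟨by positivity, ?_⟩
        calc δ ≤ 2 * (1 / Q ^ 2) := by rw [hδ]; gcongr
          _ ≤ 4 * (1 / Q ^ 2) := by gcongr; norm_num
          _ = _ := by ring
      rw [mul_assoc, h1]
      calc R * √δ ≤ (η * Q) * (2 / Q) := by gcongr
        _ = _ := by field_simp
    have hsum : 0 ≤ R ^ 3 * (δ / R) + R * √R * √(δ / R) := by positivity
    calc _ ≤ C * (1 + 2 * Real.log Q) * (R ^ 3 * (δ / R) + R * √R * √(δ / R)) := by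
          gcongr; linarith
      _ ≤ _ := by gcongr; linarith
  refine (measure_mono (P.relationSet_subset (by positivity))).trans
    ((measure_biUnion_finset_le _ _).trans ((Finset.sum_le_sum hterm).trans ?_))
  rw [Finset.sum_const, nsmul_eq_mul, ← ENNReal.ofReal_natCast,
    ← ENNReal.ofReal_mul (Nat.cast_nonneg _)]
  refine ENNReal.ofReal_le_ofReal ?_
  have hcard : (((Finset.range (⌊2 * Real.log (η * Q)⌋₊ + 1)).filter
      (fun k => (2 : ℝ) ^ k ≤ η * Q)).card : ℝ) ≤ 1 + 2 * Real.log Q := by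
    have h1 : ((Finset.range (⌊2 * Real.log (η * Q)⌋₊ + 1)).filter
      (fun k => (2 : ℝ) ^ k ≤ η * Q)).card ≤ ⌊2 * Real.log (η * Q)⌋₊ + 1 :=
      (Finset.card_filter_le _ _).trans_eq (Finset.card_range _)
    have h2 : (⌊2 * Real.log (η * Q)⌋₊ : ℝ) ≤ 2 * Real.log (η * Q) :=
      Nat.floor_le (by have := Real.log_nonneg hηQ; positivity)
    have h3 : Real.log (η * Q) ≤ Real.log Q := Real.log_le_log (by linarith) hH
    have h4 : (((Finset.range (⌊2 * Real.log (η * Q)⌋₊ + 1)).filter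
      (fun k => (2 : ℝ) ^ k ≤ η * Q)).card : ℝ) ≤ ⌊2 * Real.log (η * Q)⌋₊ + 1 := by
      exact_mod_cast h1
    linarith
  calc _ ≤ (1 + 2 * Real.log Q) * (C * (1 + 2 * Real.log Q) * (4 * η)) := by gcongr
    _ = _ := by ring

end PhaseArc

theorem exists_eq_zero_of_le_abs_deriv {F F' : ℝ → ℝ} {x r m : ℝ} (hr : 0 ≤ r) (hm : 0 < m)
    (hF : ∀ t ∈ Icc (x - r) (x + r), HasDerivAt F (F' t) t)
    (hF' : ∀ t ∈ Icc (x - r) (x + r), m ≤ |F' t|) (hx : |F x| ≤ m * r) :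
    ∃ y ∈ Icc (x - r) (x + r), F y = 0 := by
  wlog hpos : ∀ t ∈ Icc (x - r) (x + r), 0 < F' t generalizing F F'
  · have hneg : ∀ t ∈ Icc (x - r) (x + r), F' t < 0 := by
      refine (hasDerivWithinAt_forall_lt_or_forall_gt_of_forall_ne (convex_Icc _ _)
        (fun t ht => (hF t ht).hasDerivWithinAt) (m := 0) fun t ht h0 => ?_).resolve_right hpos
      have := hF' t ht
      rw [h0, abs_zero] at this
      linarith
    obtain ⟨y, hy, hy0⟩ := this (F := -F) (F' := -F') (fun t ht => (hF t ht).neg)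
      (fun t ht => by rw [Pi.neg_apply, abs_neg]; exact hF' t ht)
      (by rwa [Pi.neg_apply, abs_neg]) (fun t ht => neg_pos.2 (hneg t ht))
    exact ⟨y, hy, neg_eq_zero.1 hy0⟩
  have hle : ∀ t ∈ Icc (x - r) (x + r), m ≤ F' t := fun t ht => by
    have := hF' t ht; rwa [abs_of_pos (hpos t ht)] at this
  have h1 := mul_sub_le_of_le_deriv (by linarith : x ≤ x + r)
    (fun t ht => hF t ⟨by linarith [ht.1], ht.2⟩) (fun t ht => hle t ⟨by linarith [ht.1], ht.2⟩)
  have h2 := mul_sub_le_of_le_deriv (by linarith : x - r ≤ x)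
    (fun t ht => hF t ⟨ht.1, by linarith [ht.2]⟩) (fun t ht => hle t ⟨ht.1, by linarith [ht.2]⟩)
  obtain ⟨h3, h4⟩ := abs_le.1 hx
  exact intermediate_value_Icc (by linarith : x - r ≤ x + r)
    (fun t ht => (hF t ht).continuousAt.continuousWithinAt)
    (show (0 : ℝ) ∈ Icc (F (x - r)) (F (x + r)) from ⟨by linarith, by linarith⟩)

theorem nearestIntDist_le (x : ℝ) (z : ℤ) : nearestIntDist x ≤ |x + z| := by
  have := round_le x (-z)
  push_cast at this
  rwa [sub_neg_eq_add] at this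

namespace PhaseArc
variable {P : PhaseArc}

/-- Integer points of the phases with frequency of size comparable to `q`. -/
def resonantSet (P : PhaseArc) (q : ℝ) : Set ℝ :=
  {y ∈ Icc P.α P.β | ∃ a : ℤ × ℤ, q / 4 ≤ |(a.1 : ℝ)| ∧ |(a.1 : ℝ)| ≤ q ∧ |(a.2 : ℝ)| ≤ q ∧
    ∃ z : ℤ, P.F a y + z = 0}

theorem exists_resonant_near {η q c x r : ℝ} (hc : c = P.κ / (32 * P.M)) (hη : 0 < η) (hη1 : η ≤ 1)
    (hq : 8 * P.R₀ ≤ q) (hQ : 2 ≤ c * η ^ 2 * q) (hr : 0 ≤ r)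
    (hxr : Icc (x - r) (x + r) ⊆ Icc P.α P.β)
    (hrq : 16 / (c ^ 2 * P.κ) / η ^ 6 / q ^ 3 ≤ r)
    (hx : x ∉ P.relationSet (η * (c * η ^ 2 * q)) (η / (c * η ^ 2 * q) ^ 2)) :
    ∃ y ∈ P.resonantSet q, |x - y| ≤ r := by
  have hκ := P.κ_pos
  have hκ1 := P.κ_le
  have hM := P.one_le_M
  have hR₀ := P.one_le_R₀
  have hq0 : 0 < q := by linarith
  have hc0 : 0 < c := by rw [hc]; positivity
  have hcM : c * P.M = P.κ / 32 := by rw [hc]; field_simp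
  have hc1 : c ≤ 1 / 32 := by nlinarith
  have hxI : x ∈ Icc P.α P.β := hxr ⟨by linarith, by linarith⟩
  obtain ⟨a₀, a₁, a₂, h0, h1, h2⟩ := exists_int_relation_near (u := P.f₁ x) (v := P.f₂ x)
    (η := η) (Q := c * η ^ 2 * q) hη hη1 (by linarith)
    (fun b₀ b₁ b₂ hb1 hb2 hb0 => by
      by_contra hne
      exact hx ⟨hxI, b₀, b₁, b₂, hb1, hb2, hb0, hne⟩) (by nlinarith) (-P.g x) (q / 2) 0
  have e1 : 2 / η ^ 2 * (c * η ^ 2 * q) = 2 * c * q := by field_simp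
  have e0 : 2 / η ^ 2 / (c * η ^ 2 * q) ^ 2 =
      P.κ / 8 * q * (16 / (c ^ 2 * P.κ) / η ^ 6 / q ^ 3) := by field_simp; norm_num
  rw [e1] at h1 h2
  rw [sub_zero] at h2
  have hcq : 2 * c * q ≤ q / 16 := by nlinarith
  obtain ⟨h1l, h1u⟩ := abs_le.1 h1
  have ha1 : 0 < (a₁ : ℝ) := by linarith
  have hder : ∀ t ∈ Icc (x - r) (x + r), P.κ / 8 * q ≤ |P.dF (a₁, a₂) t| := by
    intro t ht
    have htI := hxr ht
    have b1 : P.κ * (q / 4) ≤ |a₁ * P.df₁ t| := by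
      rw [abs_mul, abs_of_pos ha1, mul_comm]
      exact mul_le_mul (by linarith) (P.κ_le_df₁ t htI) hκ.le ha1.le
    have b2 : |a₂ * P.df₂ t| ≤ P.κ / 16 * q := by
      rw [abs_mul]
      calc _ ≤ 2 * c * q * P.M := by gcongr; exact P.df₂_le t htI
        _ = 2 * (c * P.M) * q := by ring
        _ = _ := by rw [hcM]; ring
    have b3 := P.dg_le t htI
    have b4 : P.κ / 2 * P.R₀ ≤ P.κ / 16 * q := by nlinarith
    have b5 := abs_sub_abs_le_abs_sub (a₁ * P.df₁ t) (-(a₂ * P.df₂ t + P.dg t))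
    have b6 := abs_add_le (a₂ * P.df₂ t) (P.dg t)
    rw [abs_neg, sub_neg_eq_add, ← add_assoc] at b5
    show P.κ / 8 * q ≤ |a₁ * P.df₁ t + a₂ * P.df₂ t + P.dg t|
    linarith
  obtain ⟨y, hy, hy0⟩ := exists_eq_zero_of_le_abs_deriv (F := fun t => P.F (a₁, a₂) t + a₀)
    (F' := P.dF (a₁, a₂)) hr (by positivity)
    (fun t ht => (hasDerivAt_F (a₁, a₂) (hxr ht)).add_const _) hder (by
      have : P.F (a₁, a₂) x + a₀ = a₀ + a₁ * P.f₁ x + a₂ * P.f₂ x - -P.g x := by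
        simp only [F]; ring
      rw [this]
      refine h0.trans ?_
      rw [e0]
      gcongr)
  refine ⟨y, ⟨hxr hy, (a₁, a₂), ?_, ?_, by linarith, a₀, hy0⟩, ?_⟩
  · rw [abs_of_pos ha1]; linarith
  · rw [abs_of_pos ha1]; linarith
  · rw [abs_le]; constructor <;> linarith [hy.1, hy.2]

theorem mem_approxSet_of_frequently {ψ : ℝ → ℝ} (hψdec : AntitoneOn ψ (Ioi 0)) {τ ε x : ℝ}
    (hε : 0 < ε) (hx : x ∈ Icc P.α P.β)
    (h : ∀ N : ℝ, ∃ q ≥ N, q ^ (-τ) ≤ ψ q ∧ ∃ y ∈ P.resonantSet q, |x - y| ≤ q ^ (-(τ + 1 + ε))) :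
    x ∈ P.approxSet ψ := by
  have hM := P.one_le_M
  refine ⟨hx, fun hfin => ?_⟩
  obtain ⟨B, hB⟩ := (hfin.image fun p => p.1.natAbs).bddAbove
  have hsmall : ∀ᶠ q : ℝ in atTop, q ^ (-ε) < 1 / (5 * P.M) :=
    (tendsto_rpow_neg_atTop hε).eventually (gt_mem_nhds (by positivity))
  obtain ⟨N, hN⟩ := eventually_atTop.1 (hsmall.and ((eventually_ge_atTop P.R₀).and
    (eventually_gt_atTop (4 * B + 4 : ℝ))))
  obtain ⟨q, hqN, hψq, y, ⟨hy, a, h1, h2, h3, z, hz⟩, hxy⟩ := h N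
  obtain ⟨hq1, hq2, hq3⟩ := hN q hqN
  have hq0 : 0 < q := by linarith [P.one_le_R₀]
  have hF : |P.F a x + z| < q ^ (-τ) := by
    have := abs_sub_le_of_abs_deriv_le (fun t ht => hasDerivAt_F a ht)
      (fun t ht => abs_dF_le hq2 (by linarith) (by linarith) ht) hx hy
    have e : P.F a x + z = P.F a x - P.F a y := by linarith
    rw [e]
    calc _ ≤ 5 * P.M * q * |x - y| := this
      _ ≤ 5 * P.M * q * q ^ (-(τ + 1 + ε)) := by gcongr
      _ = 5 * P.M * (q ^ (-ε) * q ^ (-τ)) := by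
          rw [← Real.rpow_add hq0, mul_assoc]
          nth_rewrite 1 [← Real.rpow_one q]
          rw [← Real.rpow_add hq0]
          congr 2; ring
      _ < 5 * P.M * (1 / (5 * P.M) * q ^ (-τ)) := by gcongr
      _ = _ := by field_simp
  have ha1 : |(a.1 : ℝ)| = a.1.natAbs := by rw [Nat.cast_natAbs, Int.cast_abs]
  have ha2 : |(a.2 : ℝ)| = a.2.natAbs := by rw [Nat.cast_natAbs, Int.cast_abs]
  have hapos : (B : ℝ) + 1 < a.1.natAbs := by rw [← ha1]; linarith
  have hmem : a ∈ {p : ℤ × ℤ | p ≠ 0 ∧ nearestIntDist (P.F p x) <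
      ψ ((max p.1.natAbs p.2.natAbs : ℕ) : ℝ)} := by
    refine ⟨fun h0 => ?_, ?_⟩
    · rw [h0] at hapos
      simp at hapos
      linarith [(Nat.cast_nonneg B : (0 : ℝ) ≤ B)]
    · have hle : ((max a.1.natAbs a.2.natAbs : ℕ) : ℝ) ≤ q := by
        push_cast
        rw [← ha1, ← ha2]
        exact max_le h2 h3
      have hpos : (0 : ℝ) < ((max a.1.natAbs a.2.natAbs : ℕ) : ℝ) := by
        have : (a.1.natAbs : ℝ) ≤ ((max a.1.natAbs a.2.natAbs : ℕ) : ℝ) := by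
          exact_mod_cast le_max_left _ _
        linarith [(Nat.cast_nonneg B : (0 : ℝ) ≤ B)]
      exact (nearestIntDist_le _ z).trans_lt
        (hF.trans_le (hψq.trans (hψdec hpos hq0 hle)))
  have h5 := hB (mem_image_of_mem _ hmem)
  have h6 : ((a.1.natAbs : ℕ) : ℝ) ≤ B := by exact_mod_cast h5
  linarith

end PhaseArc

namespace PhaseArc

theorem tendsto_log_sq_mul_rpow_neg {ε : ℝ} (hε : 0 < ε) :
    Tendsto (fun q : ℝ => (1 + 2 * Real.log q) ^ 2 * q ^ (-ε)) atTop (nhds 0) := by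
  have h := (isLittleO_log_rpow_atTop (half_pos hε)).tendsto_div_nhds_zero
  have h1 : Tendsto (fun q : ℝ => q ^ (-(ε / 2))) atTop (nhds 0) :=
    tendsto_rpow_neg_atTop (half_pos hε)
  have h2 := ((h1.add (h.const_mul 2)).pow 2)
  simp only [mul_zero, add_zero, ne_eq, OfNat.ofNat_ne_zero, not_false_eq_true, zero_pow] at h2
  refine h2.congr' ?_
  filter_upwards [eventually_gt_atTop 0] with q hq
  have e : q ^ (-ε) = (q ^ (-(ε / 2))) ^ 2 := by
    rw [← Real.rpow_natCast, ← Real.rpow_mul hq.le]; congr 1; push_cast; ring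
  rw [e, ← mul_pow, div_eq_mul_inv (Real.log q), ← Real.rpow_neg hq.le]
  ring

theorem ofReal_le_volume_resonant (P : PhaseArc) {ε : ℝ} (hε : 0 < ε) (hε2 : ε < 1 / 4)
    {x r : ℝ} (hr : 0 < r) (hxr : Metric.closedBall x r ⊆ Ioo P.α P.β) :
    ∀ᶠ q : ℝ in atTop, ENNReal.ofReal (r / 2) ≤ volume (Metric.ball x (r / 2) ∩
      ⋃ y ∈ P.resonantSet q, Metric.closedBall y (q ^ (-(3 - 7 * ε)))) := by
  obtain ⟨C, hC, hvol⟩ := P.exists_volume_relationSet_le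
  have hκ := P.κ_pos
  have hκ1 := P.κ_le
  have hM := P.one_le_M
  have hmesh := mesh_pos (P := P)
  set c := P.κ / (32 * P.M) with hc
  have hc0 : 0 < c := by positivity
  have hc1 : c ≤ 1 := by rw [hc, div_le_one (by positivity)]; linarith
  have t1 : ∀ᶠ q : ℝ in atTop, q ^ (-(1 - 3 * ε)) < min (c / 2) (c * P.mesh / 2) :=
    (tendsto_rpow_neg_atTop (by linarith)).eventually (gt_mem_nhds (by positivity))
  have t2 : ∀ᶠ q : ℝ in atTop, (1 + 2 * Real.log q) ^ 2 * q ^ (-ε) < r / 2 / C :=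
    (tendsto_log_sq_mul_rpow_neg hε).eventually (gt_mem_nhds (by positivity))
  have t3 : ∀ᶠ q : ℝ in atTop, q ^ (-ε) < 1 / (16 / (c ^ 2 * P.κ)) :=
    (tendsto_rpow_neg_atTop hε).eventually (gt_mem_nhds (by positivity))
  have t4 : ∀ᶠ q : ℝ in atTop, q ^ (-(3 - 7 * ε)) < r / 2 :=
    (tendsto_rpow_neg_atTop (by linarith)).eventually (gt_mem_nhds (by positivity))
  filter_upwards [t1, t2, t3, t4, eventually_ge_atTop (8 * P.R₀)] with q h1 h2 h3 h4 h5
  have hq1 : 1 ≤ q := by linarith [P.one_le_R₀]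
  have hq0 : 0 < q := by linarith
  set η := q ^ (-ε) with hη
  have hη0 : 0 < η := by positivity
  have hη1 : η ≤ 1 := Real.rpow_le_one_of_one_le_of_nonpos hq1 (by linarith)
  have hηpow : ∀ n : ℕ, η ^ n = q ^ (-(n * ε)) := fun n => by
    rw [hη, ← Real.rpow_natCast, ← Real.rpow_mul hq0.le]; congr 1; ring
  set Q := c * η ^ 2 * q with hQ
  have hηq : η ^ 3 * q * q ^ (-(1 - 3 * ε)) = 1 := by
    rw [hηpow, ← Real.rpow_add_one hq0.ne', ← Real.rpow_add hq0, ← Real.rpow_zero q]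
    congr 1; push_cast; ring
  have hηq0 : 0 < η ^ 3 * q := by positivity
  have hηQ2 : 2 ≤ η * Q := by
    have : 1 < η ^ 3 * q * (c / 2) := by
      rw [← hηq]; gcongr; exact lt_of_lt_of_le h1 (min_le_left _ _)
    rw [hQ]; nlinarith
  have hQ2 : 2 ≤ Q := by
    have : 0 ≤ Q := by positivity
    nlinarith
  have hmQ : 2 ≤ P.mesh * Q := by
    have h6 : 1 < η ^ 3 * q * (c * P.mesh / 2) := by
      rw [← hηq]; gcongr; exact lt_of_lt_of_le h1 (min_le_right _ _)
    have h7 : P.mesh * (η * Q) ≤ P.mesh * Q := by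
      gcongr; nlinarith
    have h8 : P.mesh * (η * Q) = 2 * (η ^ 3 * q * (c * P.mesh / 2)) := by rw [hQ]; ring
    linarith
  have hQq : Q ≤ q := by
    rw [hQ]
    have : c * η ^ 2 ≤ 1 := mul_le_one₀ hc1 (by positivity) (pow_le_one₀ hη0.le hη1)
    nlinarith
  have hbad : volume (P.relationSet (η * Q) (η / Q ^ 2)) ≤ ENNReal.ofReal (r / 2) := by
    refine (hvol η Q hη0 hη1 (by linarith) hmQ).trans (ENNReal.ofReal_le_ofReal ?_)
    have hl0 : 0 ≤ Real.log Q := Real.log_nonneg (by linarith)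
    have hl : Real.log Q ≤ Real.log q := Real.log_le_log (by linarith) hQq
    calc _ ≤ C * (1 + 2 * Real.log q) ^ 2 * η := by gcongr
      _ = C * ((1 + 2 * Real.log q) ^ 2 * η) := by ring
      _ ≤ C * (r / 2 / C) := by gcongr
      _ = _ := by field_simp
  have hrad : 16 / (c ^ 2 * P.κ) / η ^ 6 / q ^ 3 ≤ q ^ (-(3 - 7 * ε)) := by
    have e : q ^ (-(3 - 7 * ε)) = 1 / η / η ^ 6 / q ^ 3 := by
      rw [div_div 1, ← pow_succ', hηpow, ← Real.rpow_natCast q 3, one_div, ← Real.rpow_neg hq0.le,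
        ← Real.rpow_sub hq0]
      congr 1; push_cast; ring
    rw [e]
    gcongr ?_ / _ / _
    rw [le_one_div (by positivity) hη0]
    exact h3.le
  set ρ := q ^ (-(3 - 7 * ε)) with hρ
  have hρ0 : 0 < ρ := by positivity
  have hsub : Metric.ball x (r / 2) \ P.relationSet (η * Q) (η / Q ^ 2) ⊆
      Metric.ball x (r / 2) ∩ ⋃ y ∈ P.resonantSet q, Metric.closedBall y ρ := by
    rintro t ⟨ht, htbad⟩
    refine ⟨ht, ?_⟩
    have hball : Icc (t - ρ) (t + ρ) ⊆ Icc P.α P.β := by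
      refine subset_trans ?_ (hxr.trans Ioo_subset_Icc_self)
      intro w hw
      rw [Metric.mem_ball, Real.dist_eq] at ht
      obtain ⟨hta, htb⟩ := abs_lt.1 ht
      rw [Metric.mem_closedBall, Real.dist_eq, abs_le]
      constructor <;> linarith [hw.1, hw.2]
    obtain ⟨y, hy, hty⟩ := exists_resonant_near hc hη0 hη1 h5 hQ2 hρ0.le hball hrad htbad
    exact mem_biUnion hy (by rwa [Metric.mem_closedBall, Real.dist_eq])
  refine le_trans ?_ (measure_mono hsub)
  refine le_trans ?_ le_measure_sdiff
  rw [Real.volume_ball, mul_div_cancel₀ _ two_ne_zero]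
  calc ENNReal.ofReal (r / 2) = ENNReal.ofReal r - ENNReal.ofReal (r / 2) := by
        rw [← ENNReal.ofReal_sub _ (by positivity)]; congr 1; ring
    _ ≤ _ := tsub_le_tsub_left hbad _

theorem le_dimH_approxSet (P : PhaseArc) {ψ : ℝ → ℝ} (hψdec : AntitoneOn ψ (Ioi 0)) {s τ : ℝ}
    (hs : 0 < s) (hs1 : s < 1) (hτ : 2 ≤ τ) (hsτ : s * (τ + 1) < 3)
    (hψ : ∃ᶠ q in atTop, q ^ (-τ) ≤ ψ q) : ENNReal.ofReal s ≤ dimH (P.approxSet ψ) := by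
  set ε := (3 - s * (τ + 1)) / 16 with hε
  have hε0 : 0 < ε := by rw [hε]; linarith
  have hε1 : ε < 1 / 4 := by rw [hε]; nlinarith
  refine le_dimH_of_ubiquitous (ρ := 3 - 7 * ε) (v := τ + 1 + ε) hs hs1 (by linarith)
    (by linarith) (by nlinarith) P.lt (X := fun q => {y | q ^ (-τ) ≤ ψ q ∧ y ∈ P.resonantSet q})
    (fun x r hr hxr N => ?_) (fun x hx h => ?_)
  · obtain ⟨q, hq1, hq2, hq3⟩ := (hψ.and_eventually ((P.ofReal_le_volume_resonant hε0 hε1 hr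
      hxr).and (eventually_ge_atTop N))).exists
    refine ⟨q, hq3, hq2.trans (measure_mono ?_)⟩
    exact inter_subset_inter_right _ (biUnion_mono (fun y hy => ⟨hq1, hy⟩) fun _ _ => Subset.rfl)
  · refine mem_approxSet_of_frequently (τ := τ) hψdec hε0 (Ioo_subset_Icc_self hx) fun N => ?_
    obtain ⟨q, hqN, y, hy, hxy⟩ := h N
    exact ⟨q, hqN, hy.1, y, hy.2, hxy⟩

end PhaseArc

theorem hasDerivAt_derivWithin_Icc {f : ℝ → ℝ} {a b x : ℝ} (hf : ContDiffOn ℝ 2 f (Icc a b))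
    (hx : x ∈ Ioo a b) : HasDerivAt f (derivWithin f (Icc a b) x) x :=
  ((hf.differentiableOn two_ne_zero) x (Ioo_subset_Icc_self hx)).hasDerivWithinAt.hasDerivAt
    (Icc_mem_nhds hx.1 hx.2)

theorem hasDerivAt_iteratedDerivWithin_Icc {f : ℝ → ℝ} {a b x : ℝ}
    (hf : ContDiffOn ℝ 2 f (Icc a b)) (hx : x ∈ Ioo a b) :
    HasDerivAt (derivWithin f (Icc a b)) (iteratedDerivWithin 2 f (Icc a b) x) x := by
  have hu := uniqueDiffOn_Icc (hx.1.trans hx.2)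
  have h1 : iteratedDerivWithin 1 f (Icc a b) = derivWithin f (Icc a b) :=
    iteratedDerivWithin_one
  have h := hf.differentiableOn_iteratedDerivWithin (m := 1) (by norm_num) hu
  rw [h1] at h
  have h2 := (h x (Ioo_subset_Icc_self hx)).hasDerivWithinAt.hasDerivAt (Icc_mem_nhds hx.1 hx.2)
  rwa [iteratedDerivWithin_succ, h1]

theorem mul_max_abs_le_of_det {u₁ u₂ v₁ v₂ M : ℝ} (hM : 0 < M) (hu₁ : |u₁| ≤ M) (hu₂ : |u₂| ≤ M)
    (hv₁ : |v₁| ≤ M) (hv₂ : |v₂| ≤ M) (b₁ b₂ : ℝ) :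
    |u₁ * v₂ - u₂ * v₁| / (2 * M) * max |b₁| |b₂| ≤ |b₁ * u₁ + b₂ * u₂| ∨
      |u₁ * v₂ - u₂ * v₁| / (2 * M) * max |b₁| |b₂| ≤ |b₁ * v₁ + b₂ * v₂| := by
  set W := u₁ * v₂ - u₂ * v₁ with hW
  set p := b₁ * u₁ + b₂ * u₂ with hp
  set q := b₁ * v₁ + b₂ * v₂ with hq
  have key : ∀ b s t : ℝ, W * b = p * s - q * t → |s| ≤ M → |t| ≤ M →
      |W| * |b| ≤ 2 * M * max |p| |q| := by
    intro b s t h hs ht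
    rw [← abs_mul, h]
    have h1 : |p * s| ≤ max |p| |q| * M := by
      rw [abs_mul]; gcongr; exact le_max_left _ _
    have h2 : |q * t| ≤ max |p| |q| * M := by
      rw [abs_mul]; gcongr; exact le_max_right _ _
    linarith [abs_sub (p * s) (q * t)]
  have h1 := key b₁ v₂ u₂ (by rw [hW, hp, hq]; ring) hv₂ hu₂
  have h2 := key b₂ (-v₁) (-u₁) (by rw [hW, hp, hq]; ring) (by rwa [abs_neg]) (by rwa [abs_neg])
  rw [← le_max_iff, div_mul_eq_mul_div, div_le_iff₀' (by positivity), mul_max_of_nonneg _ _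
    (abs_nonneg W)]
  exact max_le h1 h2

theorem le_abs_comb_of_near {u₁ u₂ w₁ w₂ κ b₁ b₂ : ℝ}
    (h : 2 * κ * max |b₁| |b₂| ≤ |b₁ * u₁ + b₂ * u₂|) (h1 : |w₁ - u₁| ≤ κ / 2)
    (h2 : |w₂ - u₂| ≤ κ / 2) : κ * max |b₁| |b₂| ≤ |b₁ * w₁ + b₂ * w₂| := by
  have e : b₁ * u₁ + b₂ * u₂ = (b₁ * w₁ + b₂ * w₂) - (b₁ * (w₁ - u₁) + b₂ * (w₂ - u₂)) := by ring
  have h3 := abs_sub (b₁ * w₁ + b₂ * w₂) (b₁ * (w₁ - u₁) + b₂ * (w₂ - u₂))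
  have h4 := abs_add_le (b₁ * (w₁ - u₁)) (b₂ * (w₂ - u₂))
  have h5 : |b₁ * (w₁ - u₁)| ≤ max |b₁| |b₂| * (κ / 2) := by
    rw [abs_mul]; gcongr; exact le_max_left _ _
  have h6 : |b₂ * (w₂ - u₂)| ≤ max |b₁| |b₂| * (κ / 2) := by
    rw [abs_mul]; gcongr; exact le_max_right _ _
  rw [e] at h
  linarith

theorem exists_phaseArc_of_deriv_ne_zero {a b x₀ : ℝ} {f₁ f₂ g : ℝ → ℝ} (hx₀ : x₀ ∈ Ioo a b)
    (hf₁ : ContDiffOn ℝ 2 f₁ (Icc a b)) (hf₂ : ContDiffOn ℝ 2 f₂ (Icc a b))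
    (hg : ContDiffOn ℝ 2 g (Icc a b)) (hd : derivWithin f₁ (Icc a b) x₀ ≠ 0)
    (hW : derivWithin f₁ (Icc a b) x₀ * iteratedDerivWithin 2 f₂ (Icc a b) x₀ -
      derivWithin f₂ (Icc a b) x₀ * iteratedDerivWithin 2 f₁ (Icc a b) x₀ ≠ 0) :
    ∃ P : PhaseArc, x₀ ∈ Ioo P.α P.β ∧ Icc P.α P.β ⊆ Ioo a b ∧ P.f₁ = f₁ ∧ P.f₂ = f₂ ∧
      P.g = g := by
  set I := Icc a b with hI
  have hab : a < b := hx₀.1.trans hx₀.2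
  have hu : UniqueDiffOn ℝ I := uniqueDiffOn_Icc hab
  have hc0 : ∀ f : ℝ → ℝ, ContDiffOn ℝ 2 f I → ContinuousOn f I := fun f hf => hf.continuousOn
  have hc1 : ∀ f : ℝ → ℝ, ContDiffOn ℝ 2 f I → ContinuousOn (derivWithin f I) I := fun f hf =>
    hf.continuousOn_derivWithin hu (by norm_num)
  have hc2 : ∀ f : ℝ → ℝ, ContDiffOn ℝ 2 f I → ContinuousOn (iteratedDerivWithin 2 f I) I :=
    fun f hf => hf.continuousOn_iteratedDerivWithin (by norm_num) hu
  obtain ⟨M₀, hM₀⟩ := isCompact_Icc.exists_bound_of_continuousOn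
    (((((((hc0 f₁ hf₁).abs.add (hc0 f₂ hf₂).abs).add (hc1 f₁ hf₁).abs).add
      (hc1 f₂ hf₂).abs).add (hc2 f₁ hf₁).abs).add (hc2 f₂ hf₂).abs).add
      ((hc1 g hg).abs.add (hc2 g hg).abs))
  set M := max 1 M₀ with hM
  have hM1 : 1 ≤ M := le_max_left _ _
  have hbound : ∀ x ∈ I, |f₁ x| ≤ M ∧ |f₂ x| ≤ M ∧ |derivWithin f₁ I x| ≤ M ∧
      |derivWithin f₂ I x| ≤ M ∧ |iteratedDerivWithin 2 f₁ I x| ≤ M ∧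
      |iteratedDerivWithin 2 f₂ I x| ≤ M ∧ |derivWithin g I x| ≤ M ∧
      |iteratedDerivWithin 2 g I x| ≤ M := by
    intro x hx
    have h := (le_abs_self _).trans ((hM₀ x hx).trans (le_max_right 1 M₀))
    simp only [Pi.add_apply] at h
    rw [← hM] at h
    have n1 := abs_nonneg (f₁ x)
    have n2 := abs_nonneg (f₂ x)
    have n3 := abs_nonneg (derivWithin f₁ I x)
    have n4 := abs_nonneg (derivWithin f₂ I x)
    have n5 := abs_nonneg (iteratedDerivWithin 2 f₁ I x)
    have n6 := abs_nonneg (iteratedDerivWithin 2 f₂ I x)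
    have n7 := abs_nonneg (derivWithin g I x)
    have n8 := abs_nonneg (iteratedDerivWithin 2 g I x)
    refine ⟨?_, ?_, ?_, ?_, ?_, ?_, ?_, ?_⟩ <;> linarith
  set W := derivWithin f₁ I x₀ * iteratedDerivWithin 2 f₂ I x₀ -
      derivWithin f₂ I x₀ * iteratedDerivWithin 2 f₁ I x₀ with hWdef
  set κ := min 1 (min (|W| / (2 * M) / 2) (|derivWithin f₁ I x₀| / 2)) with hκ
  have hκ0 : 0 < κ := by
    have := abs_pos.2 hW
    have := abs_pos.2 hd
    rw [hκ]; positivity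
  have hκ1 : κ ≤ 1 := min_le_left _ _
  have hκW : 2 * κ ≤ |W| / (2 * M) := by
    have : κ ≤ |W| / (2 * M) / 2 := (min_le_right _ _).trans (min_le_left _ _)
    linarith
  have hκd : 2 * κ ≤ |derivWithin f₁ I x₀| := by
    have : κ ≤ |derivWithin f₁ I x₀| / 2 := (min_le_right _ _).trans (min_le_right _ _)
    linarith
  have hIn : I ∈ nhds x₀ := Icc_mem_nhds hx₀.1 hx₀.2
  have hnear : ∀ h : ℝ → ℝ, ContinuousOn h I → ∀ᶠ x in nhds x₀, |h x - h x₀| ≤ κ / 2 := by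
    intro h hh
    filter_upwards [(hh.continuousAt hIn).eventually (Metric.closedBall_mem_nhds _ (half_pos hκ0))]
      with x hx
    rwa [Real.dist_eq] at hx
  obtain ⟨r, hr, hball⟩ := Metric.nhds_basis_closedBall.mem_iff.1
    ((hnear _ (hc1 f₁ hf₁)).and ((hnear _ (hc1 f₂ hf₂)).and ((hnear _ (hc2 f₁ hf₁)).and
      ((hnear _ (hc2 f₂ hf₂)).and (Ioo_mem_nhds hx₀.1 hx₀.2)))))
  set t := min r (1 / 2) with ht
  have ht0 : 0 < t := by rw [ht]; positivity
  have ht1 : t ≤ 1 / 2 := min_le_right _ _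
  have hmem : ∀ x ∈ Icc (x₀ - t) (x₀ + t), _ := fun x hx => hball
    (Metric.closedBall_subset_closedBall (min_le_left r (1 / 2))
      (by rw [Real.closedBall_eq_Icc]; exact hx))
  have hIoo : Icc (x₀ - t) (x₀ + t) ⊆ Ioo a b := fun x hx => (hmem x hx).2.2.2.2
  have hIcc : Icc (x₀ - t) (x₀ + t) ⊆ I := hIoo.trans Ioo_subset_Icc_self
  have hR : M ≤ κ / 2 * (2 * M / κ) := by
    rw [show κ / 2 * (2 * M / κ) = M by field_simp]
  refine ⟨{
    α := x₀ - t, β := x₀ + t, κ := κ, M := M, R₀ := 2 * M / κ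
    f₁ := f₁, df₁ := derivWithin f₁ I, ddf₁ := iteratedDerivWithin 2 f₁ I
    f₂ := f₂, df₂ := derivWithin f₂ I, ddf₂ := iteratedDerivWithin 2 f₂ I
    g := g, dg := derivWithin g I, ddg := iteratedDerivWithin 2 g I
    lt := by linarith
    le_one := by linarith
    κ_pos := hκ0
    κ_le := hκ1
    one_le_M := hM1
    one_le_R₀ := by rw [one_le_div hκ0]; linarith
    hf₁ := fun x hx => hasDerivAt_derivWithin_Icc hf₁ (hIoo hx)
    hdf₁ := fun x hx => hasDerivAt_iteratedDerivWithin_Icc hf₁ (hIoo hx)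
    hf₂ := fun x hx => hasDerivAt_derivWithin_Icc hf₂ (hIoo hx)
    hdf₂ := fun x hx => hasDerivAt_iteratedDerivWithin_Icc hf₂ (hIoo hx)
    hg := fun x hx => hasDerivAt_derivWithin_Icc hg (hIoo hx)
    hdg := fun x hx => hasDerivAt_iteratedDerivWithin_Icc hg (hIoo hx)
    f₁_le := fun x hx => (hbound x (hIcc hx)).1
    f₂_le := fun x hx => (hbound x (hIcc hx)).2.1
    df₁_le := fun x hx => (hbound x (hIcc hx)).2.2.1
    df₂_le := fun x hx => (hbound x (hIcc hx)).2.2.2.1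
    ddf₁_le := fun x hx => (hbound x (hIcc hx)).2.2.2.2.1
    ddf₂_le := fun x hx => (hbound x (hIcc hx)).2.2.2.2.2.1
    dg_le := fun x hx => (hbound x (hIcc hx)).2.2.2.2.2.2.1.trans hR
    ddg_le := fun x hx => (hbound x (hIcc hx)).2.2.2.2.2.2.2.trans hR
    κ_le_df₁ := fun x hx => by
      have h1 := (hmem x hx).1
      have h2 := abs_sub_abs_le_abs_sub (derivWithin f₁ I x₀) (derivWithin f₁ I x)
      rw [abs_sub_comm] at h2
      linarith
    dichotomy := fun b₁ b₂ => by
      have h0 := hbound x₀ (Ioo_subset_Icc_self hx₀)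
      have hmono : 2 * κ * max |b₁| |b₂| ≤ |W| / (2 * M) * max |b₁| |b₂| := by gcongr
      rcases mul_max_abs_le_of_det (by linarith : 0 < M) h0.2.2.1 h0.2.2.2.1 h0.2.2.2.2.1
        h0.2.2.2.2.2.1 b₁ b₂ with h | h
      · exact Or.inl fun x hx =>
          le_abs_comb_of_near (hmono.trans h) (hmem x hx).1 (hmem x hx).2.1
      · exact Or.inr fun x hx =>
          le_abs_comb_of_near (hmono.trans h) (hmem x hx).2.2.1 (hmem x hx).2.2.2.1 },
    ⟨by simp only; linarith, by simp only; linarith⟩, hIoo, rfl, rfl, rfl⟩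

/-- The dual inhomogeneous `ψ`-approximable points of the curve `(f₁, f₂)`. -/
def dualApproxSet (a b : ℝ) (f₁ f₂ lam ψ : ℝ → ℝ) : Set ℝ :=
  {x ∈ Icc a b | {p : ℤ × ℤ | p ≠ 0 ∧
    nearestIntDist ((p.1 : ℝ) * f₁ x + (p.2 : ℝ) * f₂ x + lam x) <
      ψ ((max p.1.natAbs p.2.natAbs : ℕ) : ℝ)}.Infinite}

theorem dualApproxSet_swap (a b : ℝ) (f₁ f₂ lam ψ : ℝ → ℝ) :
    dualApproxSet a b f₁ f₂ lam ψ = dualApproxSet a b f₂ f₁ lam ψ := by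
  ext x
  refine and_congr_right fun _ => ?_
  rw [← Set.infinite_image_iff (Prod.swap_injective.injOn), Set.image_swap_eq_preimage_swap]
  refine iff_of_eq (congrArg _ ?_)
  ext p
  simp only [mem_preimage, mem_ofPred_eq, Prod.fst_swap, Prod.snd_swap, max_comm p.2.natAbs,
    add_comm ((p.2 : ℝ) * f₁ x)]
  refine and_congr_left fun _ => not_congr ?_
  rw [← Prod.swap_inj, Prod.swap_swap]; rfl

theorem exists_phaseArc {a b x₀ : ℝ} {f₁ f₂ g : ℝ → ℝ} (hx₀ : x₀ ∈ Ioo a b)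
    (hf₁ : ContDiffOn ℝ 2 f₁ (Icc a b)) (hf₂ : ContDiffOn ℝ 2 f₂ (Icc a b))
    (hg : ContDiffOn ℝ 2 g (Icc a b))
    (hW : derivWithin f₁ (Icc a b) x₀ * iteratedDerivWithin 2 f₂ (Icc a b) x₀ -
      derivWithin f₂ (Icc a b) x₀ * iteratedDerivWithin 2 f₁ (Icc a b) x₀ ≠ 0) :
    ∃ P : PhaseArc, x₀ ∈ Ioo P.α P.β ∧
      ∀ ψ, P.approxSet ψ = dualApproxSet a b f₁ f₂ g ψ ∩ Icc P.α P.β := by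
  have main : ∀ P : PhaseArc, Icc P.α P.β ⊆ Ioo a b → P.g = g → ∀ ψ,
      P.approxSet ψ = dualApproxSet a b P.f₁ P.f₂ g ψ ∩ Icc P.α P.β := by
    rintro P hP rfl ψ
    ext x
    exact ⟨fun h => ⟨⟨Ioo_subset_Icc_self (hP h.1), h.2⟩, h.1⟩, fun h => ⟨h.2, h.1.2⟩⟩
  by_cases hd : derivWithin f₁ (Icc a b) x₀ = 0
  · obtain ⟨P, hxP, hP, h1, h2, h3⟩ := exists_phaseArc_of_deriv_ne_zero hx₀ hf₂ hf₁ hg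
      (fun h => hW (by rw [hd, h]; ring)) (fun h => hW (by linarith))
    refine ⟨P, hxP, fun ψ => ?_⟩
    rw [main P hP h3 ψ, h1, h2, dualApproxSet_swap]
  · obtain ⟨P, hxP, hP, h1, h2, h3⟩ := exists_phaseArc_of_deriv_ne_zero hx₀ hf₁ hf₂ hg hd hW
    refine ⟨P, hxP, fun ψ => ?_⟩
    rw [main P hP h3 ψ, h1, h2]

theorem Real.bddAbove_and_nonempty_of_liminf_ne_zero {u : ℝ → ℝ} (h : liminf u atTop ≠ 0) :
    {c | ∀ᶠ q in atTop, c ≤ u q}.Nonempty ∧ BddAbove {c | ∀ᶠ q in atTop, c ≤ u q} := by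
  rw [liminf_eq] at h
  refine ⟨?_, ?_⟩
  · by_contra hc
    rw [not_nonempty_iff_eq_empty] at hc
    exact h (by rw [hc, Real.sSup_empty])
  · by_contra hc
    exact h (Real.sSup_of_not_bddAbove hc)

theorem eventually_le_rpow_of_lt_liminf {ψ : ℝ → ℝ} (hψpos : ∀ q : ℝ, 0 < q → 0 < ψ q) {c : ℝ}
    (h0 : liminf (fun q : ℝ => -Real.log (ψ q) / Real.log q) atTop ≠ 0)
    (hc : c < liminf (fun q : ℝ => -Real.log (ψ q) / Real.log q) atTop) :
    ∀ᶠ q in atTop, ψ q ≤ q ^ (-c) := by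
  obtain ⟨hne, -⟩ := Real.bddAbove_and_nonempty_of_liminf_ne_zero h0
  rw [liminf_eq] at hc
  obtain ⟨d, hd, hcd⟩ := exists_lt_of_lt_csSup hne hc
  filter_upwards [hd, eventually_gt_atTop 1] with q hq hq1
  have hq0 : 0 < q := by linarith
  rw [← Real.log_le_log_iff (hψpos q hq0) (by positivity), Real.log_rpow hq0]
  have := (le_div_iff₀ (Real.log_pos hq1)).1 (hcd.le.trans hq)
  linarith

theorem frequently_rpow_le_of_liminf_lt {ψ : ℝ → ℝ} (hψpos : ∀ q : ℝ, 0 < q → 0 < ψ q) {c : ℝ}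
    (h0 : liminf (fun q : ℝ => -Real.log (ψ q) / Real.log q) atTop ≠ 0)
    (hc : liminf (fun q : ℝ => -Real.log (ψ q) / Real.log q) atTop < c) :
    ∃ᶠ q in atTop, q ^ (-c) ≤ ψ q := by
  obtain ⟨-, hbdd⟩ := Real.bddAbove_and_nonempty_of_liminf_ne_zero h0
  have hf : ∃ᶠ q : ℝ in atTop, -Real.log (ψ q) / Real.log q < c := by
    intro hcon
    rw [liminf_eq] at hc
    exact hc.not_ge (le_csSup hbdd (hcon.mono fun q hq => not_lt.1 hq))
  refine (hf.and_eventually (eventually_gt_atTop 1)).mono ?_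
  rintro q ⟨hq, hq1⟩
  have hq0 : 0 < q := by linarith
  rw [← Real.log_le_log_iff (by positivity) (hψpos q hq0), Real.log_rpow hq0]
  have := (div_lt_iff₀ (Real.log_pos hq1)).1 hq
  linarith

/-- The parameters at which the curve `(f₁, f₂)` has vanishing Wronskian. -/
def degenerateSet (a b : ℝ) (f₁ f₂ : ℝ → ℝ) : Set ℝ :=
  {x ∈ Icc a b |
    derivWithin f₁ (Icc a b) x * iteratedDerivWithin 2 f₂ (Icc a b) x -
      derivWithin f₂ (Icc a b) x * iteratedDerivWithin 2 f₁ (Icc a b) x = 0}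

theorem dimH_dualApproxSet_le {a b : ℝ} {f₁ f₂ lam ψ : ℝ → ℝ}
    (hf₁ : ContDiffOn ℝ 2 f₁ (Icc a b)) (hf₂ : ContDiffOn ℝ 2 f₂ (Icc a b))
    (hlam : ContDiffOn ℝ 2 lam (Icc a b)) (hψpos : ∀ q : ℝ, 0 < q → 0 < ψ q)
    (hψdec : AntitoneOn ψ (Ioi 0)) {s τ : ℝ} (hs0 : 0 < s) (hs1 : s ≤ 1) (hτ : 1 < τ)
    (hsτ : 3 < s * (τ + 1)) (hψ : ∀ᶠ q in atTop, ψ q ≤ q ^ (-τ))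
    (hW : dimH (degenerateSet a b f₁ f₂) ≤ ENNReal.ofReal s) :
    dimH (dualApproxSet a b f₁ f₂ lam ψ) ≤ ENNReal.ofReal s := by
  set D := degenerateSet a b f₁ f₂
  set A := dualApproxSet a b f₁ f₂ lam ψ
  have hcover : A ⊆ (D ∪ {a, b}) ∪ (A ∩ (Ioo a b \ D)) := by
    intro x hx
    by_cases hxD : x ∈ D
    · exact Or.inl (Or.inl hxD)
    · rcases eq_or_lt_of_le hx.1.1 with h | h
      · exact Or.inl (Or.inr (Or.inl h.symm))
      · rcases eq_or_lt_of_le hx.1.2 with h' | h'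
        · exact Or.inl (Or.inr (Or.inr h'))
        · exact Or.inr ⟨hx, ⟨h, h'⟩, hxD⟩
  refine (dimH_mono hcover).trans ?_
  rw [dimH_union, dimH_union, dimH_finite (Set.toFinite {a, b})]
  refine max_le (max_le hW zero_le) ?_
  by_contra! hcon
  obtain ⟨x, ⟨hxA, hxI, hxD⟩, hx⟩ := exists_mem_nhdsWithin_lt_dimH_of_lt_dimH hcon
  obtain ⟨P, hxP, hP⟩ := exists_phaseArc hxI hf₁ hf₂ hlam
    (fun h => hxD ⟨Ioo_subset_Icc_self hxI, h⟩)
  refine (hx _ (inter_mem self_mem_nhdsWithin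
    (mem_nhdsWithin_of_mem_nhds (Icc_mem_nhds hxP.1 hxP.2)))).not_ge ?_
  refine le_trans (dimH_mono ?_) (P.dimH_approxSet_le hψpos hψdec hs0 hs1 hτ hsτ hψ)
  rw [hP]
  exact fun y hy => ⟨hy.1.1, hy.2⟩

theorem le_dimH_dualApproxSet {a b : ℝ} (hab : a < b) {f₁ f₂ lam ψ : ℝ → ℝ}
    (hf₁ : ContDiffOn ℝ 2 f₁ (Icc a b)) (hf₂ : ContDiffOn ℝ 2 f₂ (Icc a b))
    (hlam : ContDiffOn ℝ 2 lam (Icc a b)) (hψdec : AntitoneOn ψ (Ioi 0)) {s τ : ℝ} (hs0 : 0 < s)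
    (hs1 : s < 1) (hτ : 2 ≤ τ) (hsτ : s * (τ + 1) < 3) (hψ : ∃ᶠ q in atTop, q ^ (-τ) ≤ ψ q)
    (hW : dimH (degenerateSet a b f₁ f₂) < 1) :
    ENNReal.ofReal s ≤ dimH (dualApproxSet a b f₁ f₂ lam ψ) := by
  obtain ⟨x, hxI, hxD⟩ : ∃ x ∈ Ioo a b, x ∉ degenerateSet a b f₁ f₂ := by
    by_contra! hcon
    refine hW.not_ge ((dimH_mono (s := Ioo a b) hcon).trans' ?_)
    rw [Real.dimH_of_nonempty_interior (by rw [interior_Ioo]; exact nonempty_Ioo.2 hab)]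
    simp
  obtain ⟨P, -, hP⟩ := exists_phaseArc hxI hf₁ hf₂ hlam
    (fun h => hxD ⟨Ioo_subset_Icc_self hxI, h⟩)
  refine (P.le_dimH_approxSet hψdec hs0 hs1 hτ hsτ hψ).trans (dimH_mono ?_)
  rw [hP]
  exact inter_subset_left

theorem stmt_3 (a b : ℝ) (hab : a < b)
    (f₁ f₂ lam : ℝ → ℝ)
    (hf₁ : ContDiffOn ℝ 2 f₁ (Icc a b)) (hf₂ : ContDiffOn ℝ 2 f₂ (Icc a b))
    (hlam : ContDiffOn ℝ 2 lam (Icc a b))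
    (ψ : ℝ → ℝ) (hψpos : ∀ q : ℝ, 0 < q → 0 < ψ q)
    (hψdec : AntitoneOn ψ (Ioi 0))
    (τ : ℝ) (hτ : τ = liminf (fun q : ℝ => -Real.log (ψ q) / Real.log q) atTop)
    (hτ2 : 2 ≤ τ)
    (hW : dimH {x ∈ Icc a b |
        derivWithin f₁ (Icc a b) x * iteratedDerivWithin 2 f₂ (Icc a b) x -
          derivWithin f₂ (Icc a b) x * iteratedDerivWithin 2 f₁ (Icc a b) x = 0} <
      ENNReal.ofReal (3 / (τ + 1))) :
    dimH {x ∈ Icc a b |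
        {p : ℤ × ℤ | p ≠ 0 ∧
          nearestIntDist ((p.1 : ℝ) * f₁ x + (p.2 : ℝ) * f₂ x + lam x) <
            ψ ((max p.1.natAbs p.2.natAbs : ℕ) : ℝ)}.Infinite} =
      ENNReal.ofReal (3 / (τ + 1)) := by
  have h0 : liminf (fun q : ℝ => -Real.log (ψ q) / Real.log q) atTop ≠ 0 := by
    rw [← hτ]; linarith
  have hτ1 : 0 < τ + 1 := by linarith
  have ht1 : 3 / (τ + 1) ≤ 1 := (div_le_one hτ1).2 (by linarith)
  change dimH (dualApproxSet a b f₁ f₂ lam ψ) = _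
  change dimH (degenerateSet a b f₁ f₂) < _ at hW
  apply le_antisymm
  · refine le_of_forall_gt_imp_ge_of_dense fun r hr => ?_
    obtain ⟨s, hs0, hts, hsr⟩ := ENNReal.lt_iff_exists_real_btwn.1 hr
    rw [ENNReal.ofReal_lt_ofReal_iff_of_nonneg (by positivity)] at hts
    refine le_trans ?_ hsr.le
    rcases le_or_gt 1 s with hs1 | hs1
    · refine (dimH_mono (subset_univ _)).trans ?_
      rwa [Real.dimH_univ, ENNReal.one_le_ofReal]
    · have hs : 0 < s := lt_trans (by positivity) hts
      have h3 : 3 / s - 1 < τ := by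
        rw [div_lt_iff₀ hτ1, ← div_lt_iff₀' hs] at hts
        linarith
      obtain ⟨c, hc, hcτ⟩ := exists_between h3
      have hc3 : 3 < s * (c + 1) := by
        rw [← div_lt_iff₀' hs]; linarith
      exact dimH_dualApproxSet_le hf₁ hf₂ hlam hψpos hψdec hs hs1.le (by nlinarith) hc3
        (eventually_le_rpow_of_lt_liminf hψpos h0 (hτ ▸ hcτ))
        (hW.le.trans (ENNReal.ofReal_le_ofReal hts.le))
  · refine le_of_forall_lt_imp_le_of_dense fun r hr => ?_
    obtain ⟨s, hs0, hrs, hst⟩ := ENNReal.lt_iff_exists_real_btwn.1 hr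
    refine hrs.le.trans ?_
    rw [ENNReal.ofReal_lt_ofReal_iff (by positivity)] at hst
    rcases hs0.eq_or_lt with rfl | hs
    · simp
    · have h3 : τ < 3 / s - 1 := by
        rw [lt_div_iff₀ hτ1, ← lt_div_iff₀' hs] at hst
        linarith
      obtain ⟨c, hcτ, hc⟩ := exists_between h3
      have hc3 : s * (c + 1) < 3 := by
        rw [← lt_div_iff₀' hs]; linarith
      exact le_dimH_dualApproxSet hab hf₁ hf₂ hlam hψdec hs (hst.trans_le ht1)
        (hτ2.trans hcτ.le) hc3 (frequently_rpow_le_of_liminf_lt hψpos h0 (hτ ▸ hcτ))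
        (hW.trans_le (ENNReal.ofReal_le_one.2 ht1))
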